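/- In d = 3, as r → 0, the Brownian loop measure of the set of loops intersecting both the unit sphere and the sphere of radius r equals (1 + O(r))·r; in particular it is asymptotically equivalent to r. -/

import Mathlib

open MeasureTheory Real

/-- Borel σ-algebra on the space of continuous paths `C(ℝ, ℝ^d)` (compact-open topology). -/
noncomputable instance pathSpaceMeasurableSpace (d : ℕ) :
    MeasurableSpace C(ℝ, EuclideanSpace ℝ (Fin d)) := borel _

/-- The heat kernel `p_t(x,y) = (2πt)^{-d/2} exp(-‖x-y‖²/(2t))` in `ℝ^d`. -/
noncomputable def heatKernel (d : ℕ) (t : ℝ) (x y : EuclideanSpace ℝ (Fin d)) : ℝ :=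
  (2 * π * t) ^ (-(d:ℝ)/2) * Real.exp (-‖x - y‖ ^ 2 / (2 * t))

/-- `Q` is the law `P^{x,x;T}` of the Brownian bridge of duration `T` from `x` to `x` in
`ℝ^d`, viewed as a probability measure on continuous paths which sit at `x` outside `(0, T)`:
its finite-dimensional distributions at times `0 < t₁ < ⋯ < t_k < T` have density
`(2πT)^{d/2} ∏_{j=0}^k p_{t_{j+1}−t_j}(z_j, z_{j+1})` (with `t₀ = 0`, `t_{k+1} = T`,
`z₀ = z_{k+1} = x`) with respect to Lebesgue measure. -/
def IsBrownianBridge (d : ℕ) (x : EuclideanSpace ℝ (Fin d)) (T : ℝ)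
    (Q : Measure C(ℝ, EuclideanSpace ℝ (Fin d))) : Prop :=
  IsProbabilityMeasure Q ∧
  (∀ᵐ w ∂Q, w 0 = x ∧ ∀ s : ℝ, s ∉ Set.Ioo 0 T → w s = x) ∧
  ∀ (k : ℕ) (t : Fin k → ℝ), StrictMono t → (∀ j, t j ∈ Set.Ioo 0 T) →
    Q.map (fun w => fun j => w (t j))
      = (Measure.pi fun _ : Fin k => (volume : Measure (EuclideanSpace ℝ (Fin d)))).withDensity
          (fun z =>
            let tt : Fin (k+2) → ℝ := Fin.snoc (Fin.cons 0 t) T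
            let zz : Fin (k+2) → EuclideanSpace ℝ (Fin d) := Fin.snoc (Fin.cons x z) x
            ENNReal.ofReal ((2 * π * T) ^ ((d:ℝ)/2) *
              ∏ j : Fin (k+1), heatKernel d (tt j.succ - tt j.castSucc) (zz j.castSucc) (zz j.succ)))

/-- `μ` is the Brownian loop measure in `ℝ³`:
`μ^loop = ∫_{ℝ³} dx ∫₀^∞ (dt/t) (2πt)^{−3/2} P^{x,x;t}`, where `Q x t = P^{x,x;t}` is the
Brownian bridge of duration `t` from `x` to `x`. -/
def IsBrownianLoopMeasure (μ : Measure C(ℝ, EuclideanSpace ℝ (Fin 3))) : Prop :=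
  ∃ Q : EuclideanSpace ℝ (Fin 3) → ℝ → Measure C(ℝ, EuclideanSpace ℝ (Fin 3)),
    (∀ x t, 0 < t → IsBrownianBridge 3 x t (Q x t)) ∧
    ∀ A : Set C(ℝ, EuclideanSpace ℝ (Fin 3)), MeasurableSet A →
      μ A = ∫⁻ x, ∫⁻ t in Set.Ioi (0:ℝ),
        ENNReal.ofReal (t⁻¹ * (2 * π * t) ^ (-(3:ℝ)/2)) * Q x t A ∂volume ∂volume

namespace LoopAux
open Set Filter Topology
open scoped ENNReal

/-- three-dimensional Euclidean space -/
abbrev X := EuclideanSpace ℝ (Fin 3)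

/-- radial profile of the heat kernel -/
noncomputable def fk (t d : ℝ) : ℝ≥0∞ :=
  ENNReal.ofReal ((2 * π * t) ^ (-(3:ℝ)/2) * Real.exp (-d ^ 2 / (2 * t)))

/-- heat kernel with values in `ℝ≥0∞` -/
noncomputable def pk (t : ℝ) (x y : X) : ℝ≥0∞ := ENNReal.ofReal (heatKernel 3 t x y)

lemma pk_eq_fk (t : ℝ) (x y : X) : pk t x y = fk t ‖x - y‖ := by
  simp [pk, fk, heatKernel]

lemma pk_symm (t : ℝ) (x y : X) : pk t x y = pk t y x := by
  rw [pk_eq_fk, pk_eq_fk, norm_sub_rev]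

lemma measurable_fk : Measurable (fun q : ℝ × ℝ => fk q.1 q.2) := by
  unfold fk
  fun_prop

@[fun_prop]
lemma measurable_fk' {α : Type*} [MeasurableSpace α] {t d : α → ℝ}
    (ht : Measurable t) (hd : Measurable d) : Measurable (fun a => fk (t a) (d a)) :=
  measurable_fk.comp (ht.prodMk hd)

lemma measurable_pk : Measurable (fun q : ℝ × X × X => pk q.1 q.2.1 q.2.2) := by
  simp only [pk_eq_fk]
  exact measurable_fk.comp (by fun_prop : Measurable (fun q : ℝ × X × X => (q.1, ‖q.2.1 - q.2.2‖)))

@[fun_prop]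
lemma measurable_pk' {α : Type*} [MeasurableSpace α] {t : α → ℝ} {x y : α → X}
    (ht : Measurable t) (hx : Measurable x) (hy : Measurable y) :
    Measurable (fun a => pk (t a) (x a) (y a)) :=
  measurable_pk.comp (ht.prodMk (hx.prodMk hy))

lemma lintegral_gauss {b : ℝ} (hb : 0 < b) :
    ∫⁻ y : X, ENNReal.ofReal (Real.exp (-b * ‖y‖ ^ 2)) = ENNReal.ofReal ((π / b) ^ ((3:ℝ) / 2)) := by
  have h := GaussianFourier.integral_rexp_neg_mul_sq_norm (V := X) hb
  simp only [finrank_euclideanSpace, Fintype.card_fin] at h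
  rw [← ofReal_integral_eq_lintegral_ofReal, h]
  · norm_num
  · by_contra hc
    rw [integral_undef hc] at h
    have : (0:ℝ) < (π / b) ^ (((3:ℕ):ℝ) / 2) := by positivity
    linarith
  · exact Eventually.of_forall fun _ => (Real.exp_pos _).le

lemma lintegral_pk {t : ℝ} (ht : 0 < t) (x : X) : ∫⁻ y, pk t x y = 1 := by
  have h1 : ∀ y, pk t x y = ENNReal.ofReal ((2 * π * t) ^ (-(3:ℝ)/2)) *
      ENNReal.ofReal (Real.exp (-(1/(2*t)) * ‖y - x‖ ^ 2)) := by
    intro y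
    rw [pk_eq_fk, fk, norm_sub_rev, ENNReal.ofReal_mul (by positivity)]
    congr 4
    field_simp
  simp_rw [h1]
  rw [lintegral_const_mul _ (by fun_prop),
    lintegral_sub_right_eq_self (fun y : X => ENNReal.ofReal (Real.exp (-(1/(2*t)) * ‖y‖ ^ 2))) x,
    lintegral_gauss (by positivity), ← ENNReal.ofReal_mul (by positivity)]
  have : π / (1 / (2 * t)) = 2 * π * t := by field_simp
  rw [this, ← Real.rpow_add (by positivity)]
  norm_num

lemma lintegral_pk' {t : ℝ} (ht : 0 < t) (x : X) : ∫⁻ y, pk t y x = 1 := by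
  simp_rw [pk_symm t _ x]; exact lintegral_pk ht x

lemma norm_identity (s t : ℝ) (hs : 0 < s) (ht : 0 < t) (x y z : X) :
    -‖x - z‖ ^ 2 / (2 * s) + -‖z - y‖ ^ 2 / (2 * t) =
    -‖x - y‖ ^ 2 / (2 * (s + t)) +
      -‖z - ((t / (s+t)) • x + (s / (s+t)) • y)‖ ^ 2 / (2 * (s * t / (s + t))) := by
  have hst : 0 < s + t := by positivity
  have key : ∀ u w : X, ‖u‖ ^ 2 / (2 * s) + ‖w‖ ^ 2 / (2 * t) =
      ‖u + w‖ ^ 2 / (2 * (s + t)) + ‖(s / (s+t)) • w - (t / (s+t)) • u‖ ^ 2 / (2 * (s * t / (s + t))) := by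
    intro u w
    rw [norm_add_sq_real, norm_sub_sq_real, norm_smul, norm_smul, inner_smul_left, inner_smul_right,
      real_inner_comm u w]
    simp only [Real.norm_eq_abs, mul_pow, sq_abs, conj_trivial]
    field_simp
    ring
  have h := key (x - z) (z - y)
  have e1 : x - z + (z - y) = x - y := by abel
  have e2 : (s / (s+t)) • (z - y) - (t / (s+t)) • (x - z) = z - ((t / (s+t)) • x + (s / (s+t)) • y) := by
    have : (s / (s+t)) + (t/(s+t)) = 1 := by field_simp
    have h2 : z = ((s / (s+t)) + (t/(s+t))) • z := by rw [this, one_smul]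
    conv_rhs => rw [h2]
    module
  rw [e1, e2] at h
  simp only [neg_div]
  linarith

lemma pk_comp {s t : ℝ} (hs : 0 < s) (ht : 0 < t) (x y : X) :
    ∫⁻ z, pk s x z * pk t z y = pk (s + t) x y := by
  have hst : 0 < s + t := by positivity
  set m : X := (t / (s+t)) • x + (s / (s+t)) • y with hm
  have h1 : ∀ z, pk s x z * pk t z y = pk (s + t) x y * pk (s * t / (s + t)) m z := by
    intro z
    rw [pk_eq_fk, pk_eq_fk, pk_eq_fk, pk_eq_fk, fk, fk, fk, fk, ← ENNReal.ofReal_mul (by positivity),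
      ← ENNReal.ofReal_mul (by positivity)]
    congr 1
    have e := norm_identity s t hs ht x y z
    rw [← hm, norm_sub_rev z m] at e
    rw [mul_mul_mul_comm, ← Real.exp_add, e, Real.exp_add,
      mul_mul_mul_comm ((2 * π * (s+t)) ^ (-(3:ℝ)/2))]
    congr 1
    rw [← Real.mul_rpow (by positivity) (by positivity), ← Real.mul_rpow (by positivity) (by positivity)]
    congr 1
    field_simp
  simp_rw [h1]
  rw [lintegral_const_mul _ (by fun_prop), lintegral_pk (by positivity), mul_one]

lemma pk_le {t : ℝ} (ht : 0 < t) (x y : X) :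
    pk t x y ≤ ENNReal.ofReal ((2 * π * t) ^ (-(3:ℝ)/2)) := by
  rw [pk_eq_fk, fk]
  apply ENNReal.ofReal_le_ofReal
  have : Real.exp (-‖x - y‖ ^ 2 / (2 * t)) ≤ 1 := by
    rw [Real.exp_le_one_iff]
    exact div_nonpos_of_nonpos_of_nonneg (by simp) (by positivity)
  have h2 : 0 ≤ (2 * π * t) ^ (-(3:ℝ)/2) := by positivity
  nlinarith

lemma pk_ne_top (t : ℝ) (x y : X) : pk t x y ≠ ∞ := ENNReal.ofReal_ne_top

/-- Gaussian tail bound: off the `η`-ball, `p_t ≤ tl η t * p_{2t}`. -/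
noncomputable def tl (η t : ℝ) : ℝ≥0∞ := ENNReal.ofReal ((2:ℝ) ^ ((3:ℝ)/2) * Real.exp (-η ^ 2 / (4 * t)))

lemma pk_tail {t s η : ℝ} (hs : 0 < s) (hst : s ≤ t) (hη : 0 ≤ η) {x y : X} (h : η ≤ ‖x - y‖) :
    pk s x y ≤ tl η t * pk (2 * s) x y := by
  have ht : 0 < t := hs.trans_le hst
  rw [pk_eq_fk, pk_eq_fk, fk, fk, tl, ← ENNReal.ofReal_mul (by positivity)]
  apply ENNReal.ofReal_le_ofReal
  have e1 : (2 * π * (2 * s)) ^ (-(3:ℝ)/2) = (2:ℝ) ^ (-(3:ℝ)/2) * (2 * π * s) ^ (-(3:ℝ)/2) := by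
    rw [← Real.mul_rpow (by positivity) (by positivity)]; ring_nf
  have e2 : (2:ℝ) ^ ((3:ℝ)/2) * (2:ℝ) ^ (-(3:ℝ)/2) = 1 := by
    rw [← Real.rpow_add (by positivity)]; norm_num
  have e3 : Real.exp (-‖x - y‖ ^ 2 / (2 * s)) ≤
      Real.exp (-η ^ 2 / (4 * t)) * Real.exp (-‖x - y‖ ^ 2 / (2 * (2 * s))) := by
    rw [← Real.exp_add, Real.exp_le_exp]
    have a1 : -‖x - y‖ ^ 2 / (2 * s) = -(‖x - y‖ ^ 2 / (4 * s)) + -‖x - y‖ ^ 2 / (2 * (2 * s)) := by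
      field_simp; ring
    have a2 : η ^ 2 / (4 * t) ≤ ‖x - y‖ ^ 2 / (4 * s) := by gcongr
    rw [a1, neg_div (4 * t)]
    linarith
  calc _ ≤ (2 * π * s) ^ (-(3:ℝ)/2) * (Real.exp (-η ^ 2 / (4 * t)) * Real.exp (-‖x - y‖ ^ 2 / (2 * (2 * s)))) := by
        gcongr
    _ = ((2:ℝ) ^ ((3:ℝ)/2) * (2:ℝ) ^ (-(3:ℝ)/2)) * (2 * π * s) ^ (-(3:ℝ)/2) * (Real.exp (-η ^ 2 / (4 * t)) * Real.exp (-‖x - y‖ ^ 2 / (2 * (2 * s)))) := by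
        rw [e2, one_mul]
    _ = _ := by rw [e1]; ring

lemma lintegral_Ioi_scale {c : ℝ} (hc : 0 < c) (F : ℝ → ℝ≥0∞) :
    ∫⁻ s in Ioi 0, F (c * s) = ENNReal.ofReal c⁻¹ * ∫⁻ t in Ioi 0, F t := by
  have h := Real.map_volume_mul_left hc.ne'
  have hemb : MeasurableEmbedding (fun s : ℝ => c * s) :=
    (Homeomorph.mulLeft₀ c hc.ne').measurableEmbedding
  have h2 := hemb.lintegral_map (μ := volume) ((Ioi 0).indicator F)
  rw [h, lintegral_smul_measure, lintegral_indicator measurableSet_Ioi, abs_of_pos (inv_pos.2 hc)] at h2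
  rw [smul_eq_mul] at h2
  rw [h2, ← lintegral_indicator measurableSet_Ioi]
  congr 1; ext s
  simp only [indicator, mem_Ioi, mul_pos_iff_of_pos_left hc]

lemma fk_scale {d t : ℝ} (hd : 0 < d) (ht : 0 < t) :
    fk (d ^ 2 * t) d = ENNReal.ofReal (d⁻¹ ^ 3) * fk t 1 := by
  rw [fk, fk, ← ENNReal.ofReal_mul (by positivity)]
  congr 1
  have e1 : (2 * π * (d ^ 2 * t)) ^ (-(3:ℝ)/2) = d⁻¹ ^ 3 * (2 * π * t) ^ (-(3:ℝ)/2) := by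
    have : 2 * π * (d ^ 2 * t) = d ^ 2 * (2 * π * t) := by ring
    rw [this, Real.mul_rpow (by positivity) (by positivity)]
    congr 1
    rw [← Real.rpow_natCast d 2, ← Real.rpow_mul hd.le, inv_pow, ← Real.rpow_natCast d 3, ← Real.rpow_neg hd.le]
    norm_num
  rw [e1, mul_assoc]
  congr 3
  field_simp

/-- the constant `∫₀^∞ (2πs)^{-3/2} e^{-1/(2s)} ds` -/
noncomputable def C0 : ℝ≥0∞ := ∫⁻ s in Ioi 0, fk s 1

lemma fk_le_rpow {t : ℝ} (ht : 0 < t) (d : ℝ) : fk t d ≤ ENNReal.ofReal (t ^ (-(3:ℝ)/2)) := by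
  rw [fk]
  apply ENNReal.ofReal_le_ofReal
  have h1 : Real.exp (-d ^ 2 / (2 * t)) ≤ 1 := by
    rw [Real.exp_le_one_iff]
    exact div_nonpos_of_nonpos_of_nonneg (by simp [sq_nonneg]) (by positivity)
  have h2 : (2 * π * t) ^ (-(3:ℝ)/2) ≤ t ^ (-(3:ℝ)/2) := by
    apply Real.rpow_le_rpow_of_nonpos ht _ (by norm_num)
    nlinarith [Real.pi_gt_three]
  calc _ ≤ t ^ (-(3:ℝ)/2) * 1 := by gcongr
    _ = _ := mul_one _

lemma fk_one_le {t : ℝ} (ht : 0 < t) : fk t 1 ≤ ENNReal.ofReal 16 := by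
  rw [fk]
  apply ENNReal.ofReal_le_ofReal
  have h0 : (1 / (2 * t)) ^ 2 / 2 ≤ Real.exp (1 / (2 * t)) := by
    have := Real.quadratic_le_exp_of_nonneg (show 0 ≤ 1 / (2 * t) by positivity)
    have h3 : 0 ≤ 1 / (2 * t) := by positivity
    linarith
  have h1 : Real.exp (-1 ^ 2 / (2 * t)) ≤ 8 * t ^ 2 := by
    have : -1 ^ 2 / (2 * t) = -(1 / (2 * t)) := by ring
    rw [this, Real.exp_neg, inv_le_comm₀ (Real.exp_pos _) (by positivity)]
    refine le_trans (le_of_eq ?_) h0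
    field_simp
    norm_num
  have h1' : Real.exp (-1 ^ 2 / (2 * t)) ≤ 1 := by
    rw [Real.exp_le_one_iff]
    exact div_nonpos_of_nonpos_of_nonneg (by norm_num) (by positivity)
  have h2 : (2 * π * t) ^ (-(3:ℝ)/2) ≤ t ^ (-(3:ℝ)/2) := by
    apply Real.rpow_le_rpow_of_nonpos ht _ (by norm_num)
    nlinarith [Real.pi_gt_three]
  have h4 : 0 ≤ t ^ (-(3:ℝ)/2) := by positivity
  rcases le_total t 1 with h | h
  · have h3 : t ^ (-(3:ℝ)/2) * (8 * t ^ 2) ≤ 8 := by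
      have : t ^ (-(3:ℝ)/2) * (8 * t ^ 2) = 8 * t ^ ((1:ℝ)/2) := by
        rw [mul_left_comm, ← Real.rpow_natCast t 2, ← Real.rpow_add ht]; norm_num
      rw [this]
      have := Real.rpow_le_one ht.le h (show (0:ℝ) ≤ 1/2 by norm_num)
      linarith
    calc _ ≤ t ^ (-(3:ℝ)/2) * (8 * t ^ 2) := by gcongr
      _ ≤ 16 := by linarith
  · have h3 : t ^ (-(3:ℝ)/2) ≤ 1 := Real.rpow_le_one_of_one_le_of_nonpos h (by norm_num)
    calc _ ≤ t ^ (-(3:ℝ)/2) * 1 := by gcongr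
      _ ≤ 16 := by linarith

/-- integrable majorant for the profile -/
noncomputable def maj (t : ℝ) : ℝ≥0∞ := if t ≤ 1 then ENNReal.ofReal 16 else ENNReal.ofReal (t ^ (-(3:ℝ)/2))

lemma lintegral_maj : ∫⁻ t in Ioi 0, maj t ≠ ∞ := by
  have h1 : Ioi (0:ℝ) = Ioc 0 1 ∪ Ioi 1 := (Ioc_union_Ioi_eq_Ioi zero_le_one).symm
  rw [h1]
  refine ne_top_of_le_ne_top ?_ (lintegral_union_le _ _ _)
  refine ENNReal.add_ne_top.2 ⟨?_, ?_⟩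
  · rw [setLIntegral_congr_fun (g := fun _ => ENNReal.ofReal 16) measurableSet_Ioc (fun t ht => by simp [maj, ht.2])]
    simp
  · rw [setLIntegral_congr_fun (g := fun t => ENNReal.ofReal (t ^ (-(3:ℝ)/2))) measurableSet_Ioi (fun t ht => by
      have : ¬ t ≤ 1 := not_le.2 ht
      simp [maj, this])]
    have := (integrableOn_Ioi_rpow_of_lt (show (-(3:ℝ)/2) < -1 by norm_num) zero_lt_one)
    exact this.lintegral_lt_top.ne

lemma fk_le_maj {s t : ℝ} (ht : 0 < t) (hst : t ≤ s) : fk s 1 ≤ maj t := by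
  unfold maj
  split_ifs
  · exact fk_one_le (ht.trans_le hst)
  · exact (fk_le_rpow (ht.trans_le hst) _).trans (ENNReal.ofReal_le_ofReal
      (Real.rpow_le_rpow_of_nonpos ht hst (by norm_num)))

lemma C0_ne_top : C0 ≠ ∞ :=
  ne_top_of_le_ne_top lintegral_maj (setLIntegral_mono' measurableSet_Ioi fun _ ht => fk_le_maj ht le_rfl)

lemma fk_pos {t : ℝ} (ht : 0 < t) (d : ℝ) : 0 < fk t d := by
  rw [fk, ENNReal.ofReal_pos]; positivity

lemma C0_ne_zero : C0 ≠ 0 := by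
  rw [C0, ← pos_iff_ne_zero]
  rw [setLIntegral_pos_iff (by fun_prop)]
  have : Ioi (0:ℝ) ⊆ Function.support (fun a => fk a 1) ∩ Ioi 0 := fun t ht => ⟨(fk_pos ht _).ne', ht⟩
  refine lt_of_lt_of_le ?_ (measure_mono this)
  simp

/-- Newtonian potential -/
noncomputable def v (x : X) : ℝ≥0∞ := ∫⁻ s in Ioi 0, pk s 0 x

lemma measurable_v : Measurable v :=
  Measurable.lintegral_prod_right' (f := fun q : X × ℝ => pk q.2 0 q.1) (by fun_prop)

lemma v_eq {x : X} (hx : x ≠ 0) : v x = C0 / ENNReal.ofReal ‖x‖ := by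
  have hd : 0 < ‖x‖ := norm_pos_iff.2 hx
  have h := lintegral_Ioi_scale (c := ‖x‖ ^ 2) (by positivity) (fun s => fk s ‖x‖)
  have h2 : v x = ∫⁻ s in Ioi 0, fk s ‖x‖ := by
    simp [v, pk_eq_fk]
  rw [h2]
  rw [setLIntegral_congr_fun (g := fun t => ENNReal.ofReal (‖x‖⁻¹ ^ 3) * fk t 1) measurableSet_Ioi
    (fun t ht => fk_scale hd ht), lintegral_const_mul _ (by fun_prop)] at h
  change _ * C0 = _ at h
  have h3 : ENNReal.ofReal (‖x‖ ^ 2) * ENNReal.ofReal (‖x‖ ^ 2)⁻¹ = 1 := by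
    rw [← ENNReal.ofReal_mul (by positivity), mul_inv_cancel₀ (by positivity), ENNReal.ofReal_one]
  calc _ = ENNReal.ofReal (‖x‖ ^ 2) * (ENNReal.ofReal (‖x‖ ^ 2)⁻¹ * ∫⁻ s in Ioi 0, fk s ‖x‖) := by
        rw [← mul_assoc, h3, one_mul]
    _ = ENNReal.ofReal (‖x‖ ^ 2) * (ENNReal.ofReal (‖x‖⁻¹ ^ 3) * C0) := by rw [h]
    _ = _ := by
        rw [← mul_assoc, ← ENNReal.ofReal_mul (by positivity), mul_comm, ENNReal.div_eq_inv_mul,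
          ← ENNReal.ofReal_inv_of_pos hd, mul_comm]
        congr 2
        field_simp

lemma v_ne_zero (x : X) (hx : x ≠ 0) : v x ≠ 0 := by
  rw [v_eq hx]; exact (ENNReal.div_pos C0_ne_zero ENNReal.ofReal_ne_top).ne'

end LoopAux

namespace LoopAux
open Set Filter Topology
open scoped ENNReal

/-- path kernel with weights at the intermediate sites -/
noncomputable def J (δ : ℝ) : List (X → ℝ≥0∞) → X → X → ℝ≥0∞
  | [] => pk δ
  | c :: l => fun x y => ∫⁻ z, pk δ x z * (c z * J δ l z y)

/-- trace of a cyclic list of site weights -/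
noncomputable def Tr (δ : ℝ) : List (X → ℝ≥0∞) → ℝ≥0∞
  | [] => 0
  | c :: l => ∫⁻ x, c x * J δ l x x

lemma measurable_J {l : List (X → ℝ≥0∞)} (hl : ∀ c ∈ l, Measurable c) :
    Measurable (fun q : ℝ × X × X => J q.1 l q.2.1 q.2.2) := by
  induction l with
  | nil => simpa [J] using measurable_pk
  | cons c l ih =>
    have h1 := ih (fun c hc => hl c (List.mem_cons_of_mem _ hc))
    have hc : Measurable c := hl c List.mem_cons_self
    simp only [J]
    apply Measurable.lintegral_prod_right' (f := fun q : (ℝ × X × X) × X =>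
      pk q.1.1 q.1.2.1 q.2 * (c q.2 * J q.1.1 l q.2 q.1.2.2))
    have h2 : Measurable (fun q : (ℝ × X × X) × X => J q.1.1 l q.2 q.1.2.2) :=
      h1.comp (by fun_prop : Measurable fun q : (ℝ × X × X) × X => (q.1.1, q.2, q.1.2.2))
    fun_prop

lemma measurable_J' {l : List (X → ℝ≥0∞)} (hl : ∀ c ∈ l, Measurable c)
    {α : Type*} [MeasurableSpace α] {t : α → ℝ} {x y : α → X}
    (ht : Measurable t) (hx : Measurable x) (hy : Measurable y) :
    Measurable (fun a => J (t a) l (x a) (y a)) :=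
  (measurable_J hl).comp (ht.prodMk (hx.prodMk hy))

lemma J_append (δ : ℝ) (l₁ : List (X → ℝ≥0∞)) (c : X → ℝ≥0∞) (l₂ : List (X → ℝ≥0∞))
    (h₁ : ∀ c ∈ l₁, Measurable c) (hc : Measurable c) (h₂ : ∀ c ∈ l₂, Measurable c) (x y : X) :
    J δ (l₁ ++ c :: l₂) x y = ∫⁻ z, J δ l₁ x z * (c z * J δ l₂ z y) := by
  induction l₁ generalizing x with
  | nil => simp [J]
  | cons d l₁ ih =>
    have hl1 : ∀ c ∈ l₁, Measurable c := fun c hc => h₁ c (List.mem_cons_of_mem _ hc)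
    have hd : Measurable d := h₁ d List.mem_cons_self
    have ih' := ih hl1
    simp only [List.cons_append, J]
    simp_rw [ih']
    have m1 : Measurable fun q : X × X => J δ l₁ q.1 q.2 := measurable_J' hl1 measurable_const measurable_fst measurable_snd
    have m2 : Measurable fun q : X => J δ l₂ q y := measurable_J' h₂ measurable_const measurable_id measurable_const
    have e1 : ∀ z, pk δ x z * (d z * ∫⁻ w, J δ l₁ z w * (c w * J δ l₂ w y)) =
        ∫⁻ w, pk δ x z * (d z * (J δ l₁ z w * (c w * J δ l₂ w y))) := by
      intro z
      have m3 : Measurable fun w => J δ l₁ z w := m1.comp measurable_prodMk_left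
      rw [lintegral_const_mul _ (by fun_prop), lintegral_const_mul _ (by fun_prop)]
    simp_rw [e1]
    rw [lintegral_lintegral_swap]
    · congr 1; ext w
      have m3 : Measurable fun z => J δ l₁ z w := m1.comp measurable_prodMk_right
      rw [← lintegral_mul_const _ (by fun_prop)]
      congr 1; ext z; ring
    · apply Measurable.aemeasurable
      fun_prop

lemma Tr_rotate_one (δ : ℝ) (c : X → ℝ≥0∞) (l : List (X → ℝ≥0∞))
    (hc : Measurable c) (hl : ∀ c ∈ l, Measurable c) : Tr δ (l ++ [c]) = Tr δ (c :: l) := by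
  cases l with
  | nil => rfl
  | cons d l =>
    have hl1 : ∀ c ∈ l, Measurable c := fun c hc => hl c (List.mem_cons_of_mem _ hc)
    have hd : Measurable d := hl d List.mem_cons_self
    have m1 : Measurable fun q : X × X => J δ l q.1 q.2 := measurable_J' hl1 measurable_const measurable_fst measurable_snd
    simp only [List.cons_append, Tr]
    simp_rw [J_append δ l c [] hl1 hc (by simp)]
    simp only [J]
    have e1 : ∀ x, d x * ∫⁻ z, J δ l x z * (c z * pk δ z x) = ∫⁻ z, d x * (J δ l x z * (c z * pk δ z x)) := by
      intro x
      have m3 : Measurable fun w => J δ l x w := m1.comp measurable_prodMk_left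
      rw [lintegral_const_mul _ (by fun_prop)]
    have e2 : ∀ x, c x * ∫⁻ z, pk δ x z * (d z * J δ l z x) = ∫⁻ z, c x * (pk δ x z * (d z * J δ l z x)) := by
      intro x
      have m3 : Measurable fun w => J δ l w x := m1.comp measurable_prodMk_right
      rw [lintegral_const_mul _ (by fun_prop)]
    simp_rw [e1, e2]
    rw [lintegral_lintegral_swap]
    · congr 1; ext w; congr 1; ext z; ring
    · apply Measurable.aemeasurable
      fun_prop

lemma Tr_rotate (δ : ℝ) (l : List (X → ℝ≥0∞)) (hl : ∀ c ∈ l, Measurable c) (i : ℕ) :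
    Tr δ (l.rotate i) = Tr δ l := by
  induction i generalizing l with
  | zero => simp
  | succ i ih =>
    cases l with
    | nil => simp
    | cons c l =>
      rw [List.rotate_cons_succ, ih, Tr_rotate_one]
      · exact hl c List.mem_cons_self
      · exact fun c hc => hl c (List.mem_cons_of_mem _ hc)
      · intro d hd
        apply hl
        simpa [or_comm] using hd

lemma lintegral_pi_J (δ : ℝ) (k : ℕ) (c : Fin k → X → ℝ≥0∞) (hc : ∀ j, Measurable (c j)) (x y : X) :
    ∫⁻ z : Fin k → X, (∏ j, c j (z j)) * ∏ j : Fin (k+1),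
      pk δ ((Fin.snoc (Fin.cons x z : Fin (k+1) → X) y : Fin (k+2) → X) j.castSucc)
        ((Fin.snoc (Fin.cons x z : Fin (k+1) → X) y : Fin (k+2) → X) j.succ)
      ∂(Measure.pi fun _ => volume) = J δ (List.ofFn c) x y := by
  induction k generalizing x with
  | zero =>
    have e : (Measure.pi fun _ : Fin 0 => (volume : Measure X)) = Measure.dirac isEmptyElim := by
      exact Measure.pi_of_empty _ _
    rw [e, lintegral_dirac]
    simp [J, Fin.snoc]
  | succ k ih =>
    have mp := (measurePreserving_piFinSuccAbove (fun _ : Fin (k+1) => (volume : Measure X)) 0).symm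
    rw [← mp.lintegral_comp_emb (MeasurableEquiv.measurableEmbedding _)]
    simp only [List.ofFn_succ, J]
    simp_rw [← ih (fun j => c j.succ) (fun j => hc _)]
    have key : ∀ (z0 : X) (z : Fin k → X) (j : Fin (k+2)),
        (Fin.snoc (Fin.cons x (Fin.cons z0 z : Fin (k+1) → X) : Fin (k+2) → X) y : Fin (k+3) → X) j.succ =
        (Fin.snoc (Fin.cons z0 z : Fin (k+1) → X) y : Fin (k+2) → X) j := by
      intro z0 z j
      rw [← Fin.cons_snoc_eq_snoc_cons (β := X), Fin.cons_succ]
    have mz : Measurable fun q : X × (Fin k → X) => (Fin.snoc (Fin.cons q.1 q.2 : Fin (k+1) → X) y : Fin (k+2) → X) := by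
      rw [measurable_pi_iff]
      intro j
      refine Fin.lastCases ?_ (fun j => ?_) j
      · simp
      · simp only [Fin.snoc_castSucc]
        refine Fin.cases ?_ (fun j => ?_) j
        · simpa using measurable_fst
        · simp only [Fin.cons_succ]; fun_prop
    have mz' := measurable_pi_iff.1 mz
    rw [lintegral_prod]
    · congr 1; ext z0
      have e : (∏ j : Fin k, (1:ℝ≥0∞)) = 1 := by simp
      have e2 : ∀ z : Fin k → X, ((MeasurableEquiv.piFinSuccAbove (fun _ : Fin (k+1) => X) 0).symm (z0, z)) = (Fin.cons z0 z : Fin (k+1) → X) := by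
        intro z
        simp [MeasurableEquiv.piFinSuccAbove, Fin.insertNthEquiv]
      simp_rw [e2]
      have m3 : ∀ j : Fin (k+2), Measurable fun z : Fin k → X => (Fin.snoc (Fin.cons z0 z : Fin (k+1) → X) y : Fin (k+2) → X) j :=
        fun j => (mz' j).comp measurable_prodMk_left
      have mm : Measurable (fun z : Fin k → X => (∏ j : Fin k, c j.succ (z j)) * ∏ j : Fin (k+1),
          pk δ ((Fin.snoc (Fin.cons z0 z : Fin (k+1) → X) y : Fin (k+2) → X) j.castSucc)
            ((Fin.snoc (Fin.cons z0 z : Fin (k+1) → X) y : Fin (k+2) → X) j.succ)) := by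
        refine Measurable.mul (Finset.measurable_prod _ fun j _ => (hc _).comp (measurable_pi_apply j)) (Finset.measurable_prod _ fun j _ => ?_)
        exact measurable_pk' measurable_const (m3 _) (m3 _)
      rw [← lintegral_const_mul, ← lintegral_const_mul]
      · congr 1; ext z
        rw [Fin.prod_univ_succ, Fin.prod_univ_succ (n := k+1)]
        simp only [Fin.cons_zero, Fin.cons_succ, Fin.castSucc_zero, Fin.castSucc_succ]
        simp only [key]
        have e3 : (Fin.snoc (Fin.cons x (Fin.cons z0 z : Fin (k+1) → X) : Fin (k+2) → X) y : Fin (k+3) → X) 0 = x := by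
          rw [← Fin.cons_snoc_eq_snoc_cons (β := X), Fin.cons_zero]
        have e4 : (Fin.snoc (Fin.cons z0 z : Fin (k+1) → X) y : Fin (k+2) → X) 0 = z0 := by
          rw [← Fin.cons_snoc_eq_snoc_cons (β := X), Fin.cons_zero]
        rw [e3, e4]
        ring
      · exact measurable_const.mul mm
      · exact mm
    · apply Measurable.aemeasurable
      have m4 : Measurable fun z : Fin (k+1) → X => (Fin.snoc (Fin.cons x z : Fin (k+2) → X) y : Fin (k+3) → X) := by
        rw [measurable_pi_iff]
        intro j
        refine Fin.lastCases ?_ (fun j => ?_) j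
        · simp
        · simp only [Fin.snoc_castSucc]
          refine Fin.cases ?_ (fun j => ?_) j
          · simp
          · simp only [Fin.cons_succ]; fun_prop
      have m4' := measurable_pi_iff.1 m4
      have : Measurable (fun z : Fin (k+1) → X => (∏ j, c j (z j)) * ∏ j : Fin (k+2),
      pk δ ((Fin.snoc (Fin.cons x z : Fin (k+2) → X) y : Fin (k+3) → X) j.castSucc)
        ((Fin.snoc (Fin.cons x z : Fin (k+2) → X) y : Fin (k+3) → X) j.succ)) := by
        refine Measurable.mul (Finset.measurable_prod _ fun j _ => (hc _).comp (measurable_pi_apply j)) (Finset.measurable_prod _ fun j _ => ?_)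
        exact measurable_pk' measurable_const (m4' _) (m4' _)
      exact this.comp (MeasurableEquiv.measurable _)

instance pathBorel : BorelSpace C(ℝ, X) := ⟨rfl⟩

lemma measurable_eval (s : ℝ) : Measurable (fun w : C(ℝ, X) => w s) :=
  (continuous_eval_const s).measurable

lemma bridge_prod {x : X} {T : ℝ} {Q : Measure C(ℝ, X)} (hQ : IsBrownianBridge 3 x T Q) (hT : 0 < T)
    (k : ℕ) (c : ℕ → X → ℝ≥0∞) (hc : ∀ j, Measurable (c j)) :
    pk T x x * ∫⁻ w, ∏ j ∈ Finset.range (k+1), c j (w (j * (T / (k+1)))) ∂Q =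
      c 0 x * J (T / (k+1)) (List.ofFn fun j : Fin k => c (j+1)) x x := by
  obtain ⟨hp, h0, hf⟩ := hQ
  set δ := T / (k+1) with hδ
  have hδ0 : 0 < δ := by positivity
  have hTδ : T = (k+1) * δ := by rw [hδ]; field_simp
  set t : Fin k → ℝ := fun j => ((j:ℕ)+1 : ℝ) * δ with ht
  have hm : StrictMono t := by
    intro i j hij
    simp only [ht]
    have : (i:ℝ) < j := by exact_mod_cast hij
    gcongr
  have hin : ∀ j, t j ∈ Set.Ioo 0 T := by
    intro j
    refine ⟨by simp only [ht]; positivity, ?_⟩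
    rw [hTδ]
    simp only [ht]
    have : (j:ℝ) < k := by exact_mod_cast j.2
    gcongr
  have h1 := hf k t hm hin
  have htt : ∀ j : Fin (k+2), (Fin.snoc (Fin.cons 0 t : Fin (k+1) → ℝ) T : Fin (k+2) → ℝ) j = (j:ℕ) * δ := by
    intro j
    refine Fin.lastCases ?_ (fun j => ?_) j
    · simp [hTδ]
    · simp only [Fin.snoc_castSucc]
      refine Fin.cases ?_ (fun j => ?_) j
      · simp
      · simp [ht]
  have hdiff : ∀ j : Fin (k+1), (Fin.snoc (Fin.cons 0 t : Fin (k+1) → ℝ) T : Fin (k+2) → ℝ) j.succ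
      - (Fin.snoc (Fin.cons 0 t : Fin (k+1) → ℝ) T : Fin (k+2) → ℝ) j.castSucc = δ := by
    intro j
    rw [htt, htt]; simp; ring
  have e1 : ∫⁻ w, ∏ j ∈ Finset.range (k+1), c j (w (j * δ)) ∂Q =
      ∫⁻ w, c 0 x * ∏ j : Fin k, c (j+1) (w (t j)) ∂Q := by
    apply lintegral_congr_ae
    filter_upwards [h0] with w hw
    rw [Finset.prod_range_succ', mul_comm]
    simp only [Nat.cast_zero, zero_mul, hw.1, ht]
    rw [Finset.prod_range]
    simp
  have mF : Measurable fun z : Fin k → X => ∏ j : Fin k, c (j+1) (z j) :=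
    Finset.measurable_prod _ fun j _ => (hc _).comp (measurable_pi_apply j)
  have mev : Measurable fun w : C(ℝ, X) => fun j => w (t j) :=
    measurable_pi_iff.2 fun j => measurable_eval _
  have e2 : ∫⁻ w, ∏ j : Fin k, c (j+1) (w (t j)) ∂Q = ENNReal.ofReal ((2 * π * T) ^ ((3:ℝ)/2)) *
      J δ (List.ofFn fun j : Fin k => c (j+1)) x x := by
    rw [← lintegral_map (f := fun z : Fin k → X => ∏ j : Fin k, c (j+1) (z j)) mF mev, h1, ← lintegral_pi_J δ k _ (fun j => hc _)]
    have m4 : Measurable fun z : Fin k → X => (Fin.snoc (Fin.cons x z : Fin (k+1) → X) x : Fin (k+2) → X) := by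
      rw [measurable_pi_iff]
      intro j
      refine Fin.lastCases ?_ (fun j => ?_) j
      · simp
      · simp only [Fin.snoc_castSucc]
        refine Fin.cases ?_ (fun j => ?_) j
        · simp
        · simp only [Fin.cons_succ]; fun_prop
    have m4' := measurable_pi_iff.1 m4
    simp only [hdiff]
    have e3 : ∀ z : Fin k → X, ENNReal.ofReal ((2 * π * T) ^ (((3:ℕ):ℝ)/2) * ∏ j : Fin (k+1), heatKernel 3 δ
        ((Fin.snoc (Fin.cons x z : Fin (k+1) → X) x : Fin (k+2) → X) j.castSucc)
        ((Fin.snoc (Fin.cons x z : Fin (k+1) → X) x : Fin (k+2) → X) j.succ)) =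
        ENNReal.ofReal ((2 * π * T) ^ ((3:ℝ)/2)) * ∏ j : Fin (k+1), pk δ
        ((Fin.snoc (Fin.cons x z : Fin (k+1) → X) x : Fin (k+2) → X) j.castSucc)
        ((Fin.snoc (Fin.cons x z : Fin (k+1) → X) x : Fin (k+2) → X) j.succ) := by
      intro z
      rw [ENNReal.ofReal_mul (by positivity), ENNReal.ofReal_prod_of_nonneg]
      · simp [pk]
      · intro i _; unfold heatKernel; positivity
    simp_rw [e3]
    have mG : Measurable fun z : Fin k → X => ∏ j : Fin (k+1), pk δ
        ((Fin.snoc (Fin.cons x z : Fin (k+1) → X) x : Fin (k+2) → X) j.castSucc)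
        ((Fin.snoc (Fin.cons x z : Fin (k+1) → X) x : Fin (k+2) → X) j.succ) :=
      Finset.measurable_prod _ fun j _ => measurable_pk' measurable_const (m4' _) (m4' _)
    have mG2 := mG.const_mul (ENNReal.ofReal ((2 * π * T) ^ ((3:ℝ)/2)))
    have mFG := mF.mul mG
    rw [lintegral_withDensity_eq_lintegral_mul _ mG2 mF, ← lintegral_const_mul _ (by exact mFG)]
    congr 1; ext z
    simp only [Pi.mul_apply]
    ring
  rw [e1, lintegral_const_mul _ (by exact mF.comp mev), e2]
  have e5 : pk T x x * ENNReal.ofReal ((2 * π * T) ^ ((3:ℝ)/2)) = 1 := by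
    rw [pk_eq_fk, fk, ← ENNReal.ofReal_mul (by positivity)]
    simp only [sub_self, norm_zero]
    norm_num
    rw [← Real.rpow_add (by positivity)]
    norm_num
  calc _ = (pk T x x * ENNReal.ofReal ((2 * π * T) ^ ((3:ℝ)/2))) * (c 0 x * J δ (List.ofFn fun j : Fin k => c (j+1)) x x) := by ring
    _ = _ := by rw [e5, one_mul]

end LoopAux

namespace LoopAux
open Set Filter Topology
open scoped ENNReal
open scoped Classical in
/-- indicator function of a set -/
noncomputable def ind (S : Set X) (x : X) : ℝ≥0∞ := if x ∈ S then 1 else 0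

lemma ind_eq_indicator (S : Set X) : ind S = S.indicator 1 := by
  ext x; simp [ind, Set.indicator]

lemma measurable_ind {S : Set X} (hS : MeasurableSet S) : Measurable (ind S) := by
  rw [ind_eq_indicator]; exact measurable_one.indicator hS

/-- weights evaluated along a bi-infinite sequence -/
noncomputable def EV : List (X → ℝ≥0∞) → (ℤ → X) → ℤ → ℝ≥0∞
  | [], _, _ => 1
  | c :: l, z, i => c (z i) * EV l z (i+1)

lemma EV_append (l₁ l₂ : List (X → ℝ≥0∞)) (z : ℤ → X) (i : ℤ) :
    EV (l₁ ++ l₂) z i = EV l₁ z i * EV l₂ z (i + l₁.length) := by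
  induction l₁ generalizing i with
  | nil => simp [EV]
  | cons c l ih =>
    simp only [List.cons_append, EV, ih, List.length_cons, mul_assoc]
    congr 3
    push_cast; ring

lemma EV_rotate (l : List (X → ℝ≥0∞)) (z : ℤ → X) (n : ℕ) (hn : l.length = n)
    (hz : Function.Periodic z (n:ℤ)) (i : ℕ) (a : ℤ) :
    EV (l.rotate i) z a = EV l z (a - i) := by
  induction i generalizing l with
  | zero => simp
  | succ i ih =>
    cases l with
    | nil => simp [EV]
    | cons c l =>
      rw [List.rotate_cons_succ, ih _ (by simpa using hn), EV_append]
      simp only [EV, mul_one]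
      rw [mul_comm]
      have h1 : z (a - i + l.length) = z (a - (i+1:ℕ)) := by
        rw [← hz (a - (i+1:ℕ)), ← hn]
        congr 1
        push_cast [List.length_cons]; ring
      rw [h1]
      congr 2
      push_cast; ring

lemma EV_eq_prod (l : List (X → ℝ≥0∞)) (z : ℤ → X) (i : ℤ) :
    EV l z i = ∏ j ∈ Finset.range l.length, (l.getD j 1) (z (i + j)) := by
  induction l generalizing i with
  | nil => simp [EV]
  | cons c l ih =>
    rw [EV, ih, List.length_cons, Finset.prod_range_succ', mul_comm]
    simp only [List.getD_cons_succ, List.getD_cons_zero, Nat.cast_zero, add_zero]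
    congr 1
    apply Finset.prod_congr rfl
    intro j _
    have : i + 1 + (j:ℤ) = i + ((j+1 : ℕ):ℤ) := by push_cast; ring
    rw [this]

open scoped Classical in
lemma EV_replicate_ind (S : Set X) (k : ℕ) (z : ℤ → X) (i : ℤ) :
    EV (List.replicate k (ind S)) z i = if (∀ s : ℕ, s < k → z (i + s) ∈ S) then 1 else 0 := by
  induction k generalizing i with
  | zero => simp [EV]
  | succ k ih =>
    rw [List.replicate_succ, EV, ih, ind]
    by_cases h0 : z i ∈ S
    · have : (∀ s : ℕ, s < k → z (i + 1 + s) ∈ S) ↔ (∀ s : ℕ, s < k + 1 → z (i + s) ∈ S) := by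
        constructor
        · intro h s hs
          cases s with
          | zero => simpa using h0
          | succ s => have := h s (by omega); push_cast; rwa [add_comm (s:ℤ) 1, ← add_assoc]
        · intro h s hs
          have := h (s+1) (by omega); push_cast at this; rwa [add_comm (s:ℤ) 1, ← add_assoc] at this
      simp only [h0, if_true, one_mul, this]
    · have : ¬ (∀ s : ℕ, s < k + 1 → z (i + s) ∈ S) := fun h => h0 (by simpa using h 0 (by omega))
      rw [if_neg h0, if_neg this, zero_mul]

lemma EV_replicate_one (k : ℕ) (z : ℤ → X) (i : ℤ) :
    EV (List.replicate k 1) z i = 1 := by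
  induction k generalizing i with
  | zero => simp [EV]
  | succ k ih => rw [List.replicate_succ, EV, ih]; simp

/-- one crossing word -/
noncomputable def L1 (A B : Set X) (m k : ℕ) : List (X → ℝ≥0∞) :=
  ind A :: (List.replicate m 1 ++ ind B :: List.replicate k (ind (A ∪ B)ᶜ))

/-- two crossings word -/
noncomputable def L2 (A B : Set X) (m₁ k₁ m k : ℕ) : List (X → ℝ≥0∞) :=
  ind A :: (List.replicate m₁ 1 ++ ind B :: (List.replicate k₁ (ind (A ∪ B)ᶜ) ++ L1 A B m k))

@[simp] lemma L1_length (A B : Set X) (m k : ℕ) : (L1 A B m k).length = m + k + 2 := by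
  simp [L1]; ring
@[simp] lemma L2_length (A B : Set X) (m₁ k₁ m k : ℕ) : (L2 A B m₁ k₁ m k).length = m₁ + k₁ + m + k + 4 := by
  simp [L2]; ring

lemma L1_meas {A B : Set X} (hA : MeasurableSet A) (hB : MeasurableSet B) (m k : ℕ) :
    ∀ c ∈ L1 A B m k, Measurable c := by
  intro c hc
  simp only [L1, List.mem_cons, List.mem_append, List.mem_replicate] at hc
  rcases hc with rfl | ⟨_, rfl⟩ | rfl | ⟨_, rfl⟩
  · exact measurable_ind hA
  · exact measurable_one
  · exact measurable_ind hB
  · exact measurable_ind (hA.union hB).compl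

lemma L2_meas {A B : Set X} (hA : MeasurableSet A) (hB : MeasurableSet B) (m₁ k₁ m k : ℕ) :
    ∀ c ∈ L2 A B m₁ k₁ m k, Measurable c := by
  intro c hc
  simp only [L2, List.mem_cons, List.mem_append, List.mem_replicate] at hc
  rcases hc with rfl | ⟨_, rfl⟩ | rfl | ⟨_, rfl⟩ | h
  · exact measurable_ind hA
  · exact measurable_one
  · exact measurable_ind hB
  · exact measurable_ind (hA.union hB).compl
  · exact L1_meas hA hB m k c h

/-- validity of one crossing -/
def V1 (A B : Set X) (z : ℤ → X) (i : ℤ) (m k : ℕ) : Prop :=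
  z i ∈ A ∧ z (i + m + 1) ∈ B ∧ ∀ s : ℕ, s < k → z (i + m + 2 + s) ∈ (A ∪ B)ᶜ

/-- validity of two crossings -/
def V2 (A B : Set X) (z : ℤ → X) (i : ℤ) (m₁ k₁ m k : ℕ) : Prop :=
  z i ∈ A ∧ z (i + m₁ + 1) ∈ B ∧ (∀ s : ℕ, s < k₁ → z (i + m₁ + 2 + s) ∈ (A ∪ B)ᶜ) ∧
    V1 A B z (i + m₁ + k₁ + 2) m k

open scoped Classical in
lemma EV_L1 (A B : Set X) (m k : ℕ) (z : ℤ → X) (i : ℤ) :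
    EV (L1 A B m k) z i = if V1 A B z i m k then 1 else 0 := by
  simp only [L1, EV, EV_append, EV_replicate_one, EV_replicate_ind, one_mul, List.length_replicate, V1]
  have e1 : i + 1 + (m:ℤ) = i + m + 1 := by ring
  have e2 : i + m + 1 + 1 = i + m + 2 := by ring
  rw [e1, e2]
  simp only [ind]
  have key : ∀ (p q r : Prop) (_ : Decidable p) (_ : Decidable q) (_ : Decidable r) (_ : Decidable (p ∧ q ∧ r)), (if p then (1:ℝ≥0∞) else 0) * ((if q then 1 else 0) * (if r then 1 else 0)) =
      if p ∧ q ∧ r then 1 else 0 := by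
    intro p q r _ _ _ _
    by_cases p <;> by_cases q <;> by_cases r <;> simp [*]
  exact key _ _ _ _ _ _ _

open scoped Classical in
lemma EV_L2 (A B : Set X) (m₁ k₁ m k : ℕ) (z : ℤ → X) (i : ℤ) :
    EV (L2 A B m₁ k₁ m k) z i = if V2 A B z i m₁ k₁ m k then 1 else 0 := by
  simp only [L2, EV, EV_append, EV_replicate_one, EV_replicate_ind, one_mul, List.length_replicate, V2, EV_L1]
  have e1 : i + 1 + (m₁:ℤ) = i + m₁ + 1 := by ring
  have e2 : i + m₁ + 1 + 1 = i + m₁ + 2 := by ring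
  have e3 : i + m₁ + 2 + k₁ = i + m₁ + k₁ + 2 := by ring
  rw [e1, e2, e3]
  simp only [ind]
  have key : ∀ (p q r u : Prop) (_ : Decidable p) (_ : Decidable q) (_ : Decidable r) (_ : Decidable u) (_ : Decidable (p ∧ q ∧ r ∧ u)), (if p then (1:ℝ≥0∞) else 0) * ((if q then 1 else 0) * ((if r then 1 else 0) * (if u then 1 else 0))) =
      if p ∧ q ∧ r ∧ u then 1 else 0 := by
    intro p q r u _ _ _ _ _
    by_cases p <;> by_cases q <;> by_cases r <;> by_cases u <;> simp [*]
  exact key _ _ _ _ _ _ _ _ _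

lemma V1_shift {A B : Set X} {z : ℤ → X} {i j : ℤ} {m k : ℕ} (h : ∀ a, z (i + a) = z (j + a)) :
    V1 A B z i m k ↔ V1 A B z j m k := by
  unfold V1
  have h0 := h 0
  simp only [add_zero] at h0
  simp only [add_assoc, h0, h]

lemma V1_unique {A B : Set X} {z : ℤ → X} {i : ℤ} {m k m' k' : ℕ}
    (hAB : Disjoint A B) (h : V1 A B z i m k) (h' : V1 A B z i m' k') (e : m + k = m' + k') : k = k' := by
  wlog hlt : m < m' generalizing m k m' k'
  · rcases lt_trichotomy m m' with h1 | h1 | h1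
    · exact this h h' e h1
    · omega
    · exact (this h' h e.symm h1).symm
  exfalso
  have h1 := h.2.2 (m' - m - 1) (by omega)
  have e1 : i + (m:ℤ) + 2 + ((m' - m - 1 : ℕ):ℤ) = i + m' + 1 := by omega
  rw [e1] at h1
  exact h1 (Or.inr h'.2.1)

lemma V2_of_V1 {A B : Set X} {z : ℤ → X} {n : ℕ} (hz : Function.Periodic z (n:ℤ)) (hAB : Disjoint A B)
    {a b : ℤ} {m k m' k' : ℕ} (hmk : m + k + 2 = n) (hmk' : m' + k' + 2 = n)
    (ha : V1 A B z a m k) (hb : V1 A B z b m' k') (hab : a < b) (hba : b < a + n) :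
    ∃ m₁ k₁ m₂ : ℕ, m₁ + k₁ + m₂ + k + 4 = n ∧ V2 A B z a m₁ k₁ m₂ k := by
  have hd : ∀ x, x ∈ A → x ∉ B := fun x h1 h2 => (Set.disjoint_left.1 hAB) h1 h2
  have hper : ∀ c, z (c - n) = z c := fun c => by rw [← hz (c - n)]; congr 1; ring
  -- location of the B point before b
  have hB' : z (b - k' - 1) ∈ B := by
    have := hb.2.1
    rw [← hper] at this
    convert this using 2
    omega
  have hD' : ∀ s : ℕ, s < k' → z (b - k' + s) ∈ (A ∪ B)ᶜ := by
    intro s hs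
    have := hb.2.2 s hs
    rw [← hper] at this
    convert this using 2
    omega
  have h1 : a < b - k' - 1 := by
    by_contra hc
    push Not at hc
    rcases hc.eq_or_lt with h | h
    · exact hd _ ha.1 (h ▸ hB')
    · have := hD' (a - (b - k')).toNat (by omega)
      have e : b - (k':ℤ) + ((a - (b - k')).toNat : ℤ) = a := by omega
      rw [e] at this
      exact this (Or.inl ha.1)
  have h2 : b < a + m + 1 := by
    by_contra hc
    push Not at hc
    rcases hc.eq_or_lt with h | h
    · exact hd _ hb.1 (h ▸ ha.2.1)
    · have := ha.2.2 (b - (a + m + 2)).toNat (by omega)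
      have e : a + (m:ℤ) + 2 + ((b - (a + m + 2)).toNat : ℤ) = b := by omega
      rw [e] at this
      exact this (Or.inl hb.1)
  refine ⟨(b - k' - 1 - a - 1).toNat, k', (a + m + 1 - b - 1).toNat, by omega, ha.1, ?_, ?_, ?_, ?_, ?_⟩
  · convert hB' using 2; omega
  · intro s hs
    convert hD' s hs using 2; omega
  · convert hb.1 using 2; omega
  · convert ha.2.1 using 2; omega
  · intro s hs
    convert ha.2.2 s hs using 2; omega

lemma exists_V1 {A B : Set X} {z : ℤ → X} {n : ℕ} (hz : Function.Periodic z (n:ℤ)) (hn : 0 < n)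
    (hAB : Disjoint A B) (hA : ∃ i, z i ∈ A) (hB : ∃ i, z i ∈ B) :
    ∃ i < n, ∃ m k : ℕ, m + k + 2 = n ∧ V1 A B z (-(i:ℤ)) m k := by
  classical
  have hd : ∀ x, x ∈ A → x ∉ B := fun x h1 h2 => (Set.disjoint_left.1 hAB) h1 h2
  obtain ⟨α, hα⟩ := hA
  obtain ⟨β, hβ⟩ := hB
  have hmod : ∀ a b : ℤ, z (a + n * b) = z a := by
    intro a b
    have := hz.int_mul b a
    rw [mul_comm]; simpa using this
  have hn' : (n:ℤ) ≠ 0 := by omega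
  let P : ℕ → Prop := fun g => ∃ q, z q ∈ A ∧ z (q - g) ∈ B
  have hP0 : P ((α - β) % n).toNat := by
    refine ⟨α, hα, ?_⟩
    have h1 := Int.emod_nonneg (α - β) hn'
    have h2 := Int.mul_ediv_add_emod (α - β) n
    have e : α - (((α - β) % n).toNat : ℤ) = β + n * ((α - β) / n) := by omega
    rw [e, hmod]; exact hβ
  have hex : ∃ g, P g := ⟨_, hP0⟩
  obtain ⟨q, hq1, hq2⟩ := Nat.find_spec hex
  set g := Nat.find hex with hg
  have hgn : g < n := by
    have h1 : g ≤ _ := Nat.find_min' hex hP0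
    have h2 := Int.emod_lt_of_pos (α - β) (show (0:ℤ) < n by omega)
    omega
  have hg0 : 0 < g := by
    rcases Nat.eq_zero_or_pos g with h | h
    · rw [h] at hq2
      simp only [Nat.cast_zero, sub_zero] at hq2
      exact absurd hq2 (hd _ hq1)
    · exact h
  have hV : V1 A B z q (n - 1 - g) (g - 1) := by
    have hper : ∀ c, z (c - n) = z c := fun c => by rw [← hz (c - n)]; congr 1; ring
    refine ⟨hq1, ?_, ?_⟩
    · rw [← hper]
      convert hq2 using 2; omega
    · intro s hs
      rw [← hper]
      have e : q + ((n - 1 - g : ℕ):ℤ) + 2 + s - n = q - ((g - 1 - s : ℕ) : ℤ) := by omega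
      rw [e]
      rintro (h | h)
      · have : P (s + 1) := ⟨_, h, by convert hq2 using 2; omega⟩
        exact Nat.find_min hex (show s + 1 < g by omega) this
      · exact Nat.find_min hex (show g - 1 - s < g by omega) ⟨q, hq1, h⟩
  refine ⟨((-q) % n).toNat, ?_, n - 1 - g, g - 1, by omega, ?_⟩
  · have h2 := Int.emod_lt_of_pos (-q) (show (0:ℤ) < n by omega)
    omega
  · refine (V1_shift ?_).1 hV
    intro a
    have h1 := Int.emod_nonneg (-q) hn'
    have h2 := Int.mul_ediv_add_emod (-q) n
    have e : -((((-q) % n).toNat : ℕ) : ℤ) + a = q + a + n * (-q / n) := by omega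
    rw [e, hmod]

open scoped Classical in
/-- first-order counting sum -/
noncomputable def S1 (A B : Set X) (n : ℕ) (z : ℤ → X) : ℝ≥0∞ :=
  ∑ i ∈ Finset.range n, ∑' k : ℕ, ∑' m : ℕ, if m + k + 2 = n then EV (L1 A B m k) z (-(i:ℤ)) else 0

open scoped Classical in
/-- second-order counting sum -/
noncomputable def S2 (A B : Set X) (n : ℕ) (z : ℤ → X) : ℝ≥0∞ :=
  ∑ i ∈ Finset.range n, ∑' k : ℕ, ∑' m₁ : ℕ, ∑' k₁ : ℕ, ∑' m : ℕ,
    if m₁ + k₁ + m + k + 4 = n then EV (L2 A B m₁ k₁ m k) z (-(i:ℤ)) else 0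

open scoped Classical in
lemma hit_le_S1 {A B : Set X} {z : ℤ → X} {n : ℕ} (hz : Function.Periodic z (n:ℤ)) (hn : 0 < n)
    (hAB : Disjoint A B) :
    (if (∃ i, z i ∈ A) ∧ (∃ i, z i ∈ B) then (1:ℝ≥0∞) else 0) ≤ S1 A B n z := by
  split_ifs with h
  · obtain ⟨i, hi, m, k, hmk, hV⟩ := exists_V1 hz hn hAB h.1 h.2
    unfold S1
    calc (1:ℝ≥0∞) = if m + k + 2 = n then EV (L1 A B m k) z (-(i:ℤ)) else 0 := by
          rw [if_pos hmk, EV_L1, if_pos hV]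
      _ ≤ ∑' m : ℕ, if m + k + 2 = n then EV (L1 A B m k) z (-(i:ℤ)) else 0 := 
          ENNReal.le_tsum (f := fun m => if m + k + 2 = n then EV (L1 A B m k) z (-(i:ℤ)) else 0) m
      _ ≤ ∑' k : ℕ, ∑' m : ℕ, if m + k + 2 = n then EV (L1 A B m k) z (-(i:ℤ)) else 0 :=
          ENNReal.le_tsum (f := fun k => ∑' m : ℕ, if m + k + 2 = n then EV (L1 A B m k) z (-(i:ℤ)) else 0) k
      _ ≤ _ := Finset.single_le_sum (f := fun i : ℕ => ∑' k : ℕ, ∑' m : ℕ, if m + k + 2 = n then EV (L1 A B m k) z (-(i:ℤ)) else 0) (fun _ _ => zero_le) (Finset.mem_range.2 hi)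
  · exact zero_le

open scoped Classical in
lemma S1_le {A B : Set X} {z : ℤ → X} {n : ℕ} (hz : Function.Periodic z (n:ℤ))
    (hAB : Disjoint A B) :
    S1 A B n z ≤ (if (∃ i, z i ∈ A) ∧ (∃ i, z i ∈ B) then (1:ℝ≥0∞) else 0) + S2 A B n z := by
  set g : ℕ → ℕ → ℝ≥0∞ := fun i k => ∑' m : ℕ, if m + k + 2 = n then EV (L1 A B m k) z (-(i:ℤ)) else 0 with hg
  have hgval : ∀ i k, g i k = if k + 2 ≤ n ∧ V1 A B z (-(i:ℤ)) (n - 2 - k) k then 1 else 0 := by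
    intro i k
    simp only [hg]
    rw [tsum_eq_single (n - 2 - k)]
    · rw [EV_L1]
      by_cases h : k + 2 ≤ n
      · rw [if_pos (by omega)]
        simp [h]
      · rw [if_neg (by omega), if_neg (fun hh => h hh.1)]
    · intro m hm
      rw [if_neg (by omega)]
  by_cases huniq : ∃ i₁ k₁ i₂ k₂, i₁ < n ∧ i₂ < n ∧ g i₁ k₁ ≠ 0 ∧ g i₂ k₂ ≠ 0 ∧ (i₁, k₁) ≠ (i₂, k₂)
  · refine le_trans ?_ le_add_self
    unfold S1 S2
    refine Finset.sum_le_sum fun i hi => ENNReal.tsum_le_tsum fun k => ?_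
    change g i k ≤ _
    rw [hgval]
    split_ifs with h
    · -- find another
      obtain ⟨i₁, k₁, i₂, k₂, h1, h2, hv1, hv2, hne⟩ := huniq
      have hi := Finset.mem_range.1 hi
      obtain ⟨i', k', hi', hv', hne'⟩ : ∃ i' k', i' < n ∧ g i' k' ≠ 0 ∧ (i, k) ≠ (i', k') := by
        by_cases he : (i, k) = (i₁, k₁)
        · exact ⟨i₂, k₂, h2, hv2, he ▸ hne⟩
        · exact ⟨i₁, k₁, h1, hv1, he⟩
      rw [hgval] at hv'
      have hv'' : k' + 2 ≤ n ∧ V1 A B z (-(i':ℤ)) (n - 2 - k') k' := by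
        by_contra hc
        exact hv' (if_neg hc)
      have hii : i ≠ i' := by
        rintro rfl
        apply hne'
        rw [V1_unique hAB h.2 hv''.2 (by omega)]
      obtain ⟨b, hb1, hb2, hb3⟩ : ∃ b : ℤ, -(i:ℤ) < b ∧ b < -(i:ℤ) + n ∧ V1 A B z b (n - 2 - k') k' := by
        rcases lt_or_gt_of_ne hii with hl | hl
        · refine ⟨-(i':ℤ) + n, by omega, by omega, (V1_shift ?_).1 hv''.2⟩
          intro a
          rw [← hz]; congr 1; ring
        · exact ⟨-(i':ℤ), by omega, by omega, hv''.2⟩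
      obtain ⟨m₁, k₁, m₂, hs, hV2⟩ := V2_of_V1 hz hAB (by omega) (by omega) h.2 hb3 hb1 hb2
      calc (1:ℝ≥0∞) = if m₁ + k₁ + m₂ + k + 4 = n then EV (L2 A B m₁ k₁ m₂ k) z (-(i:ℤ)) else 0 := by
            rw [if_pos hs, EV_L2, if_pos hV2]
        _ ≤ _ := ENNReal.le_tsum (f := fun m => if m₁ + k₁ + m + k + 4 = n then EV (L2 A B m₁ k₁ m k) z (-(i:ℤ)) else 0) m₂
        _ ≤ _ := ENNReal.le_tsum (f := fun k₁ => ∑' m, if m₁ + k₁ + m + k + 4 = n then EV (L2 A B m₁ k₁ m k) z (-(i:ℤ)) else 0) k₁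
        _ ≤ _ := ENNReal.le_tsum (f := fun m₁ => ∑' k₁ : ℕ, ∑' m : ℕ, if m₁ + k₁ + m + k + 4 = n then EV (L2 A B m₁ k₁ m k) z (-(i:ℤ)) else 0) m₁
    · exact zero_le
  · refine le_trans ?_ le_self_add
    change ∑ i ∈ Finset.range n, ∑' k : ℕ, g i k ≤ _
    push Not at huniq
    by_cases h0 : ∃ i₁ k₁, i₁ < n ∧ g i₁ k₁ ≠ 0
    · obtain ⟨i₁, k₁, h1, hv1⟩ := h0
      rw [Finset.sum_eq_single_of_mem i₁ (Finset.mem_range.2 h1), tsum_eq_single k₁]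
      · rw [hgval] at hv1 ⊢
        split_ifs at hv1 ⊢ with ha hb
        · exact le_rfl
        · exact absurd ⟨⟨_, ha.2.1⟩, ⟨_, ha.2.2.1⟩⟩ hb
        · exact absurd rfl hv1
        · exact absurd rfl hv1
      · intro k hk
        by_contra hc
        have := huniq i₁ k i₁ k₁ h1 h1 hc hv1
        exact hk (Prod.ext_iff.1 this).2
      · intro i hi hne
        rw [ENNReal.tsum_eq_zero]
        intro k
        by_contra hc
        have := huniq i k i₁ k₁ (Finset.mem_range.1 hi) h1 hc hv1
        exact hne (Prod.ext_iff.1 this).1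
    · push Not at h0
      rw [Finset.sum_eq_zero]
      · exact zero_le
      · intro i hi
        rw [ENNReal.tsum_eq_zero]
        exact fun k => h0 i k (Finset.mem_range.1 hi)

end LoopAux

namespace LoopAux
open Set Filter Topology
open scoped ENNReal

/-- periodic sampling of a path -/
noncomputable def zw (n : ℕ) (δ : ℝ) (w : C(ℝ, X)) (j : ℤ) : X := w (((j % (n:ℤ) : ℤ) : ℝ) * δ)

lemma zw_periodic (n : ℕ) (δ : ℝ) (w : C(ℝ, X)) : Function.Periodic (zw n δ w) (n:ℤ) := by
  intro j; simp [zw]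

lemma zw_nat {n j : ℕ} (h : j < n) (δ : ℝ) (w : C(ℝ, X)) : zw n δ w (j:ℤ) = w (j * δ) := by
  unfold zw
  rw [Int.emod_eq_of_lt (by omega) (by omega)]
  simp

/-- diagonal of the cyclic kernel -/
noncomputable def Dg (δ : ℝ) : List (X → ℝ≥0∞) → X → ℝ≥0∞
  | [] => 0
  | c :: l => fun x => c x * J δ l x x

lemma Tr_eq_Dg (δ : ℝ) (l : List (X → ℝ≥0∞)) : Tr δ l = ∫⁻ x, Dg δ l x := by
  cases l <;> simp [Tr, Dg]

lemma measurable_Dg (δ : ℝ) {l : List (X → ℝ≥0∞)} (hl : ∀ c ∈ l, Measurable c) : Measurable (Dg δ l) := by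
  cases l with
  | nil => exact measurable_const
  | cons c l =>
    exact (hl c List.mem_cons_self).mul (measurable_J' (fun c hc => hl c (List.mem_cons_of_mem _ hc))
      measurable_const measurable_id measurable_id)

lemma getD_meas {l : List (X → ℝ≥0∞)} (hl : ∀ c ∈ l, Measurable c) (j : ℕ) : Measurable (l.getD j 1) := by
  by_cases h : j < l.length
  · rw [List.getD_eq_getElem _ _ h]; exact hl _ (List.getElem_mem h)
  · rw [List.getD_eq_default _ _ (by omega)]; exact measurable_one

lemma measurable_zw (n : ℕ) (δ : ℝ) (j : ℤ) : Measurable (fun w => zw n δ w j) := measurable_eval _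

lemma measurable_EV {l : List (X → ℝ≥0∞)} (hl : ∀ c ∈ l, Measurable c) (n : ℕ) (δ : ℝ) (i : ℤ) :
    Measurable (fun w => EV l (zw n δ w) i) := by
  simp_rw [EV_eq_prod]
  exact Finset.measurable_prod _ fun j _ => (getD_meas hl j).comp (measurable_zw _ _ _)

lemma bridge_EV {x : X} {T δ : ℝ} {Q : Measure C(ℝ, X)} (hQ : IsBrownianBridge 3 x T Q) (hT : 0 < T)
    {n : ℕ} (hn : 0 < n) (hδ : δ = T / n) {l : List (X → ℝ≥0∞)} (hl : ∀ c ∈ l, Measurable c)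
    (hln : l.length = n) (i : ℕ) :
    pk T x x * ∫⁻ w, EV l (zw n δ w) (-(i:ℤ)) ∂Q = Dg δ (l.rotate i) x := by
  obtain ⟨k, rfl⟩ : ∃ k, n = k + 1 := ⟨n - 1, by omega⟩
  set l' := l.rotate i with hl'
  have hl'm : ∀ c ∈ l', Measurable c := fun c hc => hl c (List.mem_rotate.1 hc)
  have hlen : l'.length = k + 1 := by rw [hl', List.length_rotate, hln]
  have h1 : ∀ w, EV l (zw (k+1) δ w) (-(i:ℤ)) =
      ∏ j ∈ Finset.range (k+1), l'.getD j 1 (w (j * (T / (k+1)))) := by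
    intro w
    have := EV_rotate l (zw (k+1) δ w) (k+1) hln (zw_periodic _ _ _) i 0
    rw [zero_sub] at this
    rw [← this, EV_eq_prod, ← hl', hlen]
    refine Finset.prod_congr rfl fun j hj => ?_
    rw [zero_add, zw_nat (Finset.mem_range.1 hj), hδ]
    push_cast; rfl
  simp_rw [h1]
  rw [bridge_prod hQ hT k (fun j => l'.getD j 1) (fun j => getD_meas hl'm j)]
  have h2 : l' = l'.getD 0 1 :: (List.ofFn fun j : Fin k => l'.getD (j+1) 1) := by
    apply List.ext_getElem
    · simp [hlen]
    · intro j h1 h2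
      cases j with
      | zero => rw [List.getElem_cons_zero, List.getD_eq_getElem _ _ h1]
      | succ j =>
        simp only [List.getElem_cons_succ, List.getElem_ofFn]
        rw [List.getD_eq_getElem _ _ h1]
  conv_rhs => rw [h2]
  simp only [Dg]
  rw [hδ]
  push_cast
  rfl

/-- grid event -/
def En (A B : Set X) (n : ℕ) (T : ℝ) : Set C(ℝ, X) :=
  {w | (∃ j : ℕ, j < n ∧ w (j * (T / n)) ∈ A) ∧ (∃ j : ℕ, j < n ∧ w (j * (T / n)) ∈ B)}

lemma measurableSet_En {A B : Set X} (hA : MeasurableSet A) (hB : MeasurableSet B) (n : ℕ) (T : ℝ) :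
    MeasurableSet (En A B n T) := by
  have : ∀ {S : Set X}, MeasurableSet S → MeasurableSet {w : C(ℝ, X) | ∃ j : ℕ, j < n ∧ w (j * (T / n)) ∈ S} := by
    intro S hS
    have : {w : C(ℝ, X) | ∃ j : ℕ, j < n ∧ w (j * (T / n)) ∈ S} =
        ⋃ j : ℕ, ⋃ _ : j < n, (fun w : C(ℝ, X) => w (j * (T / n))) ⁻¹' S := by
      ext w; simp
    rw [this]
    exact MeasurableSet.iUnion fun j => MeasurableSet.iUnion fun _ => measurable_eval _ hS
  exact (this hA).inter (this hB)

lemma exists_zw {n : ℕ} (hn : 0 < n) (T : ℝ) (w : C(ℝ, X)) (S : Set X) :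
    (∃ i, zw n (T / n) w i ∈ S) ↔ ∃ j : ℕ, j < n ∧ w (j * (T / n)) ∈ S := by
  constructor
  · rintro ⟨i, hi⟩
    have h1 := Int.emod_nonneg i (show (n:ℤ) ≠ 0 by omega)
    have h2 := Int.emod_lt_of_pos i (show (0:ℤ) < n by omega)
    refine ⟨(i % n).toNat, by omega, ?_⟩
    unfold zw at hi
    convert hi using 3
    have : (((i % n).toNat : ℕ) : ℤ) = i % n := by omega
    exact_mod_cast this
  · rintro ⟨j, hj, h⟩
    exact ⟨j, by rwa [zw_nat hj]⟩

/-- discretized trace of the event -/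
noncomputable def tau (Q : X → ℝ → Measure C(ℝ, X)) (A B : Set X) (n : ℕ) (T : ℝ) : ℝ≥0∞ :=
  ∫⁻ x, pk T x x * Q x T (En A B n T)

variable {Q : X → ℝ → Measure C(ℝ, X)}

open scoped Classical in
lemma pk_S1 (hQ : ∀ x t, 0 < t → IsBrownianBridge 3 x t (Q x t)) {A B : Set X}
    (hA : MeasurableSet A) (hB : MeasurableSet B) {n : ℕ} (hn : 0 < n) {T : ℝ} (hT : 0 < T) :
    ∫⁻ x, pk T x x * ∫⁻ w, S1 A B n (zw n (T/n) w) ∂(Q x T) =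
      n * ∑' k : ℕ, ∑' m : ℕ, if m + k + 2 = n then Tr (T/n) (L1 A B m k) else 0 := by
  have hm : ∀ i k m : ℕ, Measurable fun w => if m + k + 2 = n then EV (L1 A B m k) (zw n (T/n) w) (-(i:ℤ)) else 0 := by
    intro i k m
    split_ifs
    · exact measurable_EV (L1_meas hA hB m k) _ _ _
    · exact measurable_const
  have h1 : ∀ x, pk T x x * ∫⁻ w, S1 A B n (zw n (T/n) w) ∂(Q x T) =
      ∑ i ∈ Finset.range n, ∑' k : ℕ, ∑' m : ℕ, if m + k + 2 = n then Dg (T/n) ((L1 A B m k).rotate i) x else 0 := by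
    intro x
    unfold S1
    rw [lintegral_finsetSum _ (fun i _ => Measurable.tsum fun k => Measurable.tsum fun m => hm i k m),
      Finset.mul_sum]
    refine Finset.sum_congr rfl fun i _ => ?_
    rw [lintegral_tsum (fun k => (Measurable.tsum fun m => hm i k m).aemeasurable), ← ENNReal.tsum_mul_left]
    refine tsum_congr fun k => ?_
    rw [lintegral_tsum (fun m => (hm i k m).aemeasurable), ← ENNReal.tsum_mul_left]
    refine tsum_congr fun m => ?_
    split_ifs with h
    · exact bridge_EV (hQ x T hT) hT hn rfl (L1_meas hA hB m k) (by simpa using h) i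
    · simp
  have hm2 : ∀ i k m : ℕ, Measurable fun x => if m + k + 2 = n then Dg (T/n) ((L1 A B m k).rotate i) x else 0 := by
    intro i k m
    split_ifs
    · exact measurable_Dg _ (fun c hc => L1_meas hA hB m k c (List.mem_rotate.1 hc))
    · exact measurable_const
  simp_rw [h1]
  rw [lintegral_finsetSum _ (fun i _ => Measurable.tsum fun k => Measurable.tsum fun m => hm2 i k m)]
  have h2 : ∀ i ∈ Finset.range n, ∫⁻ x, (∑' k : ℕ, ∑' m : ℕ, if m + k + 2 = n then Dg (T/n) ((L1 A B m k).rotate i) x else 0) =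
      ∑' k : ℕ, ∑' m : ℕ, if m + k + 2 = n then Tr (T/n) (L1 A B m k) else 0 := by
    intro i _
    rw [lintegral_tsum (fun k => (Measurable.tsum fun m => hm2 i k m).aemeasurable)]
    refine tsum_congr fun k => ?_
    rw [lintegral_tsum (fun m => (hm2 i k m).aemeasurable)]
    refine tsum_congr fun m => ?_
    split_ifs with h
    · rw [← Tr_eq_Dg, Tr_rotate _ _ (L1_meas hA hB m k)]
    · simp
  rw [Finset.sum_congr rfl h2]
  simp

open scoped Classical in
lemma pk_S2 (hQ : ∀ x t, 0 < t → IsBrownianBridge 3 x t (Q x t)) {A B : Set X}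
    (hA : MeasurableSet A) (hB : MeasurableSet B) {n : ℕ} (hn : 0 < n) {T : ℝ} (hT : 0 < T) :
    ∫⁻ x, pk T x x * ∫⁻ w, S2 A B n (zw n (T/n) w) ∂(Q x T) =
      n * ∑' k : ℕ, ∑' m₁ : ℕ, ∑' k₁ : ℕ, ∑' m : ℕ,
        if m₁ + k₁ + m + k + 4 = n then Tr (T/n) (L2 A B m₁ k₁ m k) else 0 := by
  have hm : ∀ i k m₁ k₁ m : ℕ, Measurable fun w => if m₁ + k₁ + m + k + 4 = n then EV (L2 A B m₁ k₁ m k) (zw n (T/n) w) (-(i:ℤ)) else 0 := by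
    intro i k m₁ k₁ m
    split_ifs
    · exact measurable_EV (L2_meas hA hB m₁ k₁ m k) _ _ _
    · exact measurable_const
  have h1 : ∀ x, pk T x x * ∫⁻ w, S2 A B n (zw n (T/n) w) ∂(Q x T) =
      ∑ i ∈ Finset.range n, ∑' k : ℕ, ∑' m₁ : ℕ, ∑' k₁ : ℕ, ∑' m : ℕ, if m₁ + k₁ + m + k + 4 = n then Dg (T/n) ((L2 A B m₁ k₁ m k).rotate i) x else 0 := by
    intro x
    unfold S2
    rw [lintegral_finsetSum _ (fun i _ => Measurable.tsum fun k => Measurable.tsum fun m₁ => Measurable.tsum fun k₁ => Measurable.tsum fun m => hm i k m₁ k₁ m),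
      Finset.mul_sum]
    refine Finset.sum_congr rfl fun i _ => ?_
    rw [lintegral_tsum (fun k => (Measurable.tsum fun m₁ => Measurable.tsum fun k₁ => Measurable.tsum fun m => hm i k m₁ k₁ m).aemeasurable), ← ENNReal.tsum_mul_left]
    refine tsum_congr fun k => ?_
    rw [lintegral_tsum (fun m₁ => (Measurable.tsum fun k₁ => Measurable.tsum fun m => hm i k m₁ k₁ m).aemeasurable), ← ENNReal.tsum_mul_left]
    refine tsum_congr fun m₁ => ?_
    rw [lintegral_tsum (fun k₁ => (Measurable.tsum fun m => hm i k m₁ k₁ m).aemeasurable), ← ENNReal.tsum_mul_left]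
    refine tsum_congr fun k₁ => ?_
    rw [lintegral_tsum (fun m => (hm i k m₁ k₁ m).aemeasurable), ← ENNReal.tsum_mul_left]
    refine tsum_congr fun m => ?_
    split_ifs with h
    · exact bridge_EV (hQ x T hT) hT hn rfl (L2_meas hA hB m₁ k₁ m k) (by simpa using h) i
    · simp
  have hm2 : ∀ i k m₁ k₁ m : ℕ, Measurable fun x => if m₁ + k₁ + m + k + 4 = n then Dg (T/n) ((L2 A B m₁ k₁ m k).rotate i) x else 0 := by
    intro i k m₁ k₁ m
    split_ifs
    · exact measurable_Dg _ (fun c hc => L2_meas hA hB m₁ k₁ m k c (List.mem_rotate.1 hc))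
    · exact measurable_const
  simp_rw [h1]
  rw [lintegral_finsetSum _ (fun i _ => Measurable.tsum fun k => Measurable.tsum fun m₁ => Measurable.tsum fun k₁ => Measurable.tsum fun m => hm2 i k m₁ k₁ m)]
  have h2 : ∀ i ∈ Finset.range n, ∫⁻ x, (∑' k : ℕ, ∑' m₁ : ℕ, ∑' k₁ : ℕ, ∑' m : ℕ, if m₁ + k₁ + m + k + 4 = n then Dg (T/n) ((L2 A B m₁ k₁ m k).rotate i) x else 0) =
      ∑' k : ℕ, ∑' m₁ : ℕ, ∑' k₁ : ℕ, ∑' m : ℕ, if m₁ + k₁ + m + k + 4 = n then Tr (T/n) (L2 A B m₁ k₁ m k) else 0 := by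
    intro i _
    rw [lintegral_tsum (fun k => (Measurable.tsum fun m₁ => Measurable.tsum fun k₁ => Measurable.tsum fun m => hm2 i k m₁ k₁ m).aemeasurable)]
    refine tsum_congr fun k => ?_
    rw [lintegral_tsum (fun m₁ => (Measurable.tsum fun k₁ => Measurable.tsum fun m => hm2 i k m₁ k₁ m).aemeasurable)]
    refine tsum_congr fun m₁ => ?_
    rw [lintegral_tsum (fun k₁ => (Measurable.tsum fun m => hm2 i k m₁ k₁ m).aemeasurable)]
    refine tsum_congr fun k₁ => ?_
    rw [lintegral_tsum (fun m => (hm2 i k m₁ k₁ m).aemeasurable)]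
    refine tsum_congr fun m => ?_
    split_ifs with h
    · rw [← Tr_eq_Dg, Tr_rotate _ _ (L2_meas hA hB m₁ k₁ m k)]
    · simp
  rw [Finset.sum_congr rfl h2]
  simp

open scoped Classical in
lemma En_indicator {A B : Set X} {n : ℕ} (hn : 0 < n) (T : ℝ) (w : C(ℝ, X)) :
    (if (∃ i, zw n (T / n) w i ∈ A) ∧ (∃ i, zw n (T / n) w i ∈ B) then (1:ℝ≥0∞) else 0) =
      (En A B n T).indicator 1 w := by
  rw [exists_zw hn, exists_zw hn]
  by_cases h : w ∈ En A B n T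
  · rw [Set.indicator_of_mem h]; exact if_pos h
  · rw [Set.indicator_of_notMem h]; exact if_neg h

open scoped Classical in
lemma tau_le (hQ : ∀ x t, 0 < t → IsBrownianBridge 3 x t (Q x t)) {A B : Set X}
    (hA : MeasurableSet A) (hB : MeasurableSet B) (hAB : Disjoint A B) {n : ℕ} (hn : 0 < n) {T : ℝ} (hT : 0 < T) :
    tau Q A B n T ≤ n * ∑' k : ℕ, ∑' m : ℕ, if m + k + 2 = n then Tr (T/n) (L1 A B m k) else 0 := by
  rw [← pk_S1 hQ hA hB hn hT, tau]
  refine lintegral_mono fun x => ?_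
  gcongr
  rw [← lintegral_indicator_one (measurableSet_En hA hB n T)]
  refine lintegral_mono fun w => ?_
  rw [← En_indicator hn]
  exact hit_le_S1 (zw_periodic _ _ _) hn hAB

lemma bridge_ind {x : X} {T : ℝ} {Q : Measure C(ℝ, X)} (hQ : IsBrownianBridge 3 x T Q) (hT : 0 < T)
    (k : ℕ) {S : Set X} (hS : MeasurableSet S) :
    pk T x x * Q {w | ∀ j : ℕ, j < k + 1 → w (j * (T / (k+1:ℕ))) ∈ S} =
      ind S x * J (T / (k+1)) (List.ofFn fun _ : Fin k => ind S) x x := by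
  rw [← bridge_prod hQ hT k (fun _ => ind S) (fun _ => measurable_ind hS)]
  congr 1
  have hms : MeasurableSet {w : C(ℝ, X) | ∀ j : ℕ, j < k + 1 → w (j * (T / (k+1:ℕ))) ∈ S} := by
    have : {w : C(ℝ, X) | ∀ j : ℕ, j < k + 1 → w (j * (T / (k+1:ℕ))) ∈ S} =
        ⋂ j : ℕ, ⋂ _ : j < k + 1, (fun w : C(ℝ, X) => w (j * (T / (k+1:ℕ)))) ⁻¹' S := by
      ext w; simp
    rw [this]
    exact MeasurableSet.iInter fun j => MeasurableSet.iInter fun _ => measurable_eval _ hS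
  rw [← lintegral_indicator_one hms]
  refine lintegral_congr fun w => ?_
  by_cases h : w ∈ {w : C(ℝ, X) | ∀ j : ℕ, j < k + 1 → w (j * (T / (k+1:ℕ))) ∈ S}
  · rw [Set.indicator_of_mem h, Finset.prod_eq_one]
    · rfl
    · intro j hj
      have := h j (Finset.mem_range.1 hj)
      rw [ind, if_pos]
      exact_mod_cast this
  · rw [Set.indicator_of_notMem h]
    simp only [Set.mem_ofPred_eq] at h
    push Not at h
    obtain ⟨j, hj, hjS⟩ := h
    symm
    apply Finset.prod_eq_zero (Finset.mem_range.2 hj)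
    rw [ind, if_neg]
    exact_mod_cast hjS

lemma exists_qn (hQ : ∀ x t, 0 < t → IsBrownianBridge 3 x t (Q x t)) {A B : Set X}
    (hA : MeasurableSet A) (hB : MeasurableSet B) {n : ℕ} (hn : 0 < n) :
    ∃ g : X × ℝ → ℝ≥0∞, Measurable g ∧ ∀ x t, 0 < t → pk t x x * Q x t (En A B n t) = g (x, t) := by
  obtain ⟨k, rfl⟩ : ∃ k, n = k + 1 := ⟨n - 1, by omega⟩
  let F : Set X → X × ℝ → ℝ≥0∞ := fun S q => ind S q.1 * J (q.2 / (k+1)) (List.ofFn fun _ : Fin k => ind S) q.1 q.1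
  have hF : ∀ S, MeasurableSet S → Measurable (F S) := by
    intro S hS
    refine ((measurable_ind hS).comp measurable_fst).mul (measurable_J' ?_ (by fun_prop) measurable_fst measurable_fst)
    intro c hc
    rw [List.mem_ofFn] at hc
    obtain ⟨_, rfl⟩ := hc
    exact measurable_ind hS
  refine ⟨fun q => (pk q.2 q.1 q.1 + F (Aᶜ ∩ Bᶜ) q) - (F Aᶜ q + F Bᶜ q), ?_, ?_⟩
  · exact ((by fun_prop : Measurable fun q : X × ℝ => pk q.2 q.1 q.1).add (hF _ (hA.compl.inter hB.compl))).sub ((hF _ hA.compl).add (hF _ hB.compl))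
  intro x t ht
  have hb : ∀ S, MeasurableSet S → F S (x, t) = pk t x x * Q x t {w | ∀ j : ℕ, j < k + 1 → w (j * (t / (k+1:ℕ))) ∈ S} :=
    fun S hS => (bridge_ind (hQ x t ht) ht k hS).symm
  obtain ⟨hp, -, -⟩ := hQ x t ht
  have hfin : ∀ S : Set C(ℝ, X), pk t x x * Q x t S ≠ ∞ := fun S => ENNReal.mul_ne_top (pk_ne_top _ _ _) (measure_ne_top _ _)
  simp only [hb _ hA.compl, hb _ hB.compl, hb _ (hA.compl.inter hB.compl)]
  symm
  apply ENNReal.sub_eq_of_eq_add (ENNReal.add_ne_top.2 ⟨hfin _, hfin _⟩)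
  set U := {w : C(ℝ, X) | ∀ j : ℕ, j < k + 1 → w (j * (t / (k+1:ℕ))) ∈ Aᶜ} with hU
  set V := {w : C(ℝ, X) | ∀ j : ℕ, j < k + 1 → w (j * (t / (k+1:ℕ))) ∈ Bᶜ} with hV
  have hUV : {w : C(ℝ, X) | ∀ j : ℕ, j < k + 1 → w (j * (t / (k+1:ℕ))) ∈ Aᶜ ∩ Bᶜ} = U ∩ V := by
    ext w
    simp only [hU, hV, Set.mem_ofPred_eq, Set.mem_inter_iff]
    exact ⟨fun h => ⟨fun j hj => (h j hj).1, fun j hj => (h j hj).2⟩, fun h j hj => ⟨h.1 j hj, h.2 j hj⟩⟩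
  have hE : En A B (k+1) t = (U ∪ V)ᶜ := by
    ext w
    simp only [En, hU, hV, Set.mem_ofPred_eq, Set.mem_compl_iff, Set.mem_union, not_or, not_forall, not_not, exists_prop]
  have hms : ∀ S : Set X, MeasurableSet S → MeasurableSet {w : C(ℝ, X) | ∀ j : ℕ, j < k + 1 → w (j * (t / (k+1:ℕ))) ∈ S} := by
    intro S hS
    have : {w : C(ℝ, X) | ∀ j : ℕ, j < k + 1 → w (j * (t / (k+1:ℕ))) ∈ S} =
        ⋂ j : ℕ, ⋂ _ : j < k + 1, (fun w : C(ℝ, X) => w (j * (t / (k+1:ℕ)))) ⁻¹' S := by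
      ext w; simp
    rw [this]
    exact MeasurableSet.iInter fun j => MeasurableSet.iInter fun _ => measurable_eval _ hS
  have hUm : MeasurableSet U := hms _ hA.compl
  have hVm : MeasurableSet V := hms _ hB.compl
  rw [hUV, hE, ← mul_add, ← measure_union_add_inter U hVm, ← mul_add, ← add_assoc, add_comm (Q x t (U ∪ V)ᶜ),
    measure_add_measure_compl (hUm.union hVm), mul_add]
  simp

open scoped Classical in
lemma le_tau (hQ : ∀ x t, 0 < t → IsBrownianBridge 3 x t (Q x t)) {A B : Set X}
    (hA : MeasurableSet A) (hB : MeasurableSet B) (hAB : Disjoint A B) {n : ℕ} (hn : 0 < n) {T : ℝ} (hT : 0 < T) :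
    (n * ∑' k : ℕ, ∑' m : ℕ, if m + k + 2 = n then Tr (T/n) (L1 A B m k) else 0 : ℝ≥0∞) ≤
     tau Q A B n T + n * ∑' k : ℕ, ∑' m₁ : ℕ, ∑' k₁ : ℕ, ∑' m : ℕ,
        if m₁ + k₁ + m + k + 4 = n then Tr (T/n) (L2 A B m₁ k₁ m k) else 0 := by
  rw [← pk_S1 hQ hA hB hn hT, ← pk_S2 hQ hA hB hn hT, tau]
  obtain ⟨g, hg, hgq⟩ := exists_qn hQ hA hB hn
  have hme : Measurable fun x => pk T x x * Q x T (En A B n T) := by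
    simp_rw [fun x => hgq x T hT]
    fun_prop
  rw [← lintegral_add_left hme]
  refine lintegral_mono fun x => ?_
  simp only
  rw [← mul_add]
  gcongr
  rw [← lintegral_indicator_one (measurableSet_En hA hB n T),
    ← lintegral_add_left (measurable_one.indicator (measurableSet_En hA hB n T))]
  refine lintegral_mono fun w => ?_
  simp only
  rw [← En_indicator hn]
  exact S1_le (zw_periodic _ _ _) hAB

/-- the discretized loop mass -/
noncomputable def Ld (Q : X → ℝ → Measure C(ℝ, X)) (A B : Set X) (δ : ℝ) : ℝ≥0∞ :=
  ∑' n : ℕ, ((n + 1 : ℕ) : ℝ≥0∞)⁻¹ * tau Q A B (n+1) ((n+1 : ℕ) * δ)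

open scoped Classical in
lemma tsum_ite_L1 (f : ℕ → ℕ → ℝ≥0∞) :
    ∑' n : ℕ, (∑' k : ℕ, ∑' m : ℕ, if m + k + 2 = n + 1 then f k m else 0) = ∑' k : ℕ, ∑' m : ℕ, f k m := by
  rw [ENNReal.tsum_comm]
  refine tsum_congr fun k => ?_
  rw [ENNReal.tsum_comm]
  refine tsum_congr fun m => ?_
  rw [tsum_eq_single (m + k + 1)]
  · simp
  · intro n hn
    rw [if_neg (by omega)]

open scoped Classical in
lemma tsum_ite_L2 (f : ℕ → ℕ → ℕ → ℕ → ℝ≥0∞) :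
    ∑' n : ℕ, (∑' k : ℕ, ∑' m₁ : ℕ, ∑' k₁ : ℕ, ∑' m : ℕ, if m₁ + k₁ + m + k + 4 = n + 1 then f k m₁ k₁ m else 0) =
      ∑' k : ℕ, ∑' m₁ : ℕ, ∑' k₁ : ℕ, ∑' m : ℕ, f k m₁ k₁ m := by
  rw [ENNReal.tsum_comm]
  refine tsum_congr fun k => ?_
  rw [ENNReal.tsum_comm]
  refine tsum_congr fun m₁ => ?_
  rw [ENNReal.tsum_comm]
  refine tsum_congr fun k₁ => ?_
  rw [ENNReal.tsum_comm]
  refine tsum_congr fun m => ?_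
  rw [tsum_eq_single (m₁ + k₁ + m + k + 3)]
  · simp
  · intro n hn
    rw [if_neg (by omega)]

lemma Ld_le (hQ : ∀ x t, 0 < t → IsBrownianBridge 3 x t (Q x t)) {A B : Set X}
    (hA : MeasurableSet A) (hB : MeasurableSet B) (hAB : Disjoint A B) {δ : ℝ} (hδ : 0 < δ) :
    Ld Q A B δ ≤ ∑' k : ℕ, ∑' m : ℕ, Tr δ (L1 A B m k) := by
  classical
  rw [← tsum_ite_L1, Ld]
  refine ENNReal.tsum_le_tsum fun n => ?_
  have h := tau_le hQ hA hB hAB (n := n+1) (by omega) (T := (n+1 : ℕ) * δ) (by positivity)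
  have e : ((n+1 : ℕ):ℝ) * δ / (n+1 : ℕ) = δ := by field_simp
  rw [e] at h
  calc _ ≤ ((n + 1 : ℕ) : ℝ≥0∞)⁻¹ * (((n + 1 : ℕ) : ℝ≥0∞) * _) := by gcongr
    _ = _ := by
      rw [← mul_assoc, ENNReal.inv_mul_cancel (by simp) (by simp), one_mul]

lemma le_Ld (hQ : ∀ x t, 0 < t → IsBrownianBridge 3 x t (Q x t)) {A B : Set X}
    (hA : MeasurableSet A) (hB : MeasurableSet B) (hAB : Disjoint A B) {δ : ℝ} (hδ : 0 < δ) :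
    ∑' k : ℕ, ∑' m : ℕ, Tr δ (L1 A B m k) ≤
      Ld Q A B δ + ∑' k : ℕ, ∑' m₁ : ℕ, ∑' k₁ : ℕ, ∑' m : ℕ, Tr δ (L2 A B m₁ k₁ m k) := by
  classical
  rw [← tsum_ite_L1, ← tsum_ite_L2, Ld, ← ENNReal.tsum_add]
  refine ENNReal.tsum_le_tsum fun n => ?_
  have h := le_tau hQ hA hB hAB (n := n+1) (by omega) (T := (n+1 : ℕ) * δ) (by positivity)
  have e : ((n+1 : ℕ):ℝ) * δ / (n+1 : ℕ) = δ := by field_simp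
  rw [e] at h
  have hc : ∀ a : ℝ≥0∞, ((n + 1 : ℕ) : ℝ≥0∞)⁻¹ * (((n + 1 : ℕ) : ℝ≥0∞) * a) = a := by
    intro a
    rw [← mul_assoc, ENNReal.inv_mul_cancel (by simp) (by simp), one_mul]
  have h2 := mul_le_mul_right h (((n + 1 : ℕ) : ℝ≥0∞)⁻¹)
  rwa [mul_add, hc, hc] at h2

end LoopAux

namespace LoopAux
open Set Filter Topology
open scoped ENNReal

lemma J_one {δ : ℝ} (hδ : 0 < δ) (m : ℕ) (x y : X) :
    J δ (List.replicate m 1) x y = pk ((m + 1 : ℕ) * δ) x y := by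
  induction m generalizing x with
  | zero => simp [J]
  | succ m ih =>
    rw [List.replicate_succ, J]
    simp only [ih, Pi.one_apply, one_mul]
    rw [pk_comp hδ (by positivity)]
    congr 1
    push_cast; ring

/-- discrete Green function -/
noncomputable def G (δ : ℝ) (x y : X) : ℝ≥0∞ := ∑' m : ℕ, pk ((m + 1 : ℕ) * δ) x y

/-- transition kernel killed outside `D` -/
noncomputable def hk (δ : ℝ) (D : Set X) (y x : X) : ℝ≥0∞ := ∑' k : ℕ, J δ (List.replicate k (ind D)) y x

lemma rep_meas {D : Set X} (hD : MeasurableSet D) (k : ℕ) : ∀ c ∈ List.replicate k (ind D), Measurable c := by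
  intro c hc
  rw [List.mem_replicate] at hc
  rw [hc.2]; exact measurable_ind hD

lemma rep_one_meas (k : ℕ) : ∀ c ∈ List.replicate k (1 : X → ℝ≥0∞), Measurable c := by
  intro c hc
  rw [List.mem_replicate] at hc
  rw [hc.2]; exact measurable_one

@[fun_prop]
lemma measurable_hk (δ : ℝ) {D : Set X} (hD : MeasurableSet D) {α : Type*} [MeasurableSpace α] {x y : α → X}
    (hx : Measurable x) (hy : Measurable y) : Measurable (fun a => hk δ D (x a) (y a)) :=
  Measurable.tsum fun k => measurable_J' (rep_meas hD k) measurable_const hx hy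

@[fun_prop]
lemma measurable_G (δ : ℝ) {α : Type*} [MeasurableSpace α] {x y : α → X}
    (hx : Measurable x) (hy : Measurable y) : Measurable (fun a => G δ (x a) (y a)) :=
  Measurable.tsum fun k => by fun_prop

@[fun_prop]
lemma measurable_ind' {S : Set X} (hS : MeasurableSet S) {α : Type*} [MeasurableSpace α] {x : α → X}
    (hx : Measurable x) : Measurable (fun a => ind S (x a)) := (measurable_ind hS).comp hx

/-- expected number of entrances -/
noncomputable def ef (δ : ℝ) (A D : Set X) (y : X) : ℝ≥0∞ := ∫⁻ x, hk δ D y x * ind A x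

lemma Tr_L1 {δ : ℝ} (hδ : 0 < δ) {A B : Set X} (hA : MeasurableSet A) (hB : MeasurableSet B) (m k : ℕ) :
    Tr δ (L1 A B m k) = ∫⁻ x, ∫⁻ y, ind A x * (pk ((m + 1 : ℕ) * δ) x y * (ind B y * J δ (List.replicate k (ind (A ∪ B)ᶜ)) y x)) := by
  rw [L1, Tr]
  refine lintegral_congr fun x => ?_
  have hD := (hA.union hB).compl
  rw [J_append _ _ _ _ (rep_one_meas m) (measurable_ind hB) (rep_meas hD k), ← lintegral_const_mul]
  · simp_rw [J_one hδ]
  · simp_rw [J_one hδ]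
    refine Measurable.mul (by fun_prop) (Measurable.mul (measurable_ind hB) (measurable_J' (rep_meas hD k) (by fun_prop) (by fun_prop) (by fun_prop)))

lemma sum_L1 {δ : ℝ} (hδ : 0 < δ) {A B : Set X} (hA : MeasurableSet A) (hB : MeasurableSet B) :
    ∑' k : ℕ, ∑' m : ℕ, Tr δ (L1 A B m k) =
      ∫⁻ x, ∫⁻ y, ind A x * (G δ x y * (ind B y * hk δ (A ∪ B)ᶜ y x)) := by
  have hD := (hA.union hB).compl
  simp_rw [Tr_L1 hδ hA hB]
  have hm : ∀ k m : ℕ, Measurable fun q : X × X => ind A q.1 * (pk ((m + 1 : ℕ) * δ) q.1 q.2 * (ind B q.2 * J δ (List.replicate k (ind (A ∪ B)ᶜ)) q.2 q.1)) := by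
    intro k m
    have := measurable_J' (rep_meas hD k) (α := X × X) (t := fun _ => δ) measurable_const measurable_snd measurable_fst
    have h2 := measurable_ind' hA (α := X × X) measurable_fst
    have h3 := measurable_ind' hB (α := X × X) measurable_snd
    fun_prop
  have e1 : ∀ x y, ind A x * (G δ x y * (ind B y * hk δ (A ∪ B)ᶜ y x)) = ∑' k : ℕ, ∑' m : ℕ,
      ind A x * (pk ((m + 1 : ℕ) * δ) x y * (ind B y * J δ (List.replicate k (ind (A ∪ B)ᶜ)) y x)) := by
    intro x y
    unfold G hk
    simp_rw [ENNReal.tsum_mul_left, ENNReal.tsum_mul_right, ENNReal.tsum_mul_left]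
  simp_rw [e1]
  have e2 : ∀ x, ∫⁻ y, (∑' k : ℕ, ∑' m : ℕ,
      ind A x * (pk ((m + 1 : ℕ) * δ) x y * (ind B y * J δ (List.replicate k (ind (A ∪ B)ᶜ)) y x))) =
      ∑' k : ℕ, ∑' m : ℕ, ∫⁻ y,
      ind A x * (pk ((m + 1 : ℕ) * δ) x y * (ind B y * J δ (List.replicate k (ind (A ∪ B)ᶜ)) y x)) := by
    intro x
    have hm' : ∀ k m : ℕ, Measurable fun y => ind A x * (pk ((m + 1 : ℕ) * δ) x y * (ind B y * J δ (List.replicate k (ind (A ∪ B)ᶜ)) y x)) :=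
      fun k m => (hm k m).comp measurable_prodMk_left
    rw [lintegral_tsum fun k => (Measurable.tsum fun m => hm' k m).aemeasurable]
    refine tsum_congr fun k => ?_
    rw [lintegral_tsum fun m => (hm' k m).aemeasurable]
  simp_rw [e2]
  have hm3 : ∀ k m : ℕ, Measurable fun x => ∫⁻ y, ind A x * (pk ((m + 1 : ℕ) * δ) x y * (ind B y * J δ (List.replicate k (ind (A ∪ B)ᶜ)) y x)) :=
    fun k m => (hm k m).lintegral_prod_right'
  rw [lintegral_tsum fun k => (Measurable.tsum fun m => hm3 k m).aemeasurable]
  refine tsum_congr fun k => ?_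
  rw [lintegral_tsum fun m => (hm3 k m).aemeasurable]

/-- normalized crossing functional -/
noncomputable def II (δ : ℝ) (g : X → ℝ≥0∞) (A B : Set X) : ℝ≥0∞ := ∫⁻ y, g y * (ind B y * ef δ A (A ∪ B)ᶜ y)

lemma II_eq {δ : ℝ} {A B : Set X} (hA : MeasurableSet A) (hB : MeasurableSet B)
    {g : X → ℝ≥0∞} (hg : Measurable g) :
    ∫⁻ x, ∫⁻ y, ind A x * (g y * (ind B y * hk δ (A ∪ B)ᶜ y x)) = II δ g A B := by
  have hD := (hA.union hB).compl
  have h2 := measurable_ind' hA (α := X × X) measurable_fst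
  have h3 := measurable_ind' hB (α := X × X) measurable_snd
  have h4 := measurable_hk δ hD (α := X × X) measurable_snd measurable_fst
  rw [lintegral_lintegral_swap (by fun_prop), II]
  refine lintegral_congr fun y => ?_
  rw [ef, ← lintegral_const_mul, ← lintegral_const_mul]
  · refine lintegral_congr fun x => ?_
    ring
  · have h5 := measurable_hk δ hD (α := X) (measurable_const (a := y)) measurable_id
    have := measurable_ind hA
    fun_prop
  · have h5 := measurable_hk δ hD (α := X) (measurable_const (a := y)) measurable_id
    have := measurable_ind hA
    fun_prop

lemma ind_mul_le {S : Set X} {x : X} {a b : ℝ≥0∞} (h : x ∈ S → a ≤ b) : ind S x * a ≤ ind S x * b := by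
  unfold ind
  split_ifs with hx
  · simpa using h hx
  · simp

lemma sum_L1_le {δ : ℝ} (hδ : 0 < δ) {A B : Set X} (hA : MeasurableSet A) (hB : MeasurableSet B)
    {g : X → ℝ≥0∞} (hg : Measurable g) {K : ℝ≥0∞} (hK : ∀ x ∈ A, ∀ y ∈ B, G δ x y ≤ K * g y) :
    ∑' k : ℕ, ∑' m : ℕ, Tr δ (L1 A B m k) ≤ K * II δ g A B := by
  have hD := (hA.union hB).compl
  rw [sum_L1 hδ hA hB]
  have : K * II δ g A B = II δ (fun y => K * g y) A B := by
    unfold II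
    simp_rw [mul_assoc]
    rw [lintegral_const_mul]
    have : Measurable (ef δ A (A ∪ B)ᶜ) := by
      refine Measurable.lintegral_prod_right' (f := fun q : X × X => hk δ (A ∪ B)ᶜ q.1 q.2 * ind A q.2) ?_
      have h2 := measurable_ind' hA (α := X × X) measurable_snd
      have h4 := measurable_hk δ hD (α := X × X) measurable_fst measurable_snd
      fun_prop
    have h3 := measurable_ind hB
    fun_prop
  rw [this, ← II_eq hA hB (by fun_prop)]
  refine lintegral_mono fun x => lintegral_mono fun y => ?_
  refine ind_mul_le fun hx => ?_
  rw [mul_left_comm, mul_left_comm (K * g y)]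
  refine ind_mul_le fun hy => ?_
  gcongr
  exact hK x hx y hy

lemma measurable_ef (δ : ℝ) {A D : Set X} (hA : MeasurableSet A) (hD : MeasurableSet D) : Measurable (ef δ A D) := by
  refine Measurable.lintegral_prod_right' (f := fun q : X × X => hk δ D q.1 q.2 * ind A q.2) ?_
  have h2 := measurable_ind' hA (α := X × X) measurable_snd
  have h4 := measurable_hk δ hD (α := X × X) measurable_fst measurable_snd
  fun_prop

lemma le_sum_L1 {δ : ℝ} (hδ : 0 < δ) {A B : Set X} (hA : MeasurableSet A) (hB : MeasurableSet B)
    {g : X → ℝ≥0∞} (hg : Measurable g) (hK : ∀ x ∈ A, ∀ y ∈ B, g y ≤ G δ x y) :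
    II δ g A B ≤ ∑' k : ℕ, ∑' m : ℕ, Tr δ (L1 A B m k) := by
  rw [sum_L1 hδ hA hB, ← II_eq hA hB hg]
  refine lintegral_mono fun x => lintegral_mono fun y => ?_
  refine ind_mul_le fun hx => ?_
  rw [mul_left_comm, mul_left_comm (G δ x y)]
  refine ind_mul_le fun hy => ?_
  gcongr
  exact hK x hx y hy

end LoopAux

namespace LoopAux
open Set Filter Topology
open scoped ENNReal

lemma tsum_lint2 {f : ℕ → X → X → ℝ≥0∞} (hf : ∀ i, Measurable fun q : X × X => f i q.1 q.2) :
    ∑' i, ∫⁻ x, ∫⁻ y, f i x y = ∫⁻ x, ∫⁻ y, ∑' i, f i x y := by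
  rw [← lintegral_tsum fun i => (hf i).lintegral_prod_right'.aemeasurable]
  refine lintegral_congr fun x => ?_
  exact (lintegral_tsum fun i => ((hf i).comp (measurable_prodMk_left (x := x))).aemeasurable).symm

/-- word between two visits of `A` -/
noncomputable def LF (A B : Set X) (m k : ℕ) : List (X → ℝ≥0∞) :=
  List.replicate m 1 ++ ind B :: List.replicate k (ind (A ∪ B)ᶜ)

lemma LF_meas {A B : Set X} (hA : MeasurableSet A) (hB : MeasurableSet B) (m k : ℕ) :
    ∀ c ∈ LF A B m k, Measurable c := fun c hc => L1_meas hA hB m k c (List.mem_cons_of_mem _ hc)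

lemma Tr_L2 {δ : ℝ} {A B : Set X} (hA : MeasurableSet A) (hB : MeasurableSet B) (m₁ k₁ m k : ℕ) :
    Tr δ (L2 A B m₁ k₁ m k) = ∫⁻ x, ∫⁻ y, ind A x * (J δ (LF A B m₁ k₁) x y * (ind A y * J δ (LF A B m k) y x)) := by
  have : L2 A B m₁ k₁ m k = ind A :: (LF A B m₁ k₁ ++ ind A :: LF A B m k) := by
    simp [L2, LF, L1]
  rw [this, Tr]
  refine lintegral_congr fun x => ?_
  rw [J_append _ _ _ _ (LF_meas hA hB _ _) (measurable_ind hA) (LF_meas hA hB _ _), ← lintegral_const_mul]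
  have h1 := measurable_J' (LF_meas hA hB m₁ k₁) (α := X) (t := fun _ => δ) measurable_const (measurable_const (a := x)) measurable_id
  have h2 := measurable_J' (LF_meas hA hB m k) (α := X) (t := fun _ => δ) measurable_const measurable_id (measurable_const (a := x))
  have h3 := measurable_ind hA
  exact h1.mul (h3.mul h2)

lemma J_LF {δ : ℝ} (hδ : 0 < δ) {A B : Set X} (hA : MeasurableSet A) (hB : MeasurableSet B) (x y : X) :
    ∑' k : ℕ, ∑' m : ℕ, J δ (LF A B m k) x y = ∫⁻ z, G δ x z * (ind B z * hk δ (A ∪ B)ᶜ z y) := by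
  have hD := (hA.union hB).compl
  have hm : ∀ k m : ℕ, Measurable fun z => pk ((m + 1 : ℕ) * δ) x z * (ind B z * J δ (List.replicate k (ind (A ∪ B)ᶜ)) z y) := by
    intro k m
    have := measurable_J' (rep_meas hD k) (α := X) (t := fun _ => δ) measurable_const measurable_id (measurable_const (a := y))
    have h3 := measurable_ind hB
    fun_prop
  have e1 : ∀ z, G δ x z * (ind B z * hk δ (A ∪ B)ᶜ z y) = ∑' k : ℕ, ∑' m : ℕ,
      pk ((m + 1 : ℕ) * δ) x z * (ind B z * J δ (List.replicate k (ind (A ∪ B)ᶜ)) z y) := by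
    intro z
    unfold G hk
    simp_rw [ENNReal.tsum_mul_right, ENNReal.tsum_mul_left]
  simp_rw [e1]
  rw [lintegral_tsum fun k => (Measurable.tsum fun m => hm k m).aemeasurable]
  refine tsum_congr fun k => ?_
  rw [lintegral_tsum fun m => (hm k m).aemeasurable]
  refine tsum_congr fun m => ?_
  rw [LF, J_append _ _ _ _ (rep_one_meas m) (measurable_ind hB) (rep_meas hD k)]
  simp_rw [J_one hδ]

lemma sum_L2_le {δ : ℝ} (hδ : 0 < δ) {A B : Set X} (hA : MeasurableSet A) (hB : MeasurableSet B)
    {g : X → ℝ≥0∞} (hg : Measurable g) {K : ℝ≥0∞} (hK : ∀ x ∈ A, ∀ y ∈ B, G δ x y ≤ K * g y) :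
    ∑' k : ℕ, ∑' m₁ : ℕ, ∑' k₁ : ℕ, ∑' m : ℕ, Tr δ (L2 A B m₁ k₁ m k) ≤ (K * II δ g A B) ^ 2 := by
  have hD := (hA.union hB).compl
  simp_rw [Tr_L2 hA hB]
  have hA1 := measurable_ind' hA (α := X × X) measurable_fst
  have hA2 := measurable_ind' hA (α := X × X) measurable_snd
  have hm : ∀ m₁ k₁ m k : ℕ, Measurable fun q : X × X =>
      ind A q.1 * (J δ (LF A B m₁ k₁) q.1 q.2 * (ind A q.2 * J δ (LF A B m k) q.2 q.1)) := by
    intro m₁ k₁ m k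
    have h1 := measurable_J' (LF_meas hA hB m₁ k₁) (α := X × X) (t := fun _ => δ) measurable_const measurable_fst measurable_snd
    have h2 := measurable_J' (LF_meas hA hB m k) (α := X × X) (t := fun _ => δ) measurable_const measurable_snd measurable_fst
    fun_prop
  have e : ∑' k : ℕ, ∑' m₁ : ℕ, ∑' k₁ : ℕ, ∑' m : ℕ, ∫⁻ x, ∫⁻ y, ind A x * (J δ (LF A B m₁ k₁) x y * (ind A y * J δ (LF A B m k) y x)) =
      ∫⁻ x, ∫⁻ y, ∑' k : ℕ, ∑' m₁ : ℕ, ∑' k₁ : ℕ, ∑' m : ℕ, ind A x * (J δ (LF A B m₁ k₁) x y * (ind A y * J δ (LF A B m k) y x)) := by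
    rw [← tsum_lint2 (fun k => Measurable.tsum fun m₁ => Measurable.tsum fun k₁ => Measurable.tsum fun m => hm m₁ k₁ m k)]
    refine tsum_congr fun k => ?_
    rw [← tsum_lint2 (fun m₁ => Measurable.tsum fun k₁ => Measurable.tsum fun m => hm m₁ k₁ m k)]
    refine tsum_congr fun m₁ => ?_
    rw [← tsum_lint2 (fun k₁ => Measurable.tsum fun m => hm m₁ k₁ m k)]
    refine tsum_congr fun k₁ => ?_
    rw [← tsum_lint2 (fun m => hm m₁ k₁ m k)]
  rw [e]
  have e2 : ∀ x y, ∑' k : ℕ, ∑' m₁ : ℕ, ∑' k₁ : ℕ, ∑' m : ℕ, ind A x * (J δ (LF A B m₁ k₁) x y * (ind A y * J δ (LF A B m k) y x)) =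
      ind A x * ((∑' k : ℕ, ∑' m : ℕ, J δ (LF A B m k) x y) * (ind A y * ∑' k : ℕ, ∑' m : ℕ, J δ (LF A B m k) y x)) := by
    intro x y
    simp_rw [ENNReal.tsum_mul_left, ENNReal.tsum_mul_right, ENNReal.tsum_mul_left]
    rw [ENNReal.tsum_comm (f := fun k m => J δ (LF A B m k) x y)]
  simp_rw [e2, J_LF hδ hA hB]
  set ψ : X → ℝ≥0∞ := fun x => ∫⁻ z, g z * (ind B z * hk δ (A ∪ B)ᶜ z x) with hψ
  have hψm : Measurable ψ := by
    refine Measurable.lintegral_prod_right' (f := fun q : X × X => g q.2 * (ind B q.2 * hk δ (A ∪ B)ᶜ q.2 q.1)) ?_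
    have h2 := measurable_ind' hB (α := X × X) measurable_snd
    have h4 := measurable_hk δ hD (α := X × X) measurable_snd measurable_fst
    fun_prop
  have hb : ∀ x y, x ∈ A → ∫⁻ z, G δ x z * (ind B z * hk δ (A ∪ B)ᶜ z y) ≤ K * ψ y := by
    intro x y hx
    rw [hψ]
    have h5 := measurable_hk δ hD (α := X) measurable_id (measurable_const (a := y))
    have h3 := measurable_ind hB
    rw [← lintegral_const_mul _ (by fun_prop)]
    refine lintegral_mono fun z => ?_
    simp only
    rw [← mul_assoc K, mul_left_comm, mul_left_comm (K * g z)]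
    refine ind_mul_le fun hz => ?_
    gcongr
    exact hK x hx z hz
  have hindm := measurable_ind hA
  have hII : II δ g A B = ∫⁻ x, ind A x * ψ x := by
    rw [← II_eq hA hB hg]
    refine lintegral_congr fun x => ?_
    have h5 := measurable_hk δ hD (α := X) measurable_id (measurable_const (a := x))
    have h3 := measurable_ind hB
    rw [hψ, ← lintegral_const_mul _ (by fun_prop)]
  calc _ ≤ ∫⁻ x, ∫⁻ y, (ind A x * ψ x * K) * (K * (ind A y * ψ y)) := by
        refine lintegral_mono fun x => lintegral_mono fun y => ?_
        calc _ ≤ ind A x * (ind A y * ((K * ψ y) * (K * ψ x))) := by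
              refine ind_mul_le fun hx => ?_
              rw [mul_left_comm]
              refine ind_mul_le fun hy => ?_
              exact mul_le_mul' (hb x y hx) (hb y x hy)
          _ = _ := by ring
    _ = (∫⁻ x, ind A x * ψ x * K) * (∫⁻ y, K * (ind A y * ψ y)) := by
        rw [← lintegral_mul_const _ (by fun_prop)]
        refine lintegral_congr fun x => ?_
        rw [lintegral_const_mul _ (by fun_prop)]
    _ = _ := by
        rw [lintegral_mul_const _ (by fun_prop), lintegral_const_mul _ (by fun_prop), ← hII]
        ring

end LoopAux

namespace LoopAux
open Set Filter Topology
open scoped ENNReal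

lemma tsum_zero_add (f : ℕ → ℝ≥0∞) : ∑' n, f n = f 0 + ∑' n, f (n+1) :=
  tsum_eq_zero_add' ENNReal.summable

/-- transition operator -/
noncomputable def Pp (δ : ℝ) (f : X → ℝ≥0∞) (x : X) : ℝ≥0∞ := ∫⁻ y, pk δ x y * f y

lemma Pp_mono (δ : ℝ) {f g : X → ℝ≥0∞} (h : ∀ x, f x ≤ g x) (x : X) : Pp δ f x ≤ Pp δ g x :=
  lintegral_mono fun y => by gcongr; exact h y

lemma measurable_Pp (δ : ℝ) {f : X → ℝ≥0∞} (hf : Measurable f) : Measurable (Pp δ f) :=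
  Measurable.lintegral_prod_right' (f := fun q : X × X => pk δ q.1 q.2 * f q.2) (by fun_prop)

lemma Pp_add (δ : ℝ) {f : X → ℝ≥0∞} (hf : Measurable f) (g : X → ℝ≥0∞) (x : X) :
    Pp δ (fun y => f y + g y) x = Pp δ f x + Pp δ g x := by
  unfold Pp
  simp_rw [mul_add]
  rw [lintegral_add_left (by fun_prop)]

lemma Pp_const_mul (δ : ℝ) (c : ℝ≥0∞) {f : X → ℝ≥0∞} (hf : Measurable f) (x : X) :
    Pp δ (fun y => c * f y) x = c * Pp δ f x := by
  unfold Pp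
  rw [← lintegral_const_mul _ (by fun_prop)]
  refine lintegral_congr fun y => ?_
  ring

lemma Pp_const {δ : ℝ} (hδ : 0 < δ) (c : ℝ≥0∞) (x : X) : Pp δ (fun _ => c) x = c := by
  unfold Pp
  rw [lintegral_mul_const _ (by fun_prop), lintegral_pk hδ, one_mul]

lemma Pp_tsum (δ : ℝ) {f : ℕ → X → ℝ≥0∞} (hf : ∀ n, Measurable (f n)) (x : X) :
    Pp δ (fun y => ∑' n, f n y) x = ∑' n, Pp δ (f n) x := by
  unfold Pp
  simp_rw [← ENNReal.tsum_mul_left]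
  rw [lintegral_tsum fun n => by have := hf n; fun_prop]

lemma Pp_adj (δ : ℝ) {f g : X → ℝ≥0∞} (hf : Measurable f) (hg : Measurable g) :
    ∫⁻ x, Pp δ f x * g x = ∫⁻ x, f x * Pp δ g x := by
  unfold Pp
  have h1 : ∀ x, (∫⁻ y, pk δ x y * f y) * g x = ∫⁻ y, pk δ x y * f y * g x := fun x => by
    rw [lintegral_mul_const _ (by fun_prop)]
  have h2 : ∀ x, f x * (∫⁻ y, pk δ x y * g y) = ∫⁻ y, f x * (pk δ x y * g y) := fun x => by
    rw [lintegral_const_mul _ (by fun_prop)]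
  simp_rw [h1, h2]
  rw [lintegral_lintegral_swap (by fun_prop)]
  refine lintegral_congr fun x => lintegral_congr fun y => ?_
  rw [pk_symm]; ring

/-- terms of `ef` -/
noncomputable def ek (δ : ℝ) (A D : Set X) (k : ℕ) (y : X) : ℝ≥0∞ :=
  ∫⁻ x, J δ (List.replicate k (ind D)) y x * ind A x

lemma measurable_ek {δ : ℝ} {A D : Set X} (hA : MeasurableSet A) (hD : MeasurableSet D) (k : ℕ) : Measurable (ek δ A D k) := by
  refine Measurable.lintegral_prod_right' (f := fun q : X × X => J δ (List.replicate k (ind D)) q.1 q.2 * ind A q.2) ?_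
  exact (measurable_J' (rep_meas hD k) measurable_const measurable_fst measurable_snd).mul (measurable_ind' hA measurable_snd)

lemma ef_eq_tsum {δ : ℝ} {A D : Set X} (hA : MeasurableSet A) (hD : MeasurableSet D) (y : X) : ef δ A D y = ∑' k, ek δ A D k y := by
  unfold ef ek hk
  simp_rw [← ENNReal.tsum_mul_right]
  rw [lintegral_tsum]
  intro k
  exact ((measurable_J' (rep_meas hD k) measurable_const measurable_const measurable_id).mul (measurable_ind' hA measurable_id)).aemeasurable

lemma ek_zero {δ : ℝ} {A D : Set X} (y : X) : ek δ A D 0 y = Pp δ (ind A) y := by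
  simp [ek, Pp, J]

lemma ek_succ {δ : ℝ} {A D : Set X} (hA : MeasurableSet A) (hD : MeasurableSet D) (k : ℕ) (y : X) : ek δ A D (k+1) y = Pp δ (fun z => ind D z * ek δ A D k z) y := by
  simp only [ek, Pp, List.replicate_succ, J]
  have hD1 := measurable_ind hD
  have hA1 := measurable_ind hA
  have e1 : ∀ x, (∫⁻ z, pk δ y z * (ind D z * J δ (List.replicate k (ind D)) z x)) * ind A x =
      ∫⁻ z, pk δ y z * (ind D z * J δ (List.replicate k (ind D)) z x) * ind A x := by
    intro x
    have hJ := measurable_J' (rep_meas hD k) (α := X) (t := fun _ => δ) measurable_const measurable_id (measurable_const (a := x))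
    rw [lintegral_mul_const]
    exact (measurable_pk' measurable_const measurable_const measurable_id).mul (hD1.mul hJ)
  simp_rw [e1]
  rw [lintegral_lintegral_swap]
  · refine lintegral_congr fun z => ?_
    have hJ := measurable_J' (rep_meas hD k) (α := X) (t := fun _ => δ) measurable_const (measurable_const (a := z)) measurable_id
    have m : Measurable fun x => J δ (List.replicate k (ind D)) z x * ind A x := hJ.mul hA1
    rw [← lintegral_const_mul _ m, ← lintegral_const_mul _ (Measurable.const_mul m _)]
    refine lintegral_congr fun x => ?_
    ring
  · have hJ := measurable_J' (rep_meas hD k) (α := X × X) (t := fun _ => δ) measurable_const measurable_snd measurable_fst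
    have hD2 := measurable_ind' hD (α := X × X) measurable_snd
    have hA2 := measurable_ind' hA (α := X × X) measurable_fst
    exact (((measurable_pk' measurable_const measurable_const measurable_snd).mul (hD2.mul hJ)).mul hA2).aemeasurable

lemma ef_fix {δ : ℝ} {A D : Set X} (hA : MeasurableSet A) (hD : MeasurableSet D) (y : X) : ef δ A D y = Pp δ (fun z => ind A z + ind D z * ef δ A D z) y := by
  rw [ef_eq_tsum hA hD, tsum_zero_add, ek_zero, Pp_add _ (measurable_ind hA)]
  · congr 1
    simp_rw [ek_succ hA hD, ef_eq_tsum hA hD, ← ENNReal.tsum_mul_left]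
    exact (Pp_tsum δ (f := fun i z => ind D z * ek δ A D i z) (fun k => (measurable_ind hD).mul (measurable_ek hA hD k)) y).symm
  
/-- partial sums -/
lemma Ek_succ {δ : ℝ} {A D : Set X} (hA : MeasurableSet A) (hD : MeasurableSet D) (m : ℕ) (y : X) : ∑ k ∈ Finset.range (m+1), ek δ A D k y =
    Pp δ (fun z => ind A z + ind D z * ∑ k ∈ Finset.range m, ek δ A D k z) y := by
  rw [Finset.sum_range_succ', ek_zero, Pp_add _ (measurable_ind hA), add_comm]
  congr 1
  unfold Pp
  simp_rw [Finset.mul_sum]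
  rw [lintegral_finsetSum]
  · refine Finset.sum_congr rfl fun k _ => ?_
    rw [ek_succ hA hD, Pp]
  · intro k _
    have := measurable_ek (δ := δ) hA hD k
    have := measurable_ind hD
    fun_prop

/-- slices of the potential -/
noncomputable def an (δ : ℝ) (n : ℕ) (y : X) : ℝ≥0∞ := ∫⁻ s in Ioc 0 δ, pk (n * δ + s) 0 y

lemma measurable_an (δ : ℝ) (n : ℕ) : Measurable (an δ n) :=
  Measurable.lintegral_prod_right' (f := fun q : X × ℝ => pk (n * δ + q.2) 0 q.1) (by fun_prop)

lemma an_eq (δ : ℝ) (n : ℕ) (y : X) : an δ n y = ∫⁻ s in Ioc (n * δ) ((n+1) * δ), pk s 0 y := by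
  unfold an
  have hemb : MeasurableEmbedding (fun s : ℝ => n * δ + s) := measurableEmbedding_addLeft _
  have hmp : MeasurePreserving (fun s : ℝ => n * δ + s) volume volume := measurePreserving_add_left volume _
  rw [← hmp.setLIntegral_comp_preimage_emb hemb (fun s => pk s 0 y) (Ioc (n * δ) ((n+1) * δ))]
  congr 2
  ext s
  simp only [Set.mem_preimage, Set.mem_Ioc]
  constructor <;> rintro ⟨h1, h2⟩ <;> constructor <;> linarith

lemma v_eq_tsum {δ : ℝ} (hδ : 0 < δ) (y : X) : v y = ∑' n, an δ n y := by
  simp_rw [an_eq]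
  rw [v, ← lintegral_iUnion (fun n => measurableSet_Ioc)]
  · congr 2
    ext s
    simp only [Set.mem_iUnion, Set.mem_Ioc, Set.mem_Ioi]
    constructor
    · intro hs
      have hc : 0 < ⌈s / δ⌉₊ := Nat.ceil_pos.2 (by positivity)
      refine ⟨⌈s / δ⌉₊ - 1, ?_, ?_⟩
      · have h := Nat.ceil_lt_add_one (a := s / δ) (by positivity)
        rw [Nat.cast_sub hc, ← lt_div_iff₀ hδ]
        push_cast; linarith
      · have h := Nat.le_ceil (s / δ)
        rw [Nat.cast_sub hc, ← div_le_iff₀ hδ]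
        push_cast; linarith
    · rintro ⟨n, hn, -⟩
      exact lt_of_le_of_lt (by positivity) hn
  · intro i j hij
    rw [Function.onFun, Set.disjoint_left]
    rintro s ⟨h1, h2⟩ ⟨h3, h4⟩
    rcases lt_or_gt_of_ne hij with h | h
    · have : (i:ℝ) + 1 ≤ j := by exact_mod_cast h
      nlinarith
    · have : (j:ℝ) + 1 ≤ i := by exact_mod_cast h
      nlinarith

lemma an_succ {δ : ℝ} (hδ : 0 < δ) (n : ℕ) (y : X) : an δ (n+1) y = Pp δ (an δ n) y := by
  unfold an Pp
  have e1 : ∀ z, pk δ y z * ∫⁻ s in Ioc 0 δ, pk (n * δ + s) 0 z = ∫⁻ s in Ioc 0 δ, pk δ y z * pk (n * δ + s) 0 z := by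
    intro z
    rw [lintegral_const_mul _ (by fun_prop)]
  simp_rw [e1]
  rw [lintegral_lintegral_swap (by fun_prop)]
  refine setLIntegral_congr_fun measurableSet_Ioc fun s hs => ?_
  have hs0 : 0 < s := hs.1
  have : ∀ z, pk δ y z * pk (n * δ + s) 0 z = pk (n * δ + s) 0 z * pk δ z y := fun z => by
    rw [pk_symm δ, mul_comm]
  simp only [this]
  rw [pk_comp (by positivity) hδ]
  congr 1
  push_cast; ring

lemma an_add {δ : ℝ} (hδ : 0 < δ) (n : ℕ) : an δ n = (Pp δ)^[n] (an δ 0) := by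
  induction n with
  | zero => rfl
  | succ n ih =>
    rw [Function.iterate_succ_apply', ← ih]
    ext y; exact an_succ hδ n y

lemma measurable_iter (δ : ℝ) {f : X → ℝ≥0∞} (hf : Measurable f) (n : ℕ) : Measurable ((Pp δ)^[n] f) := by
  induction n with
  | zero => exact hf
  | succ n ih => rw [Function.iterate_succ_apply']; exact measurable_Pp δ ih

lemma an_pair {δ : ℝ} (hδ : 0 < δ) (n : ℕ) {f : X → ℝ≥0∞} (hf : Measurable f) :
    ∫⁻ x, an δ n x * f x = ∫⁻ x, an δ 0 x * (Pp δ)^[n] f x := by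
  induction n generalizing f with
  | zero => rfl
  | succ n ih =>
    simp_rw [an_succ hδ]
    rw [Pp_adj δ (measurable_an δ n) hf, ih (measurable_Pp δ hf)]
    rfl

/-- Green operator including time zero -/
noncomputable def Nn (δ : ℝ) (f : X → ℝ≥0∞) (x : X) : ℝ≥0∞ := ∑' n, (Pp δ)^[n] f x

lemma measurable_Nn (δ : ℝ) {f : X → ℝ≥0∞} (hf : Measurable f) : Measurable (Nn δ f) :=
  Measurable.tsum fun n => measurable_iter δ hf n

lemma v_pair {δ : ℝ} (hδ : 0 < δ) {f : X → ℝ≥0∞} (hf : Measurable f) :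
    ∫⁻ x, v x * f x = ∫⁻ x, an δ 0 x * Nn δ f x := by
  simp_rw [v_eq_tsum hδ, Nn, ← ENNReal.tsum_mul_right, ← ENNReal.tsum_mul_left]
  have m1 : ∀ n, AEMeasurable (fun x => an δ n x * f x) := fun n => ((measurable_an δ n).mul hf).aemeasurable
  have m2 : ∀ n, AEMeasurable (fun x => an δ 0 x * (Pp δ)^[n] f x) := fun n => ((measurable_an δ 0).mul (measurable_iter δ hf n)).aemeasurable
  rw [lintegral_tsum m1, lintegral_tsum m2]
  exact tsum_congr fun n => an_pair hδ n hf

lemma Nn_fix (δ : ℝ) {f : X → ℝ≥0∞} (hf : Measurable f) (x : X) : Nn δ f x = f x + Pp δ (Nn δ f) x := by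
  unfold Nn
  rw [tsum_zero_add, Pp_tsum δ (measurable_iter δ hf)]
  simp [Function.iterate_succ_apply']

lemma lintegral_an {δ : ℝ} (hδ : 0 < δ) : ∫⁻ x, an δ 0 x = ENNReal.ofReal δ := by
  unfold an
  rw [lintegral_lintegral_swap (by fun_prop)]
  rw [setLIntegral_congr_fun (g := fun _ => 1) measurableSet_Ioc]
  · simp
  · intro s hs
    simp only [CharP.cast_eq_zero, zero_mul, zero_add]
    exact lintegral_pk hs.1 0

lemma Pp_v {δ : ℝ} (hδ : 0 < δ) (x : X) : v x = an δ 0 x + Pp δ v x := by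
  conv_lhs => rw [v_eq_tsum hδ, tsum_zero_add]
  congr 1
  have : v = fun y => ∑' n, an δ n y := funext (v_eq_tsum hδ)
  rw [this, Pp_tsum δ (measurable_an δ)]
  exact tsum_congr fun n => an_succ hδ n x

/-- partial Green sums -/
noncomputable def Sm (δ : ℝ) (f : X → ℝ≥0∞) : ℕ → X → ℝ≥0∞
  | 0 => 0
  | m+1 => fun x => f x + Pp δ (Sm δ f m) x

lemma Sm_eq (δ : ℝ) {f : X → ℝ≥0∞} (hf : Measurable f) (m : ℕ) (x : X) :
    Sm δ f m x = ∑ n ∈ Finset.range m, (Pp δ)^[n] f x := by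
  induction m generalizing x with
  | zero => simp [Sm]
  | succ m ih =>
    rw [Finset.sum_range_succ', Sm, add_comm]
    congr 1
    have e : Sm δ f m = fun y => ∑ n ∈ Finset.range m, (Pp δ)^[n] f y := funext ih
    rw [e]
    simp only [Pp]
    have e2 : ∀ y, pk δ x y * ∑ n ∈ Finset.range m, (Pp δ)^[n] f y = ∑ n ∈ Finset.range m, pk δ x y * (Pp δ)^[n] f y :=
      fun y => Finset.mul_sum _ _ _
    rw [lintegral_congr e2, lintegral_finsetSum]
    · simp only [Function.iterate_succ_apply']
      rfl
    · intro k _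
      have := measurable_iter δ hf k
      fun_prop

end LoopAux

namespace LoopAux
open Set Filter Topology
open scoped ENNReal

lemma ind_mem {S : Set X} {x : X} (h : x ∈ S) : ind S x = 1 := by simp [ind, h]
lemma ind_not {S : Set X} {x : X} (h : x ∉ S) : ind S x = 0 := by simp [ind, h]

/-- partial sums of `ef` -/
noncomputable def Ek (δ : ℝ) (A D : Set X) (m : ℕ) (y : X) : ℝ≥0∞ := ∑ k ∈ Finset.range m, ek δ A D k y

lemma measurable_Ek {δ : ℝ} {A D : Set X} (hA : MeasurableSet A) (hD : MeasurableSet D) (m : ℕ) :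
    Measurable (Ek δ A D m) :=
  Finset.measurable_fun_sum _ fun k _ => measurable_ek hA hD k

lemma Ek_mono {δ : ℝ} {A D : Set X} {m n : ℕ} (h : m ≤ n) (y : X) : Ek δ A D m y ≤ Ek δ A D n y :=
  Finset.sum_le_sum_of_subset (by simpa using h)

noncomputable def Nm (δ : ℝ) (A B D : Set X) : ℕ → X → ℝ≥0∞
  | 0 => fun _ => 0
  | m+1 => fun x => ind B x * Ek δ A D (m+1) x + Pp δ (Nm δ A B D m) x

lemma Nm_succ (δ : ℝ) (A B D : Set X) (m : ℕ) (x : X) :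
    Nm δ A B D (m+1) x = ind B x * Ek δ A D (m+1) x + Pp δ (Nm δ A B D m) x := rfl

lemma Nm_bound {δ : ℝ} (hδ : 0 < δ) {A B : Set X} (hA : MeasurableSet A) (hB : MeasurableSet B)
    (hAB : Disjoint A B) {κ β : ℝ≥0∞} (h1 : ∀ x ∈ A, 1 + β ≤ κ * v x) (h2 : ∀ x ∈ B, κ * v x ≤ β) (m : ℕ) :
    (∀ x, Nm δ A B (A ∪ B)ᶜ m x ≤ β) ∧
    (∀ x ∈ (A ∪ B)ᶜ, Ek δ A (A ∪ B)ᶜ m x + Nm δ A B (A ∪ B)ᶜ m x ≤ κ * v x) ∧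
    (∀ x ∈ B, Nm δ A B (A ∪ B)ᶜ m x ≤ κ * v x) := by
  have hD : MeasurableSet (A ∪ B)ᶜ := (hA.union hB).compl
  induction m with
  | zero => simp [Nm, Ek]
  | succ m ih =>
    obtain ⟨i1, i2, i3⟩ := ih
    set D := (A ∪ B)ᶜ with hDdef
    have hM : ∀ x, Ek δ A D (m+1) x + Pp δ (Nm δ A B D m) x ≤ κ * v x := by
      intro x
      have e1 : Ek δ A D (m+1) x + Pp δ (Nm δ A B D m) x =
          Pp δ (fun z => (ind A z + ind D z * Ek δ A D m z) + Nm δ A B D m z) x := by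
        rw [Pp_add δ (f := fun z => ind A z + ind D z * Ek δ A D m z) ((measurable_ind hA).add ((measurable_ind hD).mul (measurable_Ek hA hD m)))]
        congr 1
        exact Ek_succ hA hD m x
      rw [e1]
      calc _ ≤ Pp δ (fun z => κ * v z) x := by
            refine Pp_mono δ (fun z => ?_) x
            by_cases hzA : z ∈ A
            · have : z ∉ D := fun h => h (Or.inl hzA)
              rw [ind_mem hzA, ind_not this, zero_mul, add_zero]
              exact le_trans (by gcongr; exact i1 z) (h1 z hzA)
            · by_cases hzB : z ∈ B
              · have : z ∉ D := fun h => h (Or.inr hzB)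
                rw [ind_not hzA, ind_not this, zero_mul, add_zero, zero_add]
                exact i3 z hzB
              · have : z ∈ D := fun h => h.elim hzA hzB
                rw [ind_not hzA, ind_mem this, one_mul, zero_add]
                exact i2 z this
        _ = κ * Pp δ v x := Pp_const_mul δ κ measurable_v x
        _ ≤ κ * v x := by
            gcongr
            rw [Pp_v hδ x]; exact le_add_self
    have hB3 : ∀ x ∈ B, Nm δ A B D (m+1) x ≤ κ * v x := by
      intro x hx
      rw [Nm_succ, ind_mem hx, one_mul]; exact hM x
    refine ⟨fun x => ?_, fun x hx => ?_, hB3⟩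
    · by_cases hx : x ∈ B
      · exact (hB3 x hx).trans (h2 x hx)
      · rw [Nm_succ, ind_not hx, zero_mul, zero_add]
        exact (Pp_mono δ i1 x).trans (Pp_const hδ β x).le
    · have : x ∉ B := fun h => hx (Or.inr h)
      rw [Nm_succ, ind_not this, zero_mul, zero_add]
      exact hM x

lemma Sm_le_Nm (δ : ℝ) (A B D : Set X) (j m : ℕ) (x : X) :
    Sm δ (fun y => ind B y * Ek δ A D j y) m x ≤ Nm δ A B D (m + j) x := by
  induction m generalizing x with
  | zero => simp [Sm]
  | succ m ih =>
    rw [show m + 1 + j = (m + j) + 1 by ring, Sm, Nm]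
    refine add_le_add (mul_le_mul' le_rfl ?_) ?_
    · exact Ek_mono (by omega) x
    · exact Pp_mono δ ih x

lemma II_upper {δ : ℝ} (hδ : 0 < δ) {A B : Set X} (hA : MeasurableSet A) (hB : MeasurableSet B)
    (hAB : Disjoint A B) {κ β : ℝ≥0∞} (h1 : ∀ x ∈ A, 1 + β ≤ κ * v x) (h2 : ∀ x ∈ B, κ * v x ≤ β) :
    II δ v A B ≤ β * ENNReal.ofReal δ := by
  have hD : MeasurableSet (A ∪ B)ᶜ := (hA.union hB).compl
  have key : ∀ j, ∫⁻ x, v x * (ind B x * Ek δ A (A ∪ B)ᶜ j x) ≤ β * ENNReal.ofReal δ := by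
    intro j
    have hm : Measurable (fun x => ind B x * Ek δ A (A ∪ B)ᶜ j x) := (measurable_ind hB).mul (measurable_Ek hA hD j)
    rw [v_pair hδ hm]
    have : ∀ x, Nn δ (fun x => ind B x * Ek δ A (A ∪ B)ᶜ j x) x ≤ β := by
      intro x
      refine ENNReal.tsum_le_of_sum_range_le fun m => ?_
      rw [← Sm_eq δ hm m x]
      exact (Sm_le_Nm δ A B _ j m x).trans ((Nm_bound hδ hA hB hAB h1 h2 _).1 x)
    calc _ ≤ ∫⁻ x, an δ 0 x * β := lintegral_mono fun x => by gcongr; exact this x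
      _ = _ := by rw [lintegral_mul_const _ (measurable_an δ 0), lintegral_an hδ, mul_comm]
  unfold II
  have e : ∀ y, v y * (ind B y * ef δ A (A ∪ B)ᶜ y) = ∑' k, v y * (ind B y * ek δ A (A ∪ B)ᶜ k y) := by
    intro y
    rw [ef_eq_tsum hA hD, ENNReal.tsum_mul_left, ENNReal.tsum_mul_left]
  have m1 : ∀ k, Measurable (fun y => v y * (ind B y * ek δ A (A ∪ B)ᶜ k y)) := fun k =>
    measurable_v.mul ((measurable_ind hB).mul (measurable_ek hA hD k))
  rw [lintegral_congr e, lintegral_tsum fun k => (m1 k).aemeasurable]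
  refine ENNReal.tsum_le_of_sum_range_le fun j => ?_
  rw [← lintegral_finsetSum _ fun k _ => m1 k]
  refine le_trans (le_of_eq ?_) (key j)
  refine lintegral_congr fun y => ?_
  rw [Ek, Finset.mul_sum, Finset.mul_sum]

end LoopAux

namespace LoopAux
open Set Filter Topology
open scoped ENNReal

lemma lintegral_Ioi_slices {δ : ℝ} (hδ : 0 < δ) (F : ℝ → ℝ≥0∞) :
    ∫⁻ s in Ioi 0, F s = ∑' n : ℕ, ∫⁻ s in Ioc (n * δ) ((n+1) * δ), F s := by
  rw [← lintegral_iUnion (fun n => measurableSet_Ioc)]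
  · congr 2
    ext s
    simp only [Set.mem_iUnion, Set.mem_Ioc, Set.mem_Ioi]
    constructor
    · intro hs
      have hc : 0 < ⌈s / δ⌉₊ := Nat.ceil_pos.2 (by positivity)
      refine ⟨⌈s / δ⌉₊ - 1, ?_, ?_⟩
      · have h := Nat.ceil_lt_add_one (a := s / δ) (by positivity)
        rw [Nat.cast_sub hc, ← lt_div_iff₀ hδ]
        push_cast; linarith
      · have h := Nat.le_ceil (s / δ)
        rw [Nat.cast_sub hc, ← div_le_iff₀ hδ]
        push_cast; linarith
    · rintro ⟨n, hn, -⟩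
      exact lt_of_le_of_lt (by positivity) hn
  · intro i j hij
    rw [Function.onFun, Set.disjoint_left]
    rintro s ⟨h1, h2⟩ ⟨h3, h4⟩
    rcases lt_or_gt_of_ne hij with h | h
    · have : (i:ℝ) + 1 ≤ j := by exact_mod_cast h
      nlinarith
    · have : (j:ℝ) + 1 ≤ i := by exact_mod_cast h
      nlinarith

/-- Riemann sums of the one dimensional profile -/
noncomputable def Rs (δ : ℝ) : ℝ≥0∞ := ENNReal.ofReal δ * ∑' m : ℕ, fk ((m + 1 : ℕ) * δ) 1

lemma Rs_eq {δ : ℝ} (hδ : 0 < δ) : Rs δ = ∫⁻ t in Ioi 0, fk (δ * ⌈t / δ⌉₊) 1 := by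
  rw [lintegral_Ioi_slices hδ, Rs, ← ENNReal.tsum_mul_left]
  refine tsum_congr fun n => ?_
  rw [setLIntegral_congr_fun (g := fun _ => fk ((n + 1 : ℕ) * δ) 1) measurableSet_Ioc]
  · rw [setLIntegral_const, Real.volume_Ioc, mul_comm]
    congr 2
    ring
  · intro t ht
    have : ⌈t / δ⌉₊ = n + 1 := by
      rw [Nat.ceil_eq_iff (by omega)]
      constructor
      · rw [lt_div_iff₀ hδ]; simpa using ht.1
      · rw [div_le_iff₀ hδ]; push_cast; exact ht.2
    simp only [this]
    rw [mul_comm]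

lemma fk_continuousAt {t : ℝ} (ht : 0 < t) (d : ℝ) : ContinuousAt (fun s => fk s d) t := by
  unfold fk
  refine ENNReal.continuous_ofReal.continuousAt.comp ?_
  have h1 : ContinuousAt (fun s : ℝ => (2 * π * s) ^ (-(3:ℝ)/2)) t :=
    ContinuousAt.rpow_const (by fun_prop) (Or.inl (by positivity))
  have h2 : ContinuousAt (fun s : ℝ => Real.exp (-d ^ 2 / (2 * s))) t := by
    refine Real.continuous_exp.continuousAt.comp (ContinuousAt.div (by fun_prop) (by fun_prop) (by positivity))
  exact h1.mul h2

lemma tendsto_ceil {t : ℝ} (ht : 0 < t) : Tendsto (fun δ : ℝ => δ * ⌈t / δ⌉₊) (𝓝[>] 0) (𝓝 t) := by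
  have h0 : Tendsto (fun δ : ℝ => t + δ) (𝓝[>] 0) (𝓝 t) := by
    have : Tendsto (fun δ : ℝ => t + δ) (𝓝 0) (𝓝 (t + 0)) := tendsto_const_nhds.add tendsto_id
    rw [add_zero] at this
    exact this.mono_left nhdsWithin_le_nhds
  refine tendsto_of_tendsto_of_tendsto_of_le_of_le' tendsto_const_nhds h0 ?_ ?_
  · filter_upwards [self_mem_nhdsWithin] with δ hδ
    have hδ : 0 < δ := hδ
    have := Nat.le_ceil (t / δ)
    rw [div_le_iff₀ hδ] at this
    linarith
  · filter_upwards [self_mem_nhdsWithin] with δ hδ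
    have hδ : 0 < δ := hδ
    have := (Nat.ceil_lt_add_one (a := t / δ) (by positivity)).le
    calc δ * ⌈t / δ⌉₊ ≤ δ * (t / δ + 1) := by gcongr
      _ = t + δ := by field_simp

lemma tendsto_Rs : Tendsto Rs (𝓝[>] 0) (𝓝 C0) := by
  have h : Tendsto (fun δ : ℝ => ∫⁻ t in Ioi 0, fk (δ * ⌈t / δ⌉₊) 1) (𝓝[>] 0) (𝓝 C0) := by
    unfold C0
    refine tendsto_lintegral_filter_of_dominated_convergence maj ?_ ?_ lintegral_maj ?_
    · refine Eventually.of_forall fun δ => ?_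
      have : Measurable (fun t : ℝ => (⌈t / δ⌉₊ : ℝ)) :=
        (measurable_from_top (f := fun n : ℕ => (n:ℝ))).comp (Nat.measurable_ceil.comp (measurable_id.div_const δ))
      exact (measurable_fk' (measurable_const.mul this) measurable_const)
    · filter_upwards [self_mem_nhdsWithin] with δ hδ
      have hδ : 0 < δ := hδ
      refine (ae_restrict_iff' measurableSet_Ioi).2 (Eventually.of_forall fun t ht => ?_)
      refine fk_le_maj ht ?_
      have := Nat.le_ceil (t / δ)
      rw [div_le_iff₀ hδ] at this
      linarith
    · refine (ae_restrict_iff' measurableSet_Ioi).2 (Eventually.of_forall fun t ht => ?_)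
      exact (fk_continuousAt ht 1).tendsto.comp (tendsto_ceil ht)
  refine h.congr' ?_
  filter_upwards [self_mem_nhdsWithin] with δ hδ
  exact (Rs_eq hδ).symm

lemma G_eq_Rs {δ : ℝ} (hδ : 0 < δ) {x y : X} (h : x ≠ y) :
    G δ x y = ENNReal.ofReal δ⁻¹ * (ENNReal.ofReal ‖x - y‖⁻¹ * Rs (δ / ‖x - y‖ ^ 2)) := by
  have hd : 0 < ‖x - y‖ := norm_pos_iff.2 (sub_ne_zero.2 h)
  set d := ‖x - y‖ with hdef
  have e : G δ x y = ENNReal.ofReal (d⁻¹ ^ 3) * ∑' m : ℕ, fk ((m + 1 : ℕ) * (δ / d ^ 2)) 1 := by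
    rw [G, ← ENNReal.tsum_mul_left]
    refine tsum_congr fun m => ?_
    rw [pk_eq_fk, ← fk_scale hd (by positivity)]
    congr 1
    field_simp
  rw [e, Rs, ← mul_assoc, ← mul_assoc, ← ENNReal.ofReal_mul (by positivity), ← ENNReal.ofReal_mul (by positivity)]
  congr 2
  field_simp

lemma v_eq' {x : X} (hx : x ≠ 0) : v x = C0 * ENNReal.ofReal ‖x‖⁻¹ := by
  rw [v_eq hx, div_eq_mul_inv, ENNReal.ofReal_inv_of_pos (norm_pos_iff.2 hx)]

lemma fk_anti {s d e : ℝ} (hs : 0 < s) (hd : 0 ≤ d) (h : d ≤ e) : fk s e ≤ fk s d := by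
  unfold fk
  apply ENNReal.ofReal_le_ofReal
  gcongr

lemma v_ge {x : X} {a : ℝ} (ha : 0 < a) (h : ‖x‖ ≤ a) : C0 * ENNReal.ofReal a⁻¹ ≤ v x := by
  obtain ⟨y, hy⟩ : ∃ y : X, ‖y‖ = a := ⟨EuclideanSpace.single 0 a, by simp [abs_of_pos ha]⟩
  have hy0 : y ≠ 0 := norm_pos_iff.1 (by rw [hy]; exact ha)
  have := v_eq' hy0
  rw [hy] at this
  rw [← this]
  refine setLIntegral_mono' measurableSet_Ioi fun s hs => ?_
  rw [pk_eq_fk, pk_eq_fk]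
  refine fk_anti hs (norm_nonneg _) ?_
  simpa [hy] using h

lemma v_le {x : X} {b : ℝ} (hb : 0 < b) (h : b ≤ ‖x‖) : v x ≤ C0 * ENNReal.ofReal b⁻¹ := by
  have hx : x ≠ 0 := norm_pos_iff.1 (hb.trans_le h)
  rw [v_eq' hx]
  gcongr

lemma G_bounds {a b ε : ℝ} (ha : 0 < a) (hab : a < b) (hε : 0 < ε) (hε1 : ε < 1) :
    ∃ δ0 > 0, ∀ δ, 0 < δ → δ < δ0 → ∀ x y : X, ‖x‖ < a → b < ‖y‖ →
      G δ x y ≤ ENNReal.ofReal ((1 + ε) / (1 - a / b)) * (ENNReal.ofReal δ⁻¹ * v y) ∧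
      ENNReal.ofReal ((1 - ε) / (1 + a / b)) * (ENNReal.ofReal δ⁻¹ * v y) ≤ G δ x y := by
  have hC : (0:ℝ) < C0.toReal := ENNReal.toReal_pos C0_ne_zero C0_ne_top
  have hCe : C0 = ENNReal.ofReal C0.toReal := (ENNReal.ofReal_toReal C0_ne_top).symm
  have h1 : ∀ᶠ s in 𝓝[>] (0:ℝ), Rs s < ENNReal.ofReal (1 + ε) * C0 := by
    refine tendsto_Rs.eventually_lt_const ?_
    rw [hCe, ← ENNReal.ofReal_mul (by linarith), ENNReal.ofReal_lt_ofReal_iff (by positivity)]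
    nlinarith
  have h2 : ∀ᶠ s in 𝓝[>] (0:ℝ), ENNReal.ofReal (1 - ε) * C0 < Rs s := by
    refine tendsto_Rs.eventually_const_lt ?_
    rw [hCe, ← ENNReal.ofReal_mul (by linarith), ENNReal.ofReal_lt_ofReal_iff (by positivity)]
    nlinarith
  obtain ⟨s0, hs0, hs⟩ := (mem_nhdsGT_iff_exists_Ioo_subset).1 (h1.and h2)
  have hs0 : 0 < s0 := hs0
  have hba : 0 < b - a := by linarith
  have hb : 0 < b := by linarith
  refine ⟨s0 * (b - a) ^ 2, by positivity, fun δ hδ hδ0 x y hx hy => ?_⟩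
  have hyp : 0 < ‖y‖ := by linarith
  have hy0 : y ≠ 0 := norm_pos_iff.1 hyp
  have hd : b - a ≤ ‖x - y‖ := by
    have := norm_sub_norm_le y x
    rw [norm_sub_rev] at this; linarith
  have hd0 : 0 < ‖x - y‖ := by linarith
  have hxy : x ≠ y := fun h => by rw [h] at hx; linarith
  have hρ : a / b < 1 := by rw [div_lt_one hb]; exact hab
  have hρ0 : 0 < a / b := by positivity
  have hxρ : ‖x‖ ≤ a / b * ‖y‖ := by
    rw [div_mul_eq_mul_div, le_div_iff₀ hb]; nlinarith
  have hdl : (1 - a / b) * ‖y‖ ≤ ‖x - y‖ := by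
    have := norm_sub_norm_le y x
    rw [norm_sub_rev] at this; linarith
  have hdu : ‖x - y‖ ≤ (1 + a / b) * ‖y‖ := by
    have := norm_sub_le x y; linarith
  have hmem : δ / ‖x - y‖ ^ 2 ∈ Ioo 0 s0 := by
    refine ⟨by positivity, ?_⟩
    rw [div_lt_iff₀ (by positivity)]
    refine lt_of_lt_of_le hδ0 ?_
    gcongr
  obtain ⟨r1, r2⟩ := hs hmem
  rw [G_eq_Rs hδ hxy, v_eq' hy0]
  constructor
  · calc ENNReal.ofReal δ⁻¹ * (ENNReal.ofReal ‖x - y‖⁻¹ * Rs (δ / ‖x - y‖ ^ 2))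
        ≤ ENNReal.ofReal δ⁻¹ * (ENNReal.ofReal ((1 - a/b)⁻¹ * ‖y‖⁻¹) * (ENNReal.ofReal (1 + ε) * C0)) := by
          gcongr
          rw [← mul_inv]
          have : 0 < 1 - a / b := by linarith
          gcongr
      _ = _ := by
          rw [ENNReal.ofReal_mul (inv_nonneg.2 (by linarith)), div_eq_mul_inv (1 + ε), ENNReal.ofReal_mul (by linarith)]
          ring
  · calc _ = ENNReal.ofReal δ⁻¹ * (ENNReal.ofReal ((1 + a/b)⁻¹ * ‖y‖⁻¹) * (ENNReal.ofReal (1 - ε) * C0)) := by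
          rw [ENNReal.ofReal_mul (inv_nonneg.2 (by linarith)), div_eq_mul_inv (1 - ε), ENNReal.ofReal_mul (by linarith)]
          ring
      _ ≤ ENNReal.ofReal δ⁻¹ * (ENNReal.ofReal ‖x - y‖⁻¹ * Rs (δ / ‖x - y‖ ^ 2)) := by
          gcongr
          rw [← mul_inv]
          gcongr

/-- inner ball -/
def BA (a : ℝ) : Set X := {x | ‖x‖ < a}
/-- outer region -/
def BB (b : ℝ) : Set X := {x | b < ‖x‖}

lemma isOpen_BA (a : ℝ) : IsOpen (BA a) := isOpen_lt continuous_norm continuous_const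
lemma isOpen_BB (a : ℝ) : IsOpen (BB a) := isOpen_lt continuous_const continuous_norm
lemma disj_BAB {a b : ℝ} (h : a < b) : Disjoint (BA a) (BB b) := by
  rw [Set.disjoint_left]
  intro x (h1 : ‖x‖ < a) (h2 : b < ‖x‖)
  linarith

lemma II_mul (δ : ℝ) (c : ℝ≥0∞) {g : X → ℝ≥0∞} (hg : Measurable g) {A B : Set X} (hA : MeasurableSet A)
    (hB : MeasurableSet B) : II δ (fun y => c * g y) A B = c * II δ g A B := by
  unfold II
  rw [← lintegral_const_mul]
  · refine lintegral_congr fun y => ?_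
    ring
  · exact hg.mul ((measurable_ind hB).mul (measurable_ef δ hA (hA.union hB).compl))

lemma II_ball_upper {δ a b : ℝ} (hδ : 0 < δ) (ha : 0 < a) (hab : a < b) :
    II δ (fun y => ENNReal.ofReal δ⁻¹ * v y) (BA a) (BB b) ≤ ENNReal.ofReal (a / b / (1 - a / b)) := by
  have hC : (0:ℝ) < C0.toReal := ENNReal.toReal_pos C0_ne_zero C0_ne_top
  have hCe : C0 = ENNReal.ofReal C0.toReal := (ENNReal.ofReal_toReal C0_ne_top).symm
  have hb : 0 < b := by linarith
  have hρ : 0 < 1 - a / b := by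
    have : a / b < 1 := by rw [div_lt_one hb]; exact hab
    linarith
  set c := C0.toReal with hc
  rw [II_mul δ _ measurable_v (isOpen_BA a).measurableSet (isOpen_BB b).measurableSet]
  have := II_upper hδ (isOpen_BA a).measurableSet (isOpen_BB b).measurableSet (disj_BAB hab)
    (κ := ENNReal.ofReal (a / ((1 - a / b) * c))) (β := ENNReal.ofReal (a / b / (1 - a / b))) ?_ ?_
  · calc _ ≤ ENNReal.ofReal δ⁻¹ * (ENNReal.ofReal (a / b / (1 - a / b)) * ENNReal.ofReal δ) := by gcongr
      _ = _ := by
        rw [mul_comm, mul_assoc, ← ENNReal.ofReal_mul hδ.le, mul_inv_cancel₀ hδ.ne', ENNReal.ofReal_one, mul_one]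
  · intro x hx
    calc 1 + ENNReal.ofReal (a / b / (1 - a / b)) = ENNReal.ofReal (a / ((1 - a / b) * c)) * (C0 * ENNReal.ofReal a⁻¹) := by
          rw [hCe, ← ENNReal.ofReal_mul hC.le, ← ENNReal.ofReal_mul (by positivity), ← ENNReal.ofReal_one, ← ENNReal.ofReal_add zero_le_one (by positivity)]
          congr 1
          have : b - a ≠ 0 := by linarith
          have h1 : 1 - a / b = (b - a) / b := by field_simp
          rw [h1, eq_comm]
          field_simp
          ring
      _ ≤ _ := by
          gcongr
          exact v_ge ha (le_of_lt hx)
  · intro x hx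
    calc _ ≤ ENNReal.ofReal (a / ((1 - a / b) * c)) * (C0 * ENNReal.ofReal b⁻¹) := by
          gcongr
          exact v_le hb (le_of_lt hx)
      _ = _ := by
          rw [hCe, ← ENNReal.ofReal_mul hC.le, ← ENNReal.ofReal_mul (by positivity)]
          congr 1
          field_simp

/-- upper bounds for the one- and two-crossing sums -/
lemma crossing_upper {a b ε : ℝ} (ha : 0 < a) (hab : a < b) (hε : 0 < ε) (hε1 : ε < 1) :
    ∃ δ0 > 0, ∀ δ, 0 < δ → δ < δ0 →
      (∑' k : ℕ, ∑' m : ℕ, Tr δ (L1 (BA a) (BB b) m k) ≤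
        ENNReal.ofReal ((1 + ε) / (1 - a / b) * (a / b / (1 - a / b)))) ∧
      (∑' k : ℕ, ∑' m₁ : ℕ, ∑' k₁ : ℕ, ∑' m : ℕ, Tr δ (L2 (BA a) (BB b) m₁ k₁ m k) ≤
        ENNReal.ofReal (((1 + ε) / (1 - a / b) * (a / b / (1 - a / b))) ^ 2)) := by
  obtain ⟨δ0, hδ0, h⟩ := G_bounds ha hab hε hε1
  have hb : 0 < b := by linarith
  have hρ : 0 < 1 - a / b := by
    have : a / b < 1 := by rw [div_lt_one hb]; exact hab
    linarith
  refine ⟨δ0, hδ0, fun δ hδ hδ1 => ?_⟩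
  have hg : Measurable (fun y => ENNReal.ofReal δ⁻¹ * v y) := measurable_v.const_mul _
  have hK : ∀ x ∈ BA a, ∀ y ∈ BB b, G δ x y ≤ ENNReal.ofReal ((1 + ε) / (1 - a / b)) * (ENNReal.ofReal δ⁻¹ * v y) :=
    fun x hx y hy => (h δ hδ hδ1 x y hx hy).1
  have e : ENNReal.ofReal ((1 + ε) / (1 - a / b)) * II δ (fun y => ENNReal.ofReal δ⁻¹ * v y) (BA a) (BB b) ≤
      ENNReal.ofReal ((1 + ε) / (1 - a / b) * (a / b / (1 - a / b))) := by
    rw [ENNReal.ofReal_mul (by positivity)]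
    gcongr
    exact II_ball_upper hδ ha hab
  constructor
  · exact (sum_L1_le hδ (isOpen_BA a).measurableSet (isOpen_BB b).measurableSet hg hK).trans e
  · refine (sum_L2_le hδ (isOpen_BA a).measurableSet (isOpen_BB b).measurableSet hg hK).trans ?_
    rw [ENNReal.ofReal_pow (by positivity)]
    gcongr

end LoopAux

namespace LoopAux
open Set Filter Topology
open scoped ENNReal

lemma iter_mono (δ : ℝ) {f g : X → ℝ≥0∞} (h : ∀ x, f x ≤ g x) (n : ℕ) (x : X) :
    (Pp δ)^[n] f x ≤ (Pp δ)^[n] g x := by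
  induction n generalizing x with
  | zero => exact h x
  | succ n ih => rw [Function.iterate_succ_apply', Function.iterate_succ_apply']; exact Pp_mono δ ih x

lemma Nn_mono (δ : ℝ) {f g : X → ℝ≥0∞} (h : ∀ x, f x ≤ g x) (x : X) : Nn δ f x ≤ Nn δ g x :=
  ENNReal.tsum_le_tsum fun n => iter_mono δ h n x

lemma iter_tsum (δ : ℝ) {f : ℕ → X → ℝ≥0∞} (hf : ∀ n, Measurable (f n)) (m : ℕ) (x : X) :
    (Pp δ)^[m] (fun y => ∑' n, f n y) x = ∑' n, (Pp δ)^[m] (f n) x := by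
  induction m generalizing x with
  | zero => rfl
  | succ m ih =>
    rw [Function.iterate_succ_apply', show (Pp δ)^[m] (fun y => ∑' n, f n y) = fun x => ∑' n, (Pp δ)^[m] (f n) x from funext ih,
      Pp_tsum δ fun n => measurable_iter δ (hf n) m]
    simp only [Function.iterate_succ_apply']

lemma iter_Nn_tendsto (δ : ℝ) {f : X → ℝ≥0∞} (hf : Measurable f) {x : X} (h : Nn δ f x ≠ ∞) :
    Tendsto (fun m => (Pp δ)^[m] (Nn δ f) x) atTop (𝓝 0) := by
  have := ENNReal.tendsto_sum_nat_add (fun n => (Pp δ)^[n] f x) h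
  refine this.congr fun m => ?_
  rw [show Nn δ f = fun y => ∑' n, (Pp δ)^[n] f y from rfl, iter_tsum δ (measurable_iter δ hf)]
  refine tsum_congr fun n => ?_
  rw [← Function.iterate_add_apply, add_comm]

lemma iter_v_tendsto {δ : ℝ} (hδ : 0 < δ) {x : X} (hx : x ≠ 0) :
    Tendsto (fun m => (Pp δ)^[m] v x) atTop (𝓝 0) := by
  have hv : v = Nn δ (an δ 0) := by
    ext y
    rw [v_eq_tsum hδ, Nn]
    exact tsum_congr fun n => by rw [an_add hδ]
  rw [hv]
  refine iter_Nn_tendsto δ (measurable_an δ 0) ?_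
  rw [← hv, v_eq' hx]
  exact ENNReal.mul_ne_top C0_ne_top ENNReal.ofReal_ne_top

/-- stopping at the support of a potential -/
lemma stop_lemma (δ : ℝ) {S : Set X} {φ h : X → ℝ≥0∞} (hφ : Measurable φ) 
    (hS : MeasurableSet S) (hh : Measurable h)
    (hφS : ∀ x ∉ S, φ x = 0) (hfin : ∀ x, Nn δ φ x ≠ ∞)
    (hst : ∀ x ∉ S, Pp δ (fun z => ind S z * Nn δ φ z + ind Sᶜ z * h z) x ≤ h x) :
    ∀ x ∉ S, Nn δ φ x ≤ h x := by
  have mN := measurable_Nn δ hφ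
  have m1 := measurable_ind hS
  have m2 := measurable_ind hS.compl
  have key : ∀ m, ∀ x ∉ S, Nn δ φ x ≤ h x + (Pp δ)^[m] (Nn δ φ) x := by
    intro m
    induction m with
    | zero => intro x _; exact le_add_self
    | succ m ih =>
      intro x hx
      rw [Nn_fix δ hφ, hφS x hx, zero_add, Function.iterate_succ_apply']
      refine le_trans ?_ (add_le_add_left (hst x hx) _)
      rw [← Pp_add δ (f := fun z => ind S z * Nn δ φ z + ind Sᶜ z * h z) (by fun_prop)]
      refine Pp_mono δ (fun z => ?_) x
      by_cases hz : z ∈ S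
      · rw [ind_mem hz, one_mul, add_assoc]
        exact le_self_add
      · rw [ind_not hz, ind_mem (show z ∈ Sᶜ from hz), zero_mul, zero_add, one_mul]
        exact ih z hz
  intro x hx
  have := (iter_Nn_tendsto δ hφ (hfin x)).const_add (h x)
  rw [add_zero] at this
  exact ge_of_tendsto' this fun m => key m x hx

/-- truncated potential -/
noncomputable def Uc (c : ℝ≥0∞) (x : X) : ℝ≥0∞ := min (v x) c

lemma measurable_Uc (c : ℝ≥0∞) : Measurable (Uc c) := measurable_v.min measurable_const

lemma Pp_Uc_le {δ : ℝ} (hδ : 0 < δ) (c : ℝ≥0∞) (x : X) : Pp δ (Uc c) x ≤ Uc c x := by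
  refine le_min ?_ ?_
  · refine (Pp_mono δ (fun z => min_le_left _ _) x).trans ?_
    rw [Pp_v hδ x]; exact le_add_self
  · exact (Pp_mono δ (fun z => min_le_right _ _) x).trans (Pp_const hδ c x).le

/-- charge of the truncated potential -/
noncomputable def ps (δ : ℝ) (c : ℝ≥0∞) (x : X) : ℝ≥0∞ := Uc c x - Pp δ (Uc c) x

lemma measurable_ps (δ : ℝ) (c : ℝ≥0∞) : Measurable (ps δ c) :=
  (measurable_Uc c).sub (measurable_Pp δ (measurable_Uc c))

lemma ps_add {δ : ℝ} (hδ : 0 < δ) (c : ℝ≥0∞) (x : X) : ps δ c x + Pp δ (Uc c) x = Uc c x :=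
  tsub_add_cancel_of_le (Pp_Uc_le hδ c x)

lemma iter_add (δ : ℝ) {f g : X → ℝ≥0∞} (hf : Measurable f) (n : ℕ) (x : X) :
    (Pp δ)^[n] (fun y => f y + g y) x = (Pp δ)^[n] f x + (Pp δ)^[n] g x := by
  induction n generalizing x with
  | zero => rfl
  | succ n ih =>
    rw [Function.iterate_succ_apply', show (Pp δ)^[n] (fun y => f y + g y) = fun x => (Pp δ)^[n] f x + (Pp δ)^[n] g x from funext ih,
      Pp_add δ (measurable_iter δ hf n), Function.iterate_succ_apply', Function.iterate_succ_apply']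

lemma ps_telescope {δ : ℝ} (hδ : 0 < δ) (c : ℝ≥0∞) (m : ℕ) (x : X) :
    ∑ n ∈ Finset.range m, (Pp δ)^[n] (ps δ c) x + (Pp δ)^[m] (Uc c) x = Uc c x := by
  induction m with
  | zero => simp
  | succ m ih =>
    rw [Finset.sum_range_succ, add_assoc, Function.iterate_succ_apply, ← iter_add δ (measurable_ps δ c)]
    rw [show (fun y => ps δ c y + Pp δ (Uc c) y) = Uc c from funext (ps_add hδ c)]
    exact ih

lemma Nn_ps_le {δ : ℝ} (hδ : 0 < δ) (c : ℝ≥0∞) (x : X) : Nn δ (ps δ c) x ≤ Uc c x :=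
  ENNReal.tsum_le_of_sum_range_le fun m => by
    rw [← ps_telescope hδ c m x]; exact le_self_add

lemma Nn_ps_eq {δ : ℝ} (hδ : 0 < δ) (c : ℝ≥0∞) {x : X} (hx : x ≠ 0) : Nn δ (ps δ c) x = Uc c x := by
  refine le_antisymm (Nn_ps_le hδ c x) ?_
  have h0 : Tendsto (fun m => (Pp δ)^[m] (Uc c) x) atTop (𝓝 0) :=
    tendsto_of_tendsto_of_tendsto_of_le_of_le tendsto_const_nhds (iter_v_tendsto hδ hx) (fun _ => zero_le)
      (fun m => iter_mono δ (fun z => min_le_left _ _) m x)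
  have h1 := h0.const_add (Nn δ (ps δ c) x)
  rw [add_zero] at h1
  refine ge_of_tendsto' h1 fun m => ?_
  rw [← ps_telescope hδ c m x]
  gcongr
  exact ENNReal.sum_le_tsum _

/-- off `A`, a potential of charges in `A` is controlled by the crossing function -/
lemma pot_le_M {δ : ℝ} {A B : Set X} (hA : MeasurableSet A) (hB : MeasurableSet B) (hAB : Disjoint A B)
    {φ : X → ℝ≥0∞} (hφ : Measurable φ) (hφA : ∀ x ∉ A, φ x = 0) {c : ℝ≥0∞} (hc : c ≠ ∞) (hle : ∀ x, Nn δ φ x ≤ c) :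
    ∀ x ∈ B, Nn δ φ x ≤ c * Nn δ (fun y => ind B y * ef δ A (A ∪ B)ᶜ y) x := by
  have hD : MeasurableSet (A ∪ B)ᶜ := (hA.union hB).compl
  set D := (A ∪ B)ᶜ with hDdef
  have mef := measurable_ef δ hA hD
  have mB := measurable_ind hB
  have mA := measurable_ind hA
  have mD := measurable_ind hD
  have mAc := measurable_ind hA.compl
  have mf : Measurable (fun y => ind B y * ef δ A D y) := by fun_prop
  set N := Nn δ (fun y => ind B y * ef δ A D y) with hN
  have mN : Measurable N := measurable_Nn δ mf
  have mPN := measurable_Pp δ mN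
  have fixN : ∀ x, N x = ind B x * ef δ A D x + Pp δ N x := Nn_fix δ mf
  have hM : ∀ x, Pp δ (fun z => ind A z + ind Aᶜ z * (ef δ A D z + Pp δ N z)) x ≤ ef δ A D x + Pp δ N x := by
    intro x
    rw [ef_fix hA hD, ← Pp_add δ (f := fun z => ind A z + ind D z * ef δ A D z) (by fun_prop)]
    refine Pp_mono δ (fun z => ?_) x
    by_cases hzA : z ∈ A
    · rw [ind_mem hzA, ind_not (show z ∉ Aᶜ from fun h => h hzA), zero_mul, add_zero, add_assoc]
      exact le_self_add
    · by_cases hzB : z ∈ B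
      · have : z ∉ D := fun h => h (Or.inr hzB)
        rw [ind_not hzA, ind_mem (show z ∈ Aᶜ from hzA), ind_not this, fixN z, ind_mem hzB]
        simp
      · have : z ∈ D := fun h => h.elim hzA hzB
        rw [ind_not hzA, ind_mem (show z ∈ Aᶜ from hzA), ind_mem this, fixN z, ind_not hzB]
        simp
  have := stop_lemma δ (S := A) (φ := φ) (h := fun z => c * (ef δ A D z + Pp δ N z)) hφ hA (by fun_prop) hφA
    (fun x => ne_top_of_le_ne_top hc (hle x)) ?_
  · intro x hx
    have hxA : x ∉ A := fun h => Set.disjoint_left.1 hAB h hx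
    refine (this x hxA).trans ?_
    rw [fixN x, ind_mem hx, one_mul]
  · intro x hx
    refine le_trans ?_ (mul_le_mul_right (hM x) c)
    rw [← Pp_const_mul δ c (by fun_prop)]
    refine Pp_mono δ (fun z => ?_) x
    rw [show c * (ind A z + ind Aᶜ z * (ef δ A D z + Pp δ N z)) =
      ind A z * c + ind Aᶜ z * (c * (ef δ A D z + Pp δ N z)) by ring]
    gcongr
    exact hle z

lemma pot_le_N (δ : ℝ) {B : Set X} (hB : MeasurableSet B)
    {χ f : X → ℝ≥0∞} (hχ : Measurable χ) (hχB : ∀ x ∉ B, χ x = 0) (hfin : ∀ x, Nn δ χ x ≠ ∞)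
    (hf : Measurable f) {K : ℝ≥0∞} (hle : ∀ x ∈ B, Nn δ χ x ≤ K * Nn δ f x) (x : X) :
    Nn δ χ x ≤ K * Nn δ f x := by
  by_cases hx : x ∈ B
  · exact hle x hx
  have mN := measurable_Nn δ hf
  refine stop_lemma δ (S := B) (h := fun z => K * Nn δ f z) hχ hB (by fun_prop) hχB hfin ?_ x hx
  intro y hy
  calc _ ≤ Pp δ (fun z => K * Nn δ f z) y := by
        refine Pp_mono δ (fun z => ?_) y
        by_cases hz : z ∈ B
        · rw [ind_mem hz, ind_not (show z ∉ Bᶜ from fun h => h hz), one_mul, zero_mul, add_zero]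
          exact hle z hz
        · rw [ind_not hz, ind_mem (show z ∈ Bᶜ from hz), one_mul, zero_mul, zero_add]
    _ = K * Pp δ (Nn δ f) y := Pp_const_mul δ K mN y
    _ ≤ K * Nn δ f y := by
        gcongr
        rw [Nn_fix δ hf y]; exact le_add_self

/-- the Green operator applied to a charge is bounded below through `G` -/
lemma iter_eq {δ : ℝ} (hδ : 0 < δ) {φ : X → ℝ≥0∞} (hφ : Measurable φ) (n : ℕ) (x : X) :
    (Pp δ)^[n+1] φ x = ∫⁻ y, pk ((n + 1 : ℕ) * δ) x y * φ y := by
  induction n generalizing x with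
  | zero => simp [Pp]
  | succ n ih =>
    rw [Function.iterate_succ_apply', Pp]
    simp_rw [ih]
    have e1 : ∀ z, pk δ x z * ∫⁻ y, pk ((n + 1 : ℕ) * δ) z y * φ y = ∫⁻ y, pk δ x z * (pk ((n + 1 : ℕ) * δ) z y * φ y) :=
      fun z => by rw [lintegral_const_mul _ (by fun_prop)]
    simp_rw [e1]
    rw [lintegral_lintegral_swap (by fun_prop)]
    refine lintegral_congr fun y => ?_
    simp_rw [← mul_assoc]
    rw [lintegral_mul_const _ (by fun_prop), pk_comp hδ (by positivity)]
    congr 2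
    push_cast; ring

lemma Nn_ge_G {δ : ℝ} (hδ : 0 < δ) {φ : X → ℝ≥0∞} (hφ : Measurable φ) (x : X) :
    ∫⁻ y, G δ x y * φ y ≤ Nn δ φ x := by
  unfold G Nn
  simp_rw [← ENNReal.tsum_mul_right]
  rw [lintegral_tsum (fun n => by fun_prop), tsum_zero_add (fun n => (Pp δ)^[n] φ x)]
  refine le_trans (le_of_eq ?_) le_add_self
  exact tsum_congr fun n => (iter_eq hδ hφ n x).symm

end LoopAux

namespace LoopAux
open Set Filter Topology
open scoped ENNReal

/-- truncation level for a given radius -/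
noncomputable def cr (ρ : ℝ) : ℝ≥0∞ := C0 * ENNReal.ofReal ρ⁻¹

lemma cr_ne_top (ρ : ℝ) : cr ρ ≠ ∞ := ENNReal.mul_ne_top C0_ne_top ENNReal.ofReal_ne_top

lemma Uc_eq_v {ρ : ℝ} (hρ : 0 < ρ) {x : X} (h : ρ ≤ ‖x‖) : Uc (cr ρ) x = v x := min_eq_left (v_le hρ h)
lemma Uc_eq_c {ρ : ℝ} (hρ : 0 < ρ) {x : X} (h : ‖x‖ ≤ ρ) : Uc (cr ρ) x = cr ρ := min_eq_right (v_ge hρ h)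

/-- local mass of the potential -/
noncomputable def Vl (ρ : ℝ) : ℝ≥0∞ := ∫⁻ x in Metric.closedBall (0:X) ρ, v x

lemma Vl_ne_top (ρ : ℝ) : Vl ρ ≠ ∞ := by
  unfold Vl v
  rw [lintegral_lintegral_swap (by fun_prop)]
  have h1 : Ioi (0:ℝ) = Ioc 0 1 ∪ Ioi 1 := (Ioc_union_Ioi_eq_Ioi zero_le_one).symm
  rw [h1]
  refine ne_top_of_le_ne_top ?_ (lintegral_union_le _ _ _)
  refine ENNReal.add_ne_top.2 ⟨?_, ?_⟩
  · have : ∫⁻ s in Ioc (0:ℝ) 1, ∫⁻ x in Metric.closedBall (0:X) ρ, pk s 0 x ≤ ∫⁻ s in Ioc (0:ℝ) 1, 1 := by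
      refine setLIntegral_mono' measurableSet_Ioc fun s hs => ?_
      rw [← lintegral_pk hs.1 0]
      exact setLIntegral_le_lintegral _ _
    refine ne_top_of_le_ne_top ?_ this
    simp
  · have : ∫⁻ s in Ioi (1:ℝ), ∫⁻ x in Metric.closedBall (0:X) ρ, pk s 0 x ≤
        ∫⁻ s in Ioi (1:ℝ), ENNReal.ofReal (s ^ (-(3:ℝ)/2)) * volume (Metric.closedBall (0:X) ρ) := by
      refine setLIntegral_mono' measurableSet_Ioi fun s hs => ?_
      have hs0 : (0:ℝ) < s := zero_lt_one.trans hs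
      refine (lintegral_mono fun x => (pk_eq_fk s 0 x).le.trans (fk_le_rpow hs0 _)).trans ?_
      rw [setLIntegral_const]
    refine ne_top_of_le_ne_top ?_ this
    rw [lintegral_mul_const _ (by fun_prop)]
    refine ENNReal.mul_ne_top ?_ (measure_closedBall_lt_top).ne
    exact (integrableOn_Ioi_rpow_of_lt (show (-(3:ℝ)/2) < -1 by norm_num) zero_lt_one).lintegral_lt_top.ne

lemma ind_split (S : Set X) (x : X) (a : ℝ≥0∞) : ind S x * a + ind Sᶜ x * a = a := by
  by_cases h : x ∈ S
  · simp [ind_mem h, ind_not (show x ∉ Sᶜ from fun k => k h)]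
  · simp [ind_not h, ind_mem (show x ∈ Sᶜ from h)]

lemma lintegral_split {S : Set X} (hS : MeasurableSet S) {f : X → ℝ≥0∞} (hf : Measurable f) :
    ∫⁻ x, f x = (∫⁻ x, ind S x * f x) + (∫⁻ x, ind Sᶜ x * f x) := by
  have := measurable_ind hS
  rw [← lintegral_add_left (by fun_prop)]
  exact lintegral_congr fun x => (ind_split S x _).symm

lemma ind_le_one (S : Set X) (x : X) : ind S x ≤ 1 := by
  unfold ind; split_ifs <;> simp

/-- mass of the slice `an` outside a ball -/
lemma an_tail {δ r : ℝ} (hδ : 0 < δ) (hr : 0 < r) :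
    (∫⁻ x, ind (BA r)ᶜ x * an δ 0 x) ≤ tl r δ * ENNReal.ofReal δ := by
  have m := measurable_ind (isOpen_BA r).measurableSet.compl
  unfold an
  have e : ∀ x, ind (BA r)ᶜ x * ∫⁻ s in Ioc 0 δ, pk ((0:ℕ) * δ + s) 0 x = ∫⁻ s in Ioc 0 δ, ind (BA r)ᶜ x * pk ((0:ℕ) * δ + s) 0 x :=
    fun x => by rw [lintegral_const_mul _ (by fun_prop)]
  simp_rw [e]
  rw [lintegral_lintegral_swap (by fun_prop)]
  have : ∀ s ∈ Ioc 0 δ, ∫⁻ x, ind (BA r)ᶜ x * pk ((0:ℕ) * δ + s) 0 x ≤ tl r δ := by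
    intro s hs
    calc _ ≤ ∫⁻ x, tl r δ * pk (2 * s) 0 x := by
          refine lintegral_mono fun x => ?_
          by_cases hx : x ∈ BA r
          · simp [ind_not (show x ∉ (BA r)ᶜ from fun k => k hx)]
          · rw [ind_mem (show x ∈ (BA r)ᶜ from hx), one_mul]
            simp only [CharP.cast_eq_zero, zero_mul, zero_add]
            refine pk_tail hs.1 hs.2 hr.le ?_
            rw [zero_sub, norm_neg]
            exact not_lt.1 hx
      _ = _ := by
          rw [lintegral_const_mul _ (by fun_prop), lintegral_pk (by linarith [hs.1]), mul_one]
  calc _ ≤ ∫⁻ s in Ioc 0 δ, tl r δ := setLIntegral_mono' measurableSet_Ioc this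
    _ = _ := by rw [setLIntegral_const, Real.volume_Ioc, sub_zero]

lemma lintegral_Pp {δ : ℝ} (hδ : 0 < δ) {f : X → ℝ≥0∞} (hf : Measurable f) : ∫⁻ x, Pp δ f x = ∫⁻ x, f x := by
  have := Pp_adj δ hf (g := fun _ => 1) measurable_const
  simpa [Pp_const hδ] using this

/-- mass of the charge -/
lemma mass_ps {δ ρ r : ℝ} (hδ : 0 < δ) (hρ : 0 < ρ) (hr : ρ < r) :
    ENNReal.ofReal δ ≤ (∫⁻ x, ind (BA r) x * ps δ (cr ρ) x) + tl (r - ρ) δ * Vl ρ + tl r δ * ENNReal.ofReal δ := by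
  have hA := (isOpen_BA r).measurableSet
  have mA := measurable_ind hA
  have mAc := measurable_ind hA.compl
  set c := cr ρ with hc
  set Z : X → ℝ≥0∞ := fun x => v x - Uc c x with hZ
  have mZ : Measurable Z := measurable_v.sub (measurable_Uc c)
  have mU := measurable_Uc c
  have mps := measurable_ps δ c
  have man := measurable_an δ 0
  have mPZ := measurable_Pp δ mZ
  have hvZ : ∀ x, v x = Uc c x + Z x := fun x => (add_tsub_cancel_of_le (min_le_left _ _)).symm
  have Z0 : ∀ x, ρ ≤ ‖x‖ → Z x = 0 := fun x hx => by
    simp only [hZ]; rw [hc, Uc_eq_v hρ hx, tsub_self]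
  have id1 : ∀ x, ps δ c x + Z x = an δ 0 x + Pp δ Z x := by
    intro x
    have h1 := hvZ x
    have h2 := Pp_v hδ x
    have h3 : Pp δ v x = Pp δ (Uc c) x + Pp δ Z x := by
      rw [show v = fun y => Uc c y + Z y from funext hvZ, Pp_add δ mU]
    have hfin : Pp δ (Uc c) x ≠ ∞ := ne_top_of_le_ne_top (cr_ne_top ρ) ((Pp_Uc_le hδ c x).trans (min_le_right _ _))
    have h4 := ps_add hδ c x
    have : Pp δ (Uc c) x + (ps δ c x + Z x) = Pp δ (Uc c) x + (an δ 0 x + Pp δ Z x) := by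
      rw [← add_assoc, add_comm (Pp δ (Uc c) x), h4, ← h1, h2, h3]; ring
    exact (ENNReal.add_right_inj hfin).1 this
  have hZV : (∫⁻ x, Z x) ≤ Vl ρ := by
    rw [Vl, ← lintegral_indicator Metric.isClosed_closedBall.measurableSet]
    refine lintegral_mono fun x => ?_
    by_cases hx : x ∈ Metric.closedBall (0:X) ρ
    · rw [indicator_of_mem hx]; exact tsub_le_self
    · rw [Z0 x (by simp at hx; exact hx.le)]; exact zero_le
  have hZfin : (∫⁻ x, Z x) ≠ ∞ := ne_top_of_le_ne_top (Vl_ne_top ρ) hZV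
  have tail : (∫⁻ x, ind (BA r)ᶜ x * Pp δ Z x) ≤ tl (r - ρ) δ * (∫⁻ x, Z x) := by
    rw [← lintegral_Pp (δ := 2 * δ) (by linarith) mZ, ← lintegral_const_mul _ (measurable_Pp _ mZ)]
    refine lintegral_mono fun x => ?_
    by_cases hx : x ∈ BA r
    · simp [ind_not (show x ∉ (BA r)ᶜ from fun k => k hx)]
    · rw [ind_mem (show x ∈ (BA r)ᶜ from hx), one_mul, Pp, Pp, ← lintegral_const_mul _ (by fun_prop)]
      refine lintegral_mono fun y => ?_
      by_cases hy : ρ ≤ ‖y‖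
      · simp [Z0 y hy]
      · rw [← mul_assoc]
        gcongr
        refine pk_tail hδ le_rfl (by linarith) ?_
        have h1 : r ≤ ‖x‖ := not_lt.1 hx
        have := norm_sub_norm_le x y
        push Not at hy
        linarith
  have i1 : (∫⁻ x, ind (BA r) x * ps δ c x) + (∫⁻ x, ind (BA r) x * Z x) =
      (∫⁻ x, ind (BA r) x * an δ 0 x) + (∫⁻ x, ind (BA r) x * Pp δ Z x) := by
    rw [← lintegral_add_left (by fun_prop), ← lintegral_add_left (by fun_prop)]
    refine lintegral_congr fun x => ?_
    rw [← mul_add, ← mul_add, id1]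
  have i2 : ENNReal.ofReal δ + (∫⁻ x, Z x) = ((∫⁻ x, ind (BA r) x * ps δ c x) + (∫⁻ x, ind (BA r) x * Z x)) +
      ((∫⁻ x, ind (BA r)ᶜ x * Pp δ Z x) + (∫⁻ x, ind (BA r)ᶜ x * an δ 0 x)) := by
    rw [i1, ← lintegral_an hδ, ← lintegral_Pp hδ mZ, lintegral_split hA man, lintegral_split hA mPZ]
    ring
  have i3 : (∫⁻ x, ind (BA r) x * Z x) ≤ (∫⁻ x, Z x) := lintegral_mono fun x => by
    calc _ ≤ 1 * Z x := by gcongr; exact ind_le_one _ _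
      _ = _ := one_mul _
  have i4 : ENNReal.ofReal δ + (∫⁻ x, Z x) ≤ ((∫⁻ x, ind (BA r) x * ps δ c x) + tl (r - ρ) δ * Vl ρ + tl r δ * ENNReal.ofReal δ) + (∫⁻ x, Z x) := by
    rw [i2]
    calc _ ≤ ((∫⁻ x, ind (BA r) x * ps δ c x) + (∫⁻ x, Z x)) + (tl (r - ρ) δ * Vl ρ + tl r δ * ENNReal.ofReal δ) := by
          refine add_le_add (add_le_add le_rfl i3) (add_le_add (tail.trans ?_) (an_tail hδ (by linarith)))
          gcongr
      _ = _ := by ring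
  exact (ENNReal.add_le_add_iff_right hZfin).1 i4

/-- outer charge, pairing with the slice -/
lemma outer_pair {δ R : ℝ} (hδ : 0 < δ) (hR : 1 < R) :
    cr R * ENNReal.ofReal δ ≤ (∫⁻ x, an δ 0 x * Nn δ (fun y => ind (BB 1) y * ps δ (cr R) y) x)
      + cr R * (tl R δ * ENNReal.ofReal δ) + tl (R - 1) δ * cr R * Vl 1 := by
  have hR0 : 0 < R := by linarith
  set c := cr R with hc
  have hB := (isOpen_BB 1).measurableSet
  have hAR := (isOpen_BA R).measurableSet
  have mU := measurable_Uc c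
  have mps := measurable_ps δ c
  have man := measurable_an δ 0
  have mB := measurable_ind hB
  have mBc := measurable_ind hB.compl
  have mARc := measurable_ind hAR.compl
  -- step 1
  have s1 : c * ENNReal.ofReal δ ≤ (∫⁻ x, an δ 0 x * Uc c x) + c * (tl R δ * ENNReal.ofReal δ) := by
    rw [← lintegral_an hδ, ← lintegral_const_mul _ man, lintegral_an hδ]
    refine le_trans ?_ (add_le_add le_rfl (mul_le_mul_right (an_tail hδ hR0) c))
    rw [← lintegral_const_mul _ (by fun_prop), ← lintegral_add_left (by fun_prop)]
    refine lintegral_mono fun x => ?_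
    by_cases hx : x ∈ BA R
    · rw [hc, Uc_eq_c hR0 (le_of_lt hx), mul_comm]; exact le_self_add
    · rw [ind_mem (show x ∈ (BA R)ᶜ from hx), one_mul]; exact le_add_self
  -- step 2
  have s2 : (∫⁻ x, an δ 0 x * Uc c x) = ∫⁻ x, v x * ps δ c x := by
    rw [v_pair hδ mps]
    refine lintegral_congr_ae ?_
    have : ∀ᵐ x : X, x ≠ 0 := by
      rw [ae_iff]; simp
    filter_upwards [this] with x hx
    rw [Nn_ps_eq hδ c hx]
  have s3 : ∫⁻ x, v x * ps δ c x = (∫⁻ x, v x * (ind (BB 1) x * ps δ c x)) + (∫⁻ x, ind (BB 1)ᶜ x * (v x * ps δ c x)) := by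
    have mv := measurable_v
    rw [lintegral_split hB (by fun_prop)]
    congr 1
    refine lintegral_congr fun x => ?_
    ring
  have s4 : ∀ x ∉ BB 1, ps δ c x ≤ tl (R - 1) δ * c := by
    intro x hx
    have hx1 : ‖x‖ ≤ 1 := not_lt.1 hx
    have h1 : c ≤ Pp δ (Uc c) x + tl (R - 1) δ * c := by
      calc c = Pp δ (fun _ => c) x := (Pp_const hδ c x).symm
        _ ≤ ∫⁻ y, (pk δ x y * Uc c y + tl (R - 1) δ * c * pk (2 * δ) x y) := by
            refine lintegral_mono fun y => ?_
            by_cases hy : ‖y‖ ≤ R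
            · rw [hc, Uc_eq_c hR0 hy]; exact le_self_add
            · refine le_trans ?_ le_add_self
              rw [mul_assoc, mul_comm c, ← mul_assoc]
              gcongr
              refine pk_tail hδ le_rfl (by linarith) ?_
              have := norm_sub_norm_le y x
              rw [norm_sub_rev] at this
              push Not at hy
              linarith
        _ = _ := by
            rw [lintegral_add_left (by fun_prop), lintegral_const_mul _ (by fun_prop), lintegral_pk (by linarith), mul_one]
            rfl
    unfold ps
    rw [hc, Uc_eq_c hR0 (by linarith), tsub_le_iff_left]
    exact h1
  have s5 : (∫⁻ x, ind (BB 1)ᶜ x * (v x * ps δ c x)) ≤ tl (R - 1) δ * c * Vl 1 := by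
    rw [Vl, ← lintegral_indicator Metric.isClosed_closedBall.measurableSet, ← lintegral_const_mul _ (measurable_v.indicator Metric.isClosed_closedBall.measurableSet)]
    refine lintegral_mono fun x => ?_
    by_cases hx : x ∈ BB 1
    · simp [ind_not (show x ∉ (BB 1)ᶜ from fun k => k hx)]
    · have hx' : x ∈ Metric.closedBall (0:X) 1 := by
        simp; exact not_lt.1 hx
      rw [ind_mem (show x ∈ (BB 1)ᶜ from hx), indicator_of_mem hx', one_mul, mul_comm]
      gcongr
      exact s4 x hx
  calc c * ENNReal.ofReal δ ≤ _ := s1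
    _ ≤ ((∫⁻ x, v x * (ind (BB 1) x * ps δ c x)) + tl (R - 1) δ * c * Vl 1) + c * (tl R δ * ENNReal.ofReal δ) := by
        rw [s2, s3]; gcongr
    _ = _ := by
        rw [v_pair hδ (by fun_prop)]; ring

end LoopAux

namespace LoopAux
open Set Filter Topology
open scoped ENNReal

lemma tl_small {η ε : ℝ} (hη : 0 < η) (hε : 0 < ε) {M : ℝ≥0∞} (hM : M ≠ ∞) :
    ∃ δ0 > 0, ∀ δ, 0 < δ → δ < δ0 → tl η δ * M ≤ ENNReal.ofReal (ε * δ) := by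
  set K : ℝ := (2:ℝ) ^ ((3:ℝ)/2) * (32 / η ^ 4) with hK
  have hK0 : 0 < K := by positivity
  set N := M.toReal with hN
  have hN0 : 0 ≤ N := ENNReal.toReal_nonneg
  refine ⟨ε / (K * N + 1), by positivity, fun δ hδ h => ?_⟩
  rw [← ENNReal.ofReal_toReal hM, tl, ← ENNReal.ofReal_mul (by positivity)]
  refine ENNReal.ofReal_le_ofReal ?_
  have h1 : Real.exp (-η ^ 2 / (4 * δ)) ≤ 32 / η ^ 4 * δ ^ 2 := by
    have hx : 0 ≤ η ^ 2 / (4 * δ) := by positivity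
    have h2 := Real.quadratic_le_exp_of_nonneg hx
    have h3 : (η ^ 2 / (4 * δ)) ^ 2 / 2 ≤ Real.exp (η ^ 2 / (4 * δ)) := by linarith
    rw [neg_div, Real.exp_neg]
    have h4 : 32 / η ^ 4 * δ ^ 2 = ((η ^ 2 / (4 * δ)) ^ 2 / 2)⁻¹ := by field_simp; ring
    rw [h4]
    exact inv_anti₀ (by positivity) h3
  have h5 : δ * (K * N + 1) < ε := (lt_div_iff₀ (by positivity)).1 h
  calc (2:ℝ) ^ ((3:ℝ)/2) * Real.exp (-η ^ 2 / (4 * δ)) * M.toReal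
      ≤ (2:ℝ) ^ ((3:ℝ)/2) * (32 / η ^ 4 * δ ^ 2) * N := by gcongr
    _ = (δ * (K * N)) * δ := by rw [hK]; ring
    _ ≤ ε * δ := by gcongr; nlinarith

lemma mass_lower {ρ r ε : ℝ} (hρ : 0 < ρ) (hr : ρ < r) (hε : 0 < ε) :
    ∃ δ0 > 0, ∀ δ, 0 < δ → δ < δ0 →
      ENNReal.ofReal ((1 - ε) * δ) ≤ ∫⁻ x, ind (BA r) x * ps δ (cr ρ) x := by
  obtain ⟨d1, h1, H1⟩ := tl_small (η := r - ρ) (ε := ε / 2) (by linarith) (by linarith) (Vl_ne_top ρ)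
  obtain ⟨d2, h2, H2⟩ := tl_small (η := r) (ε := ε / 2) (by linarith) (by linarith) (M := 1) (by simp)
  refine ⟨min (min d1 d2) 1, by positivity, fun δ hδ h => ?_⟩
  simp only [lt_min_iff] at h
  have a1 := H1 δ hδ h.1.1
  have a2 := H2 δ hδ h.1.2
  have a3 : tl r δ * ENNReal.ofReal δ ≤ ENNReal.ofReal (ε / 2 * δ) := by
    refine le_trans ?_ a2
    gcongr
    exact ENNReal.ofReal_le_one.2 h.2.le
  have h3 := mass_ps hδ hρ hr
  have h4 : ENNReal.ofReal δ ≤ (∫⁻ x, ind (BA r) x * ps δ (cr ρ) x) + ENNReal.ofReal (ε * δ) := by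
    refine h3.trans ?_
    rw [add_assoc]
    gcongr
    refine (add_le_add a1 a3).trans ?_
    rw [← ENNReal.ofReal_add (by positivity) (by positivity)]
    exact (congrArg ENNReal.ofReal (by ring)).le
  rw [← tsub_le_iff_right, ← ENNReal.ofReal_sub _ (by positivity)] at h4
  convert h4 using 2
  ring

lemma outer_lower {R ε : ℝ} (hR : 1 < R) (hε : 0 < ε) :
    ∃ δ0 > 0, ∀ δ, 0 < δ → δ < δ0 →
      cr R * ENNReal.ofReal ((1 - ε) * δ) ≤
        ∫⁻ x, an δ 0 x * Nn δ (fun y => ind (BB 1) y * ps δ (cr R) y) x := by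
  obtain ⟨d1, h1, H1⟩ := tl_small (η := R - 1) (ε := ε / 2) (by linarith) (by linarith) (Vl_ne_top 1)
  obtain ⟨d2, h2, H2⟩ := tl_small (η := R) (ε := ε / 2) (by linarith) (by linarith) (M := 1) (by simp)
  refine ⟨min (min d1 d2) 1, by positivity, fun δ hδ h => ?_⟩
  simp only [lt_min_iff] at h
  have a1 := H1 δ hδ h.1.1
  have a2 := H2 δ hδ h.1.2
  have a3 : tl R δ * ENNReal.ofReal δ ≤ ENNReal.ofReal (ε / 2 * δ) := by
    refine le_trans ?_ a2
    gcongr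
    exact ENNReal.ofReal_le_one.2 h.2.le
  have h3 := outer_pair hδ hR
  have h4 : cr R * ENNReal.ofReal δ ≤
      (∫⁻ x, an δ 0 x * Nn δ (fun y => ind (BB 1) y * ps δ (cr R) y) x) + cr R * ENNReal.ofReal (ε * δ) := by
    refine h3.trans ?_
    rw [add_assoc]
    gcongr
    have : ENNReal.ofReal (ε * δ) = ENNReal.ofReal (ε / 2 * δ) + ENNReal.ofReal (ε / 2 * δ) := by
      rw [← ENNReal.ofReal_add (by positivity) (by positivity)]
      exact (congrArg ENNReal.ofReal (by ring))
    rw [this, mul_add, mul_comm (tl (R-1) δ), mul_assoc]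
    gcongr
  rw [← tsub_le_iff_right, ← ENNReal.mul_sub (fun _ _ => cr_ne_top R), ← ENNReal.ofReal_sub _ (by positivity)] at h4
  convert h4 using 3
  ring

lemma G_symm (δ : ℝ) (x y : X) : G δ x y = G δ y x := by
  unfold G; exact tsum_congr fun m => pk_symm _ _ _

lemma crossing_lower {r ε : ℝ} (hr : 0 < r) (hr1 : r < 1) (hε : 0 < ε) (hε1 : ε < 1) :
    ∃ δ0 > 0, ∀ δ, 0 < δ → δ < δ0 →
      ENNReal.ofReal ((1 - ε) ^ 4 * (r * (1 - r)) / (1 + r) ^ 3) ≤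
        ∑' k, ∑' m, Tr δ (L1 (BA r) (BB 1) m k) := by
  set ρ := r * (1 - r) with hρ
  have hρ0 : 0 < ρ := mul_pos hr (by linarith)
  have hρr : ρ < r := by nlinarith
  clear_value ρ
  obtain ⟨d1, h1, H1⟩ := mass_lower hρ0 hρr hε
  obtain ⟨d2, h2, H2⟩ := outer_lower (R := 1 + r) (by linarith) hε
  obtain ⟨d3, h3, H3⟩ := G_bounds hr hr1 hε hε1
  refine ⟨min (min d1 d2) d3, by positivity, fun δ hδ h => ?_⟩
  simp only [lt_min_iff] at h
  have m1 := H1 δ hδ h.1.1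
  have o1 := H2 δ hδ h.1.2
  have g1 := H3 δ hδ h.2
  have e1 : 0 < 1 - ε := by linarith
  have e2 : 0 < 1 + r := by linarith
  have hA := (isOpen_BA r).measurableSet
  have hB := (isOpen_BB 1).measurableSet
  have hAB := disj_BAB hr1
  have mA := measurable_ind hA
  have mB := measurable_ind hB
  have mp1 := measurable_ps δ (cr ρ)
  have mp2 := measurable_ps δ (cr (1 + r))
  set φ : X → ℝ≥0∞ := fun x => ind (BA r) x * ps δ (cr ρ) x with hφ
  set χ : X → ℝ≥0∞ := fun x => ind (BB 1) x * ps δ (cr (1 + r)) x with hχ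
  have mφ : Measurable φ := by fun_prop
  have mχ : Measurable χ := by fun_prop
  set f : X → ℝ≥0∞ := fun y => ind (BB 1) y * ef δ (BA r) (BA r ∪ BB 1)ᶜ y with hf
  have mef := measurable_ef δ hA (hA.union hB).compl
  have mf : Measurable f := by fun_prop
  have φle : ∀ x, Nn δ φ x ≤ cr ρ := fun x =>
    (Nn_mono δ (fun y => mul_le_of_le_one_left' (ind_le_one _ y)) x).trans
      ((Nn_ps_le hδ _ x).trans (min_le_right _ _))
  have χle : ∀ x, Nn δ χ x ≤ Uc (cr (1 + r)) x := fun x =>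
    (Nn_mono δ (fun y => mul_le_of_le_one_left' (ind_le_one _ y)) x).trans (Nn_ps_le hδ _ x)
  have hM := pot_le_M (δ := δ) hA hB hAB mφ (fun x hx => by simp [hφ, ind_not hx]) (cr_ne_top ρ) φle
  have hvφ : ∀ x ∈ BB 1, ENNReal.ofReal ((1 - ε) ^ 2 / (1 + r)) * v x ≤ Nn δ φ x := by
    intro x hx
    refine le_trans ?_ (Nn_ge_G hδ mφ x)
    have : ∀ y, (ENNReal.ofReal ((1 - ε) / (1 + r / 1)) * (ENNReal.ofReal δ⁻¹ * v x)) * φ y ≤ G δ x y * φ y := by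
      intro y
      by_cases hy : y ∈ BA r
      · rw [G_symm]
        exact mul_le_mul_left (g1 y x hy hx).2 _
      · simp [hφ, ind_not hy]
    refine le_trans ?_ (lintegral_mono this)
    rw [lintegral_const_mul _ mφ]
    refine le_trans ?_ (mul_le_mul_right m1 _)
    rw [show ENNReal.ofReal ((1 - ε) ^ 2 / (1 + r)) =
      ENNReal.ofReal ((1 - ε) / (1 + r / 1)) * ENNReal.ofReal δ⁻¹ * ENNReal.ofReal ((1 - ε) * δ) by
        rw [← ENNReal.ofReal_mul (by positivity), ← ENNReal.ofReal_mul (by positivity)]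
        congr 1
        field_simp]
    exact le_of_eq (by ring)
  set κ := ENNReal.ofReal ((1 + r) / (1 - ε) ^ 2) with hκ
  have hvκ : ∀ x ∈ BB 1, v x ≤ κ * Nn δ φ x := by
    intro x hx
    have := mul_le_mul_right (hvφ x hx) κ
    rw [← mul_assoc, hκ, ← ENNReal.ofReal_mul (by positivity)] at this
    rw [show (1 + r) / (1 - ε) ^ 2 * ((1 - ε) ^ 2 / (1 + r)) = 1 by field_simp, ENNReal.ofReal_one, one_mul] at this
    exact this
  have hN : ∀ x, Nn δ χ x ≤ (κ * cr ρ) * Nn δ f x := by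
    refine pot_le_N δ hB mχ (fun x hx => by simp [hχ, ind_not hx])
      (fun x => ne_top_of_le_ne_top (cr_ne_top (1 + r)) ((χle x).trans (min_le_right _ _))) mf ?_
    intro x hx
    refine ((χle x).trans (min_le_left _ _)).trans ((hvκ x hx).trans ?_)
    rw [mul_assoc]
    exact mul_le_mul_right (hM x hx) κ
  have mN := measurable_Nn δ mf
  have man := measurable_an δ 0
  have hII : cr (1 + r) * ENNReal.ofReal ((1 - ε) * δ) ≤ (κ * cr ρ) * II δ v (BA r) (BB 1) := by
    refine o1.trans ?_
    unfold II
    rw [v_pair hδ mf, ← lintegral_const_mul _ (by fun_prop)]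
    refine lintegral_mono fun x => ?_
    refine (mul_le_mul_right (hN x) _).trans (le_of_eq (by ring))
  have hII2 : ENNReal.ofReal ((1 - ε) ^ 3 * ρ * δ / (1 + r) ^ 2) ≤ II δ v (BA r) (BB 1) := by
    have : C0 * ENNReal.ofReal ((1 + r)⁻¹ * ((1 - ε) * δ)) ≤
        C0 * (ENNReal.ofReal ((1 + r) / (1 - ε) ^ 2 * ρ⁻¹) * II δ v (BA r) (BB 1)) := by
      rw [ENNReal.ofReal_mul (by positivity), ENNReal.ofReal_mul (p := (1 + r) / (1 - ε) ^ 2) (by positivity)]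
      refine le_trans (le_of_eq ?_) (hII.trans (le_of_eq ?_))
      · unfold cr; ring
      · unfold cr; ring
    rw [ENNReal.mul_le_mul_iff_right C0_ne_zero C0_ne_top] at this
    have h5 := mul_le_mul_right this (ENNReal.ofReal ((1 - ε) ^ 2 / (1 + r) * ρ))
    rw [← mul_assoc (ENNReal.ofReal _) (ENNReal.ofReal _) (II δ v (BA r) (BB 1)), ← ENNReal.ofReal_mul (by positivity), ← ENNReal.ofReal_mul (by positivity)] at h5
    rw [show (1 - ε) ^ 2 / (1 + r) * ρ * ((1 + r) / (1 - ε) ^ 2 * ρ⁻¹) = 1 by field_simp,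
      ENNReal.ofReal_one, one_mul] at h5
    refine le_trans (le_of_eq ?_) h5
    congr 1
    field_simp
  have hL := le_sum_L1 hδ hA hB (g := fun y => (ENNReal.ofReal ((1 - ε) / (1 + r / 1)) * ENNReal.ofReal δ⁻¹) * v y)
    (measurable_v.const_mul _) (fun x hx y hy => by
      have := (g1 x y hx hy).2
      rwa [← mul_assoc] at this)
  rw [II_mul δ _ measurable_v hA hB] at hL
  refine le_trans ?_ hL
  refine le_trans (le_of_eq ?_) (mul_le_mul_right hII2 _)
  rw [← ENNReal.ofReal_mul (by positivity), ← ENNReal.ofReal_mul (by positivity)]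
  congr 1
  field_simp

end LoopAux

namespace LoopAux
open Set Filter Topology
open scoped ENNReal

/-- the weights produced by averaging over the mesh -/
noncomputable def wt (n : ℕ) (ε t : ℝ) : ℝ≥0∞ :=
  if t < ((n + 1 : ℕ) : ℝ) * ε then ENNReal.ofReal ((((n + 1 : ℕ) : ℝ) ^ 2)⁻¹) else 0

lemma measurable_wt (n : ℕ) (ε : ℝ) : Measurable (wt n ε) := by
  unfold wt
  exact Measurable.ite (measurableSet_lt measurable_id measurable_const) measurable_const measurable_const

lemma avg_Ld {Q : X → ℝ → Measure C(ℝ, X)} {A B : Set X} {g : ℕ → X × ℝ → ℝ≥0∞}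
    (mg : ∀ n, Measurable (g n))
    (hg : ∀ n x t, 0 < t → pk t x x * Q x t (En A B (n+1) t) = g n (x, t)) (ε : ℝ) :
    ∫⁻ δ in Ioo 0 ε, Ld Q A B δ = ∫⁻ x, ∫⁻ t in Ioi (0:ℝ), ∑' n, wt n ε t * g n (x, t) := by
  have mw := fun n => measurable_wt n ε
  have mG : ∀ n, Measurable fun t => ∫⁻ x, g n (x, t) := fun n =>
    Measurable.lintegral_prod_left' (mg n)
  have e1 : ∫⁻ δ in Ioo 0 ε, Ld Q A B δ =
      ∫⁻ δ in Ioi (0:ℝ), ∑' n : ℕ, (if δ < ε then 1 else 0) * (((n + 1 : ℕ) : ℝ≥0∞)⁻¹ *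
        ∫⁻ x, g n (x, ((n + 1 : ℕ) : ℝ) * δ)) := by
    have : Ioo 0 ε = Iio ε ∩ Ioi 0 := by ext; simp [and_comm]
    rw [this, ← Measure.restrict_restrict measurableSet_Iio, ← lintegral_indicator measurableSet_Iio]
    refine setLIntegral_congr_fun measurableSet_Ioi fun δ hδ => ?_
    simp only [indicator, mem_Iio]
    by_cases h : δ < ε
    · simp only [h, if_true, one_mul, Ld]
      refine tsum_congr fun n => ?_
      congr 1
      refine lintegral_congr fun x => ?_
      exact hg n x _ (mul_pos (by positivity) hδ)
    · simp [h]
  have e2 : ∀ n : ℕ, ∫⁻ δ in Ioi (0:ℝ), (if δ < ε then 1 else 0) * (((n + 1 : ℕ) : ℝ≥0∞)⁻¹ *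
        ∫⁻ x, g n (x, ((n + 1 : ℕ) : ℝ) * δ)) = ∫⁻ x, ∫⁻ t in Ioi (0:ℝ), wt n ε t * g n (x, t) := by
    intro n
    have hN : (0:ℝ) < ((n + 1 : ℕ) : ℝ) := by positivity
    have h := lintegral_Ioi_scale hN (fun t => (if t < ((n + 1 : ℕ) : ℝ) * ε then 1 else 0) * (((n + 1 : ℕ) : ℝ≥0∞)⁻¹ *
        ∫⁻ x, g n (x, t)))
    have h' : ∀ δ : ℝ, ((n + 1 : ℕ) : ℝ) * δ < ((n + 1 : ℕ) : ℝ) * ε ↔ δ < ε := fun δ =>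
      mul_lt_mul_iff_right₀ hN
    simp only [h'] at h
    rw [h, lintegral_lintegral_swap (by have := mg n; have := mw n; fun_prop)]
    have mite : Measurable fun t : ℝ => (if t < ((n + 1 : ℕ) : ℝ) * ε then (1:ℝ≥0∞) else 0) :=
      Measurable.ite (measurableSet_lt measurable_id measurable_const) measurable_const measurable_const
    have := mG n
    rw [← lintegral_const_mul _ (by fun_prop)]
    refine lintegral_congr fun t => ?_
    have m3 : Measurable fun x => g n (x, t) := (mg n).comp (by fun_prop)
    rw [lintegral_const_mul _ m3]
    unfold wt
    split_ifs
    · rw [one_mul, ← mul_assoc]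
      congr 1
      have : (((n + 1 : ℕ) : ℝ≥0∞)⁻¹) = ENNReal.ofReal (((n + 1 : ℕ) : ℝ)⁻¹) := by
        rw [ENNReal.ofReal_inv_of_pos hN, ENNReal.ofReal_natCast]
      rw [this, ← ENNReal.ofReal_mul (by positivity)]
      congr 1
      field_simp
    · simp
  rw [e1, lintegral_tsum]
  · simp_rw [e2]
    rw [← lintegral_tsum]
    · refine lintegral_congr fun x => ?_
      rw [lintegral_tsum]
      intro n
      have := mw n
      have m3 : Measurable fun t => g n (x, t) := (mg n).comp (by fun_prop)
      exact (this.mul m3).aemeasurable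
    · intro n
      have := mw n
      have := mg n
      exact (Measurable.lintegral_prod_right' (f := fun p : X × ℝ => wt n ε p.2 * g n p) (by fun_prop)).aemeasurable
  · intro n
    have mite : Measurable fun t : ℝ => (if t < ε then (1:ℝ≥0∞) else 0) :=
      Measurable.ite (measurableSet_lt measurable_id measurable_const) measurable_const measurable_const
    have := (mG n).comp (measurable_const_mul ((n + 1 : ℕ) : ℝ))
    exact (mite.mul (this.const_mul _)).aemeasurable

lemma tele_ge {a b : ℕ → ℝ≥0∞} (h : ∀ n, a n ≤ b n + a (n+1)) (ha : Tendsto a atTop (𝓝 0)) : a 0 ≤ ∑' n, b n := by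
  have h1 : ∀ n, a 0 ≤ (∑ i ∈ Finset.range n, b i) + a n := by
    intro n
    induction n with
    | zero => simp
    | succ n ih =>
      refine ih.trans ?_
      rw [Finset.sum_range_succ, add_assoc]
      gcongr
      exact h n
  have h2 : Tendsto (fun n => (∑ i ∈ Finset.range n, b i) + a n) atTop (𝓝 (∑' n, b n + 0)) :=
    (ENNReal.tendsto_nat_tsum b).add ha
  rw [add_zero] at h2
  exact ge_of_tendsto' h2 h1

lemma tele_le {a b : ℕ → ℝ≥0∞} (h : ∀ n, b n + a (n+1) ≤ a n) : ∑' n, b n ≤ a 0 := by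
  have h1 : ∀ n, (∑ i ∈ Finset.range n, b i) + a n ≤ a 0 := by
    intro n
    induction n with
    | zero => simp
    | succ n ih =>
      refine le_trans ?_ ih
      rw [Finset.sum_range_succ, add_assoc]
      gcongr
      exact h n
  exact ENNReal.tsum_le_of_sum_range_le fun n => le_self_add.trans (h1 n)

lemma wt_shift {ε t : ℝ} (hε : 0 < ε) (ht : 0 < t) (g : ℕ → ℝ≥0∞) :
    ∑' n, wt n ε t * g n =
      ∑' k : ℕ, ENNReal.ofReal ((((k + ⌊t / ε⌋₊ + 1 : ℕ) : ℝ) ^ 2)⁻¹) * g (k + ⌊t / ε⌋₊) := by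
  have key : ∀ n : ℕ, t < ((n + 1 : ℕ) : ℝ) * ε ↔ ⌊t / ε⌋₊ ≤ n := by
    intro n
    rw [← div_lt_iff₀ hε, ← Nat.floor_lt (by positivity), Nat.lt_succ_iff]
  rw [← ENNReal.summable.sum_add_tsum_nat_add' (k := ⌊t / ε⌋₊)]
  rw [Finset.sum_eq_zero, zero_add]
  · refine tsum_congr fun k => ?_
    rw [wt, if_pos ((key _).2 (by omega))]
  · intro i hi
    rw [wt, if_neg, zero_mul]
    rw [key]
    have := Finset.mem_range.1 hi
    omega

lemma wt_lower (M : ℕ) :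
    ENNReal.ofReal (((M + 1 : ℕ) : ℝ)⁻¹) ≤ ∑' k : ℕ, ENNReal.ofReal ((((k + M + 1 : ℕ) : ℝ) ^ 2)⁻¹) := by
  have := tele_ge (a := fun k => ENNReal.ofReal (((k + M + 1 : ℕ) : ℝ)⁻¹))
    (b := fun k => ENNReal.ofReal ((((k + M + 1 : ℕ) : ℝ) ^ 2)⁻¹)) ?_ ?_
  · simpa using this
  · intro n
    rw [← ENNReal.ofReal_add (by positivity) (by positivity)]
    refine ENNReal.ofReal_le_ofReal ?_
    push_cast
    have : (0:ℝ) < n + M + 1 := by positivity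
    have h2 : (n:ℝ) + 1 + M + 1 = (n + M + 1) + 1 := by ring
    rw [h2]
    generalize (n:ℝ) + M + 1 = y at *
    rw [← sub_nonneg]
    have : (y ^ 2)⁻¹ + (y + 1)⁻¹ - y⁻¹ = 1 / (y ^ 2 * (y + 1)) := by field_simp; ring
    rw [this]; positivity
  · rw [← ENNReal.ofReal_zero]
    refine ENNReal.tendsto_ofReal ?_
    refine tendsto_inv_atTop_zero.comp (tendsto_natCast_atTop_atTop.comp ?_)
    exact tendsto_atTop_mono (fun n => by show n ≤ n + M + 1; omega) tendsto_id

lemma wt_upper (M : ℕ) :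
    ∑' k : ℕ, ENNReal.ofReal ((((k + M + 1 : ℕ) : ℝ) ^ 2)⁻¹) ≤ ENNReal.ofReal (((M : ℝ) + 1 / 2)⁻¹) := by
  have := tele_le (a := fun k => ENNReal.ofReal (((k : ℝ) + M + 1 / 2)⁻¹))
    (b := fun k => ENNReal.ofReal ((((k + M + 1 : ℕ) : ℝ) ^ 2)⁻¹)) ?_
  · simpa using this
  · intro n
    rw [← ENNReal.ofReal_add (by positivity) (by positivity)]
    refine ENNReal.ofReal_le_ofReal ?_
    push_cast
    have h1 : (n:ℝ) + 1 + M + 1 / 2 = (n + M + 1 / 2) + 1 := by ring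
    have h2 : (n:ℝ) + M + 1 = (n + M + 1 / 2) + 1 / 2 := by ring
    rw [h1, h2]
    have : (0:ℝ) < (n:ℝ) + M + 1 / 2 := by positivity
    generalize (n:ℝ) + M + 1 / 2 = y at *
    rw [← sub_nonneg]
    have : y⁻¹ - (((y + 1 / 2) ^ 2)⁻¹ + (y + 1)⁻¹) = (1 / 4) / (y * (y + 1) * (y + 1 / 2) ^ 2) := by field_simp; ring
    rw [this]; positivity

end LoopAux

namespace LoopAux
open Set Filter Topology
open scoped ENNReal

/-- the continuous crossing event -/
def EE (A B : Set X) : Set C(ℝ, X) := {w | (∃ s : ℝ, w s ∈ A) ∧ (∃ s : ℝ, w s ∈ B)}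

lemma measurableSet_EE {A B : Set X} (hA : IsOpen A) (hB : IsOpen B) : MeasurableSet (EE A B) := by
  have : ∀ {S : Set X}, IsOpen S → MeasurableSet {w : C(ℝ, X) | ∃ s : ℝ, w s ∈ S} := by
    intro S hS
    have : {w : C(ℝ, X) | ∃ s : ℝ, w s ∈ S} = ⋃ s : ℝ, (fun w : C(ℝ, X) => w s) ⁻¹' S := by
      ext w; simp
    rw [this]
    have := pathBorel
    exact (isOpen_iUnion fun s => hS.preimage (ContinuousEvalConst.continuous_eval_const s)).measurableSet
  exact (this hA).inter (this hB)

lemma grid_eventually {S : Set X} (hS : IsOpen S) {w : C(ℝ, X)} {x : X} {T s : ℝ} (hT : 0 < T)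
    (h0 : w 0 = x) (hx : ∀ s : ℝ, s ∉ Ioo 0 T → w s = x) (hs : w s ∈ S) :
    ∀ᶠ n : ℕ in atTop, ∃ j : ℕ, j < n + 1 ∧ w (j * (T / (n + 1 : ℕ))) ∈ S := by
  by_cases hm : s ∈ Ioo 0 T
  · have ht : Tendsto (fun n : ℕ => (⌊s * (n + 1 : ℕ) / T⌋₊ : ℝ) * (T / (n + 1 : ℕ))) atTop (𝓝 s) := by
      have h1 : Tendsto (fun n : ℕ => s - T / (n + 1 : ℕ)) atTop (𝓝 (s - 0)) := by
        refine tendsto_const_nhds.sub ?_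
        exact (tendsto_const_nhds.div_atTop (tendsto_natCast_atTop_atTop.comp (tendsto_add_atTop_nat 1)))
      rw [sub_zero] at h1
      refine tendsto_of_tendsto_of_tendsto_of_le_of_le h1 tendsto_const_nhds ?_ ?_
      · intro n
        have hN : (0:ℝ) < ((n + 1 : ℕ) : ℝ) := by positivity
        have := (Nat.lt_floor_add_one (s * (n + 1 : ℕ) / T)).le
        have h3 := mul_le_mul_of_nonneg_right this (show 0 ≤ T / ((n + 1 : ℕ) : ℝ) by positivity)
        have h4 : s * (n + 1 : ℕ) / T * (T / ((n + 1 : ℕ) : ℝ)) = s := by field_simp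
        rw [h4] at h3
        simp only
        linarith
      · intro n
        have hN : (0:ℝ) < ((n + 1 : ℕ) : ℝ) := by positivity
        have := Nat.floor_le (show 0 ≤ s * (n + 1 : ℕ) / T by have := hm.1; positivity)
        have h3 := mul_le_mul_of_nonneg_right this (show 0 ≤ T / ((n + 1 : ℕ) : ℝ) by positivity)
        have h4 : s * (n + 1 : ℕ) / T * (T / ((n + 1 : ℕ) : ℝ)) = s := by field_simp
        rwa [h4] at h3
    have h5 := (w.continuous.tendsto s).comp ht
    filter_upwards [h5.eventually (hS.mem_nhds hs)] with n hn
    refine ⟨⌊s * (n + 1 : ℕ) / T⌋₊, ?_, hn⟩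
    rw [Nat.floor_lt (by have := hm.1; positivity), div_lt_iff₀ hT, mul_comm]
    exact mul_lt_mul_of_pos_left hm.2 (by positivity)
  · refine Eventually.of_forall fun n => ⟨0, by omega, ?_⟩
    simp only [Nat.cast_zero, zero_mul]
    rwa [h0, ← hx s hm]

lemma EE_lower {Q : Measure C(ℝ, X)} {x : X} {T : ℝ} (hT : 0 < T) (hQ : IsBrownianBridge 3 x T Q)
    {A B : Set X} (hA : IsOpen A) (hB : IsOpen B) {c : ℝ≥0∞} (hc : c < Q (EE A B)) :
    ∃ n0 : ℕ, ∀ n ≥ n0, c ≤ Q (En A B (n+1) T) := by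
  set W : ℕ → Set C(ℝ, X) := fun m => ⋂ n : ℕ, ⋂ _ : m ≤ n, En A B (n+1) T with hW
  have hmono : Monotone W := by
    intro a b hab w hw
    simp only [hW, mem_iInter] at hw ⊢
    exact fun n hn => hw n (hab.trans hn)
  have h1 : Q (EE A B) ≤ Q (⋃ m, W m) := by
    refine measure_mono_ae ?_
    filter_upwards [hQ.2.1] with w hw hE
    obtain ⟨⟨s, hs⟩, ⟨s', hs'⟩⟩ := hE
    obtain ⟨m, hm⟩ := eventually_atTop.1 ((grid_eventually hA hT hw.1 hw.2 hs).and (grid_eventually hB hT hw.1 hw.2 hs'))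
    refine mem_iUnion.2 ⟨m, ?_⟩
    simp only [hW, mem_iInter]
    exact fun n hn => hm n hn
  rw [hmono.measure_iUnion] at h1
  obtain ⟨m, hm⟩ := lt_iSup_iff.1 (hc.trans_le h1)
  refine ⟨m, fun n hn => hm.le.trans (measure_mono ?_)⟩
  exact (iInter_subset _ n).trans (iInter_subset _ hn)

lemma En_subset (A B : Set X) (n : ℕ) (T : ℝ) : En A B n T ⊆ EE A B := by
  rintro w ⟨⟨j, _, h⟩, ⟨k, _, hh⟩⟩
  exact ⟨⟨_, h⟩, ⟨_, hh⟩⟩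

/-- shorthand: mesh averaging lengths -/
noncomputable def ep (k : ℕ) : ℝ := 1 / ((k:ℝ) + 1)

lemma ep_pos (k : ℕ) : 0 < ep k := by unfold ep; positivity
lemma ep_tendsto : Tendsto ep atTop (𝓝 0) := tendsto_one_div_add_atTop_nhds_zero_nat

lemma floor_tendsto {t : ℝ} (ht : 0 < t) (b : ℝ) :
    Tendsto (fun k => ep k * ((⌊t / ep k⌋₊ : ℝ) + b)) atTop (𝓝 t) := by
  have h1 : Tendsto (fun k => t + ep k * (b - 1)) atTop (𝓝 (t + 0 * (b - 1))) :=
    tendsto_const_nhds.add (ep_tendsto.mul_const _)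
  have h2 : Tendsto (fun k => t + ep k * b) atTop (𝓝 (t + 0 * b)) :=
    tendsto_const_nhds.add (ep_tendsto.mul_const _)
  rw [zero_mul, add_zero] at h1 h2
  refine tendsto_of_tendsto_of_tendsto_of_le_of_le h1 h2 ?_ ?_
  · intro k
    have e := ep_pos k
    have := mul_le_mul_of_nonneg_left (Nat.lt_floor_add_one (t / ep k)).le e.le
    rw [mul_div_cancel₀ _ e.ne'] at this
    simp only
    nlinarith
  · intro k
    have e := ep_pos k
    have := mul_le_mul_of_nonneg_left (Nat.floor_le (show 0 ≤ t / ep k by positivity)) e.le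
    rw [mul_div_cancel₀ _ e.ne'] at this
    simp only
    nlinarith

/-- averaged density -/
noncomputable def Fk (g : ℕ → ℝ≥0∞) (t : ℝ) (k : ℕ) : ℝ≥0∞ :=
  ENNReal.ofReal (ep k)⁻¹ * ∑' n, wt n (ep k) t * g n

lemma Fk_lower {g : ℕ → ℝ≥0∞} {t : ℝ} (ht : 0 < t) {q : ℝ≥0∞}
    (hq : ∀ c < q, ∃ n0, ∀ n ≥ n0, c ≤ g n) :
    q * ENNReal.ofReal t⁻¹ ≤ liminf (Fk g t) atTop := by
  have ht' : ENNReal.ofReal t⁻¹ ≠ 0 := by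
    rw [Ne, ENNReal.ofReal_eq_zero]; push Not; positivity
  rw [← ENNReal.le_div_iff_mul_le (Or.inl ht') (Or.inl ENNReal.ofReal_ne_top)]
  refine le_of_forall_lt fun c hc => ?_
  obtain ⟨c', hc1, hc2⟩ := exists_between hc
  refine hc1.trans_le ?_
  rw [ENNReal.le_div_iff_mul_le (Or.inl ht') (Or.inl ENNReal.ofReal_ne_top)]
  obtain ⟨n0, hn0⟩ := hq c' hc2
  have h1 : Tendsto (fun k => c' * ENNReal.ofReal (ep k * ((⌊t / ep k⌋₊ : ℝ) + 1))⁻¹) atTop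
      (𝓝 (c' * ENNReal.ofReal t⁻¹)) := by
    refine ENNReal.Tendsto.const_mul (ENNReal.tendsto_ofReal ((floor_tendsto ht 1).inv₀ ht.ne')) ?_
    exact Or.inl ht'
  rw [← h1.liminf_eq]
  refine liminf_le_liminf ?_
  have h2 : Tendsto (fun k => ⌊t / ep k⌋₊) atTop atTop := by
    refine tendsto_nat_floor_atTop.comp ?_
    have : (fun k => t / ep k) = fun k : ℕ => t * ((k:ℝ) + 1) := by
      funext k; unfold ep; field_simp
    rw [this]
    exact (tendsto_atTop_add_const_right _ _ tendsto_natCast_atTop_atTop).const_mul_atTop ht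
  filter_upwards [h2.eventually (eventually_ge_atTop n0)] with k hk
  unfold Fk
  rw [wt_shift (ep_pos k) ht]
  have h3 : ∑' j : ℕ, ENNReal.ofReal ((((j + ⌊t / ep k⌋₊ + 1 : ℕ) : ℝ) ^ 2)⁻¹) * c' ≤
      ∑' j : ℕ, ENNReal.ofReal ((((j + ⌊t / ep k⌋₊ + 1 : ℕ) : ℝ) ^ 2)⁻¹) * g (j + ⌊t / ep k⌋₊) :=
    ENNReal.tsum_le_tsum fun j => mul_le_mul_right (hn0 _ (by omega)) _
  refine le_trans ?_ (mul_le_mul_right h3 _)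
  rw [ENNReal.tsum_mul_right]
  have h4 := wt_lower ⌊t / ep k⌋₊
  refine le_trans ?_ (mul_le_mul_right (mul_le_mul_left h4 c') _)
  rw [mul_comm c', ← mul_assoc]
  rw [← ENNReal.ofReal_mul (by have := ep_pos k; positivity), mul_inv]
  push_cast
  rfl

lemma Fk_upper {g : ℕ → ℝ≥0∞} {t : ℝ} (ht : 0 < t) {q : ℝ≥0∞} (hq : ∀ n, g n ≤ q) (k : ℕ) :
    Fk g t k ≤ q * ENNReal.ofReal (ep k * ((⌊t / ep k⌋₊ : ℝ) + 1 / 2))⁻¹ := by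
  unfold Fk
  rw [wt_shift (ep_pos k) ht]
  have h3 : ∑' j : ℕ, ENNReal.ofReal ((((j + ⌊t / ep k⌋₊ + 1 : ℕ) : ℝ) ^ 2)⁻¹) * g (j + ⌊t / ep k⌋₊) ≤
      ∑' j : ℕ, ENNReal.ofReal ((((j + ⌊t / ep k⌋₊ + 1 : ℕ) : ℝ) ^ 2)⁻¹) * q :=
    ENNReal.tsum_le_tsum fun j => mul_le_mul_right (hq _) _
  refine (mul_le_mul_right h3 _).trans ?_
  rw [ENNReal.tsum_mul_right]
  have h4 := wt_upper ⌊t / ep k⌋₊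
  refine (mul_le_mul_right (mul_le_mul_left h4 q) _).trans ?_
  rw [mul_comm q, ← mul_assoc]
  rw [← ENNReal.ofReal_mul (by have := ep_pos k; positivity), mul_inv]

lemma hk_bound {t : ℝ} (ht : 0 < t) (k : ℕ) :
    ENNReal.ofReal (ep k * ((⌊t / ep k⌋₊ : ℝ) + 1 / 2))⁻¹ ≤ 2 * ENNReal.ofReal t⁻¹ := by
  rw [show (2:ℝ≥0∞) = ENNReal.ofReal 2 by simp, ← ENNReal.ofReal_mul (by norm_num)]
  refine ENNReal.ofReal_le_ofReal ?_
  have e := ep_pos k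
  have := mul_le_mul_of_nonneg_left (Nat.lt_floor_add_one (t / ep k)).le e.le
  rw [mul_div_cancel₀ _ e.ne'] at this
  have h0 : 0 ≤ ep k * (⌊t / ep k⌋₊ : ℝ) := by positivity
  have h2 : t / 2 ≤ ep k * ((⌊t / ep k⌋₊ : ℝ) + 1 / 2) := by nlinarith
  refine (inv_anti₀ (by positivity) h2).trans (le_of_eq ?_)
  field_simp

end LoopAux

namespace LoopAux
open Set Filter Topology
open scoped ENNReal

lemma mu_eq {μ : Measure C(ℝ, X)} {Q : X → ℝ → Measure C(ℝ, X)}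
    (hμ : ∀ A : Set C(ℝ, X), MeasurableSet A →
      μ A = ∫⁻ x, ∫⁻ t in Set.Ioi (0:ℝ), ENNReal.ofReal (t⁻¹ * (2 * π * t) ^ (-(3:ℝ)/2)) * Q x t A ∂volume ∂volume)
    {E : Set C(ℝ, X)} (hE : MeasurableSet E) :
    μ E = ∫⁻ x, ∫⁻ t in Ioi (0:ℝ), (pk t x x * Q x t E) * ENNReal.ofReal t⁻¹ := by
  rw [hμ E hE]
  refine lintegral_congr fun x => setLIntegral_congr_fun measurableSet_Ioi fun t ht => ?_
  have ht0 : (0:ℝ) < t := ht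
  rw [pk_eq_fk, fk, sub_self, norm_zero, ENNReal.ofReal_mul (by positivity)]
  simp only [ne_eq, OfNat.ofNat_ne_zero, not_false_eq_true, zero_pow, neg_zero, zero_div, Real.exp_zero, mul_one]
  ring

lemma exists_g {Q : X → ℝ → Measure C(ℝ, X)} (hQ : ∀ x t, 0 < t → IsBrownianBridge 3 x t (Q x t)) {A B : Set X}
    (hA : MeasurableSet A) (hB : MeasurableSet B) :
    ∃ g : ℕ → X × ℝ → ℝ≥0∞, (∀ n, Measurable (g n)) ∧
      ∀ n x t, 0 < t → pk t x x * Q x t (En A B (n+1) t) = g n (x, t) := by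
  have := fun n : ℕ => exists_qn hQ hA hB (n := n+1) (by omega)
  choose g h1 h2 using this
  exact ⟨g, h1, h2⟩

lemma avg_eq {Q : X → ℝ → Measure C(ℝ, X)} {A B : Set X} {g : ℕ → X × ℝ → ℝ≥0∞}
    (mg : ∀ n, Measurable (g n))
    (hg : ∀ n x t, 0 < t → pk t x x * Q x t (En A B (n+1) t) = g n (x, t)) (k : ℕ) :
    ENNReal.ofReal (ep k)⁻¹ * ∫⁻ δ in Ioo 0 (ep k), Ld Q A B δ =
      ∫⁻ x, ∫⁻ t in Ioi (0:ℝ), Fk (fun n => g n (x, t)) t k := by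
  have mw := fun n => measurable_wt n (ep k)
  have m1 : Measurable fun p : X × ℝ => ∑' n, wt n (ep k) p.2 * g n p :=
    Measurable.tsum fun n => by have := mw n; have := mg n; fun_prop
  rw [avg_Ld mg hg, ← lintegral_const_mul _ (Measurable.lintegral_prod_right' m1)]
  refine lintegral_congr fun x => ?_
  have m2 : Measurable fun t : ℝ => ∑' n, wt n (ep k) t * g n (x, t) :=
    m1.comp (f := fun t => (x, t)) (by fun_prop)
  exact (lintegral_const_mul _ m2).symm

lemma measurable_Fk {g : ℕ → X × ℝ → ℝ≥0∞} (mg : ∀ n, Measurable (g n)) (k : ℕ) :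
    Measurable fun p : X × ℝ => Fk (fun n => g n p) p.2 k := by
  unfold Fk
  have mw := fun n => measurable_wt n (ep k)
  exact (Measurable.tsum fun n => by have := mw n; have := mg n; fun_prop).const_mul _

lemma pk_lt_lower {Q : X → ℝ → Measure C(ℝ, X)} (hQ : ∀ x t, 0 < t → IsBrownianBridge 3 x t (Q x t)) {A B : Set X}
    (hA : IsOpen A) (hB : IsOpen B) {x : X} {t : ℝ} (ht : 0 < t) (c : ℝ≥0∞) (hc : c < pk t x x * Q x t (EE A B)) :
    ∃ n0 : ℕ, ∀ n ≥ n0, c ≤ pk t x x * Q x t (En A B (n+1) t) := by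
  have h2 : c / pk t x x < Q x t (EE A B) := ENNReal.div_lt_of_lt_mul' hc
  obtain ⟨n0, h⟩ := EE_lower ht (hQ x t ht) hA hB h2
  refine ⟨n0, fun n hn => ?_⟩
  have h0 : pk t x x ≠ 0 := by
    intro h0
    simp [h0] at hc
  have := mul_le_mul_right (h n hn) (pk t x x)
  rwa [ENNReal.mul_div_cancel h0 (pk_ne_top _ _ _)] at this

lemma muE_le {μ : Measure C(ℝ, X)} {Q : X → ℝ → Measure C(ℝ, X)}
    (hQ : ∀ x t, 0 < t → IsBrownianBridge 3 x t (Q x t))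
    (hμ : ∀ A : Set C(ℝ, X), MeasurableSet A →
      μ A = ∫⁻ x, ∫⁻ t in Set.Ioi (0:ℝ), ENNReal.ofReal (t⁻¹ * (2 * π * t) ^ (-(3:ℝ)/2)) * Q x t A ∂volume ∂volume)
    {A B : Set X} (hA : IsOpen A) (hB : IsOpen B) {K : ℝ≥0∞} {δ0 : ℝ} (h0 : 0 < δ0)
    (hK : ∀ δ, 0 < δ → δ < δ0 → Ld Q A B δ ≤ K) : μ (EE A B) ≤ K := by
  obtain ⟨g, mg, hg⟩ := exists_g hQ hA.measurableSet hB.measurableSet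
  rw [mu_eq hμ (measurableSet_EE hA hB)]
  have h1 : ∀ x, ∀ t ∈ Ioi (0:ℝ), (pk t x x * Q x t (EE A B)) * ENNReal.ofReal t⁻¹ ≤
      liminf (fun k => Fk (fun n => g n (x, t)) t k) atTop := by
    intro x t ht
    refine Fk_lower ht fun c hc => ?_
    obtain ⟨n0, h⟩ := pk_lt_lower hQ hA hB ht c hc
    exact ⟨n0, fun n hn => (h n hn).trans (hg n x t ht).le⟩
  refine (lintegral_mono fun x => setLIntegral_mono' measurableSet_Ioi (h1 x)).trans ?_
  refine (lintegral_mono fun x => lintegral_liminf_le fun k => ?_).trans ?_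
  · exact (measurable_Fk mg k).comp (f := fun t => (x, t)) (by fun_prop)
  refine (lintegral_liminf_le fun k => ?_).trans ?_
  · exact Measurable.lintegral_prod_right' (measurable_Fk mg k)
  simp_rw [← avg_eq mg hg]
  refine liminf_le_of_frequently_le' (Eventually.frequently ?_)
  filter_upwards [ep_tendsto.eventually (gt_mem_nhds h0)] with k hk
  have : ∫⁻ δ in Ioo 0 (ep k), Ld Q A B δ ≤ ∫⁻ δ in Ioo 0 (ep k), K :=
    setLIntegral_mono' measurableSet_Ioo fun δ hδ => hK δ hδ.1 (hδ.2.trans hk)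
  refine (mul_le_mul_right this _).trans ?_
  rw [setLIntegral_const, Real.volume_Ioo, sub_zero, mul_comm K, ← mul_assoc,
    ← ENNReal.ofReal_mul (by have := ep_pos k; positivity), inv_mul_cancel₀ (ep_pos k).ne', ENNReal.ofReal_one, one_mul]

lemma le_muE {μ : Measure C(ℝ, X)} {Q : X → ℝ → Measure C(ℝ, X)}
    (hQ : ∀ x t, 0 < t → IsBrownianBridge 3 x t (Q x t))
    (hμ : ∀ A : Set C(ℝ, X), MeasurableSet A →
      μ A = ∫⁻ x, ∫⁻ t in Set.Ioi (0:ℝ), ENNReal.ofReal (t⁻¹ * (2 * π * t) ^ (-(3:ℝ)/2)) * Q x t A ∂volume ∂volume)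
    {A B : Set X} (hA : IsOpen A) (hB : IsOpen B) {K : ℝ≥0∞} {δ0 : ℝ} (h0 : 0 < δ0)
    (hK : ∀ δ, 0 < δ → δ < δ0 → K ≤ Ld Q A B δ) (hfin : μ (EE A B) ≠ ∞) : K ≤ μ (EE A B) := by
  obtain ⟨g, mg, hg⟩ := exists_g hQ hA.measurableSet hB.measurableSet
  have gle : ∀ n x t, 0 < t → g n (x, t) ≤ pk t x x * Q x t (EE A B) := fun n x t ht => by
    rw [← hg n x t ht]
    exact mul_le_mul_right (measure_mono (En_subset A B _ _)) _
  set qm : X × ℝ → ℝ≥0∞ := fun p => if 0 < p.2 then liminf (fun n => g n p) atTop else 0 with hqm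
  have mq : Measurable qm :=
    Measurable.ite (measurableSet_lt measurable_const measurable_snd) (Measurable.liminf mg) measurable_const
  have qeq : ∀ x t, 0 < t → qm (x, t) = pk t x x * Q x t (EE A B) := by
    intro x t ht
    simp only [hqm, ht, if_true]
    apply le_antisymm
    · exact liminf_le_of_frequently_le' (Frequently.of_forall fun n => gle n x t ht)
    · refine le_of_forall_lt fun c hc => ?_
      obtain ⟨c', hc1, hc2⟩ := exists_between hc
      refine hc1.trans_le ?_
      obtain ⟨n0, h⟩ := pk_lt_lower hQ hA hB ht c' hc2
      refine le_liminf_of_le (by isBoundedDefault) ?_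
      filter_upwards [eventually_ge_atTop n0] with n hn
      rw [← hg n x t ht]
      exact h n hn
  set H : ℕ → X × ℝ → ℝ≥0∞ := fun k p => qm p * ENNReal.ofReal (ep k * ((⌊p.2 / ep k⌋₊ : ℝ) + 1 / 2))⁻¹ with hH
  set L : X × ℝ → ℝ≥0∞ := fun p => qm p * ENNReal.ofReal (p.2)⁻¹ with hL
  have mH : ∀ k, Measurable (H k) := fun k => by
    have : Measurable fun t : ℝ => (⌊t / ep k⌋₊ : ℝ) :=
      measurable_from_nat.comp (Nat.measurable_floor.comp (measurable_id.div_const _))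
    have := this.comp (measurable_snd : Measurable (Prod.snd : X × ℝ → ℝ))
    have m2 : Measurable fun p : X × ℝ => (⌊p.2 / ep k⌋₊ : ℝ) := this
    fun_prop
  have mL : Measurable L := by fun_prop
  set ν : Measure (X × ℝ) := (volume : Measure X).prod (volume.restrict (Ioi (0:ℝ))) with hν
  have hmu : μ (EE A B) = ∫⁻ p, L p ∂ν := by
    rw [mu_eq hμ (measurableSet_EE hA hB), hν, lintegral_prod _ mL.aemeasurable]
    refine lintegral_congr fun x => setLIntegral_congr_fun measurableSet_Ioi fun t ht => ?_
    simp only [hL]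
    rw [qeq x t ht]
  have hlim : Tendsto (fun k => ∫⁻ p, H k p ∂ν) atTop (𝓝 (∫⁻ p, L p ∂ν)) := by
    refine tendsto_lintegral_of_dominated_convergence (fun p => 2 * L p) mH ?_ ?_ ?_
    · intro k
      refine Eventually.of_forall fun p => ?_
      by_cases hp : 0 < p.2
      · simp only [hH, hL]
        refine (mul_le_mul_right (hk_bound hp k) _).trans (le_of_eq (by ring))
      · simp [hH, hqm, hp]
    · rw [lintegral_const_mul _ mL, ← hmu]
      exact ENNReal.mul_ne_top (by simp) hfin
    · refine Eventually.of_forall fun p => ?_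
      by_cases hp : 0 < p.2
      · simp only [hH, hL]
        refine ENNReal.Tendsto.const_mul (ENNReal.tendsto_ofReal ((floor_tendsto hp (1/2)).inv₀ hp.ne')) ?_
        left
        rw [Ne, ENNReal.ofReal_eq_zero]; push Not; positivity
      · simp [hH, hL, hqm, hp]
  rw [hmu]
  refine ge_of_tendsto hlim ?_
  filter_upwards [ep_tendsto.eventually (gt_mem_nhds h0)] with k hk
  have h1 : K ≤ ENNReal.ofReal (ep k)⁻¹ * ∫⁻ δ in Ioo 0 (ep k), Ld Q A B δ := by
    have : ∫⁻ δ in Ioo 0 (ep k), K ≤ ∫⁻ δ in Ioo 0 (ep k), Ld Q A B δ :=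
      setLIntegral_mono' measurableSet_Ioo fun δ hδ => hK δ hδ.1 (hδ.2.trans hk)
    refine le_trans ?_ (mul_le_mul_right this _)
    rw [setLIntegral_const, Real.volume_Ioo, sub_zero, mul_comm K, ← mul_assoc,
      ← ENNReal.ofReal_mul (by have := ep_pos k; positivity), inv_mul_cancel₀ (ep_pos k).ne', ENNReal.ofReal_one, one_mul]
  refine h1.trans ?_
  rw [avg_eq mg hg, hν, lintegral_prod _ (mH k).aemeasurable]
  refine lintegral_mono fun x => setLIntegral_mono' measurableSet_Ioi fun t ht => ?_
  refine (Fk_upper ht (q := qm (x, t)) (fun n => ?_) k)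
  rw [qeq x t ht]
  exact gle n x t ht

end LoopAux

namespace LoopAux
open Set Filter Topology
open scoped ENNReal

lemma num_upper {r q : ℝ} (hr : 0 < r) (hr1 : r < 1 / 10) (hq0 : 0 < q) (hq : q ≤ r * (1 + 3 * r)) :
    (1 + r) / (1 - q) * (q / (1 - q)) ≤ r + 14 * r ^ 2 := by
  have hq1 : q ≤ 13 / 10 * r := by nlinarith
  have hq2 : q < 13 / 100 := by nlinarith
  have h1 : 0 < 1 - q := by linarith
  have e : (1 + r) / (1 - q) * (q / (1 - q)) = (1 + r) * q * ((1 - q) ^ 2)⁻¹ := by field_simp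
  have h2 : ((1 - q) ^ 2)⁻¹ ≤ 1 + 6 * r := by
    rw [inv_le_comm₀ (by positivity) (by positivity)]
    refine le_trans (b := (1 + 4 * q)⁻¹) (inv_anti₀ (by positivity) (by linarith)) ?_
    rw [inv_le_iff_one_le_mul₀ (by positivity)]
    nlinarith [mul_pos hq0 hq0, mul_pos (mul_pos hq0 hq0) hq0, mul_nonneg hq0.le (show 0 ≤ 2 - 7 * q by linarith)]
  rw [e]
  calc (1 + r) * q * ((1 - q) ^ 2)⁻¹ ≤ (1 + r) * (r * (1 + 3 * r)) * (1 + 6 * r) := by gcongr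
    _ ≤ (r * (1 + 5 * r)) * (1 + 6 * r) := by
      gcongr ?_ * _
      nlinarith [mul_pos hr hr, mul_nonneg (mul_pos hr hr).le (show 0 ≤ 1 - 3 * r by linarith)]
    _ ≤ r + 14 * r ^ 2 := by
      nlinarith [mul_pos hr hr, mul_nonneg (mul_pos hr hr).le (show 0 ≤ 1 - 10 * r by linarith)]

lemma num_lower {r : ℝ} (hr : 0 < r) (hr1 : r < 1 / 10) :
    r - 14 * r ^ 2 + ((1 + r) / (1 - r / 1) * (r / 1 / (1 - r / 1))) ^ 2 ≤
      (1 - r) ^ 4 * (r * (1 - r)) / (1 + r) ^ 3 := by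
  have h1 := num_upper (q := r) hr hr1 hr (by nlinarith)
  rw [div_one]
  have h0 : 0 ≤ (1 + r) / (1 - r) * (r / (1 - r)) := by
    have : 0 < 1 - r := by linarith
    positivity
  have h2 : ((1 + r) / (1 - r) * (r / (1 - r))) ^ 2 ≤ 6 * r ^ 2 := by
    have : (1 + r) / (1 - r) * (r / (1 - r)) ≤ 24 / 10 * r := by nlinarith
    nlinarith
  have h3 : r * (1 - 8 * r) ≤ (1 - r) ^ 4 * (r * (1 - r)) / (1 + r) ^ 3 := by
    have b : 1 + (8:ℕ) * (-r) ≤ (1 + -r) ^ 8 := one_add_mul_le_pow (by linarith) 8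
    push_cast at b
    have : (1 - r) ^ 3 ≤ ((1 + r) ^ 3)⁻¹ := by
      rw [← inv_pow]
      have : 1 - r ≤ (1 + r)⁻¹ := by
        rw [le_inv_comm₀ (by linarith) (by linarith), le_inv_comm₀ (by linarith) (by
          have : 0 < 1 - r := by linarith
          positivity)]
        rw [le_inv_comm₀ (by linarith) (by linarith), inv_eq_one_div, le_div_iff₀ (by linarith)]
        nlinarith
      exact pow_le_pow_left₀ (by linarith) this 3
    calc r * (1 - 8 * r) ≤ r * (1 + -r) ^ 8 := by gcongr; linarith
      _ = (1 - r) ^ 4 * (r * (1 - r)) * (1 - r) ^ 3 := by ring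
      _ ≤ (1 - r) ^ 4 * (r * (1 - r)) * ((1 + r) ^ 3)⁻¹ := by
        have : 0 < 1 - r := by linarith
        gcongr
      _ = _ := by rw [div_eq_mul_inv]
  nlinarith

lemma sub1 {r : ℝ} (hr1 : r < 1) :
    EE (BA r) (BB 1) ⊆ {w : C(ℝ, X) | (∃ s : ℝ, ‖w s‖ = 1) ∧ (∃ s : ℝ, ‖w s‖ = r)} := by
  rintro w ⟨⟨s, hs⟩, ⟨t, ht⟩⟩
  have hs' : ‖w s‖ < r := hs
  have ht' : 1 < ‖w t‖ := ht
  have hc : Continuous fun s : ℝ => ‖w s‖ := w.continuous.norm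
  exact ⟨mem_range_of_exists_le_of_exists_ge hc ⟨s, by linarith⟩ ⟨t, ht'.le⟩,
    mem_range_of_exists_le_of_exists_ge hc ⟨s, hs'.le⟩ ⟨t, by linarith⟩⟩

lemma sub2 {r : ℝ} (hr : 0 < r) :
    {w : C(ℝ, X) | (∃ s : ℝ, ‖w s‖ = 1) ∧ (∃ s : ℝ, ‖w s‖ = r)} ⊆ EE (BA (r * (1 + r))) (BB (1 - r)) := by
  rintro w ⟨⟨s, hs⟩, ⟨t, ht⟩⟩
  refine ⟨⟨t, ?_⟩, ⟨s, ?_⟩⟩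
  · change ‖w t‖ < _
    rw [ht]; nlinarith
  · change _ < ‖w s‖
    rw [hs]; linarith

lemma main_bounds {μ : Measure C(ℝ, X)} (hμ : IsBrownianLoopMeasure μ) {r : ℝ} (hr : 0 < r) (hr1 : r < 1 / 10) :
    |(μ {w | (∃ s : ℝ, ‖w s‖ = 1) ∧ (∃ s : ℝ, ‖w s‖ = r)}).toReal - r| ≤ 14 * r ^ 2 := by
  obtain ⟨Q, hQ, hμ⟩ := hμ
  set S := {w : C(ℝ, X) | (∃ s : ℝ, ‖w s‖ = 1) ∧ (∃ s : ℝ, ‖w s‖ = r)} with hS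
  have up : μ S ≤ ENNReal.ofReal (r + 14 * r ^ 2) := by
    refine (measure_mono (sub2 hr)).trans ?_
    have ha : 0 < r * (1 + r) := by positivity
    have hab : r * (1 + r) < 1 - r := by nlinarith
    obtain ⟨d, hd, H⟩ := crossing_upper ha hab hr (by linarith)
    refine muE_le hQ hμ (isOpen_BA _) (isOpen_BB _) hd fun δ hδ h => ?_
    refine (Ld_le hQ (isOpen_BA _).measurableSet (isOpen_BB _).measurableSet (disj_BAB hab) hδ).trans ?_
    refine (H δ hδ h).1.trans (ENNReal.ofReal_le_ofReal ?_)
    refine num_upper hr hr1 (div_pos ha (by linarith)) ?_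
    rw [div_le_iff₀ (by linarith)]
    nlinarith [mul_pos hr hr, mul_nonneg (mul_pos hr hr).le (show 0 ≤ 1 - 3 * r by linarith)]
  have lo : ENNReal.ofReal (r - 14 * r ^ 2) ≤ μ S := by
    refine le_trans ?_ (measure_mono (sub1 (r := r) (by linarith)))
    have hr2 : r < 1 := by linarith
    obtain ⟨d, hd, H⟩ := crossing_upper hr hr2 hr hr2
    obtain ⟨d', hd', H'⟩ := crossing_lower hr hr2 hr hr2
    refine le_muE hQ hμ (isOpen_BA _) (isOpen_BB _) (δ0 := min d d') (lt_min hd hd') (fun δ hδ h => ?_)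
      (ne_top_of_le_ne_top ENNReal.ofReal_ne_top ((measure_mono (sub1 (r := r) hr2)).trans up))
    rw [lt_min_iff] at h
    have h1 := le_Ld hQ (isOpen_BA r).measurableSet (isOpen_BB 1).measurableSet (disj_BAB hr2) hδ
    have h2 := (H' δ hδ h.2).trans (h1.trans (add_le_add le_rfl (H δ hδ h.1).2))
    rw [← tsub_le_iff_right, ← ENNReal.ofReal_sub _ (by positivity)] at h2
    refine le_trans (ENNReal.ofReal_le_ofReal ?_) h2
    have := num_lower hr hr1
    linarith
  have hfin : μ S ≠ ∞ := ne_top_of_le_ne_top ENNReal.ofReal_ne_top up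
  rw [abs_le]
  constructor
  · have := (ENNReal.ofReal_le_iff_le_toReal hfin).1 lo
    linarith
  · have := ENNReal.toReal_le_of_le_ofReal (by positivity) up
    linarith

end LoopAux

/-- **Asymptotics of the shell-crossing loop measure.** As `r → 0`, the Brownian loop measure
in `ℝ³` of the set of loops intersecting both the unit sphere and the sphere of radius `r`
equals `(1 + O(r))·r`; in particular it is asymptotically equivalent to `r`. -/
theorem loop_measure_crossing_asymptotics
    (μ : Measure C(ℝ, EuclideanSpace ℝ (Fin 3))) (hμ : IsBrownianLoopMeasure μ) :
    ∃ C : ℝ, 0 < C ∧ ∃ r₀ : ℝ, 0 < r₀ ∧ r₀ ≤ 1 ∧ ∀ r : ℝ, 0 < r → r < r₀ →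
      |(μ {w | (∃ s : ℝ, ‖w s‖ = 1) ∧ (∃ s : ℝ, ‖w s‖ = r)}).toReal - r| ≤ C * r ^ 2 := by
  exact ⟨14, by norm_num, 1 / 10, by norm_num, by norm_num, fun _ hr hr1 => LoopAux.main_bounds hμ hr hr1⟩
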